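/- arXiv:1910.01912 — 7 statements merged into one kernel-verified Lean document; each statement's English description precedes it below -/
import Mathlib

section
/- Let d ≥ 1 and L ≥ 0 be integers and let M ≥ 1. There is a constant C = C(d, L, M) with the following property. Let K and ε be real numbers with 0 < ε ≤ 1 and Kε ≥ 1. Let f : ℝ^d → ℝ be smooth and let g : ℝ^d → ℝ be smooth and compactly supported. Assume that ‖∇f(x)‖ ≥ 1 for every x in the support of g, and that for every integer j with 2 ≤ j ≤ L+1 and every x in the support of g one has ‖∇^j f(x)‖ ≤ M ε^{1−j}. Then |∫_{ℝ^d} e^{i K f(x)} g(x) dx| ≤ C (Kε)^{−L} Σ_{l=0}^{L} ε^l ∫_{ℝ^d} ‖∇^l g(x)‖ dx. -/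
open MeasureTheory Complex
open scoped ENNReal

/-- A smooth function that is homogeneous of degree `-1` outside the ball of radius `1/2` has
bounded derivatives outside the unit ball. -/
theorem exists_norm_iteratedFDeriv_le_of_homogeneous {W : Type*} [NormedAddCommGroup W]
    [NormedSpace ℝ W] [FiniteDimensional ℝ W] {F : W → ℝ} (hF : ContDiff ℝ (⊤ : ℕ∞) F)
    (hom : ∀ z, 1 / 2 < ‖z‖ → ∀ r : ℝ, 1 ≤ r → F (r • z) = r⁻¹ * F z) (n : ℕ) :
    ∃ C, ∀ y, 1 ≤ ‖y‖ → ‖iteratedFDeriv ℝ n F y‖ ≤ C := by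
  have hn : ((n : ℕ∞) : WithTop ℕ∞) ≤ ((⊤ : ℕ∞) : WithTop ℕ∞) := by exact_mod_cast le_top
  obtain ⟨C, hC⟩ := (isCompact_sphere (0 : W) 1).exists_bound_of_continuousOn
    (hF.continuous_iteratedFDeriv (m := n) hn).continuousOn
  refine ⟨C, fun y hy => ?_⟩
  set r := ‖y‖
  have hr : 0 < r := by positivity
  set z := r⁻¹ • y
  have hz : ‖z‖ = 1 := by
    rw [norm_smul, norm_inv, Real.norm_of_nonneg hr.le, inv_mul_cancel₀ hr.ne']
  have hrz : r • z = y := by simp [z, smul_smul, hr.ne']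
  have hev : (fun w => F (r • w)) =ᶠ[nhds z] (r⁻¹ • F) := by
    have : ∀ᶠ w in nhds z, 1 / 2 < ‖w‖ :=
      continuous_norm.continuousAt.eventually_const_lt (by norm_num [hz])
    filter_upwards [this] with w hw
    simpa using hom w hw r hy
  have h1 := (hev.iteratedFDeriv ℝ n).eq_of_nhds
  rw [iteratedFDeriv_comp_const_smul (i := n) r (hF.of_le hn),
    iteratedFDeriv_const_smul_apply (hF.of_le hn).contDiffAt] at h1
  beta_reduce at h1
  rw [hrz] at h1
  have h2 := congrArg norm h1
  rw [norm_smul, norm_smul, norm_pow, norm_inv, Real.norm_of_nonneg hr.le] at h2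
  have h3 := hC z (by simp [hz])
  calc ‖iteratedFDeriv ℝ n F y‖ ≤ r ^ n * ‖iteratedFDeriv ℝ n F y‖ :=
        le_mul_of_one_le_left (norm_nonneg _) (one_le_pow₀ hy)
    _ = r⁻¹ * ‖iteratedFDeriv ℝ n F z‖ := h2
    _ ≤ ‖iteratedFDeriv ℝ n F z‖ :=
        mul_le_of_le_one_left (norm_nonneg _) (inv_le_one_of_one_le₀ hy)
    _ ≤ C := h3

/-- There are smooth functions `F i` on the dual of a finite-dimensional space, with bounded
derivatives outside the unit ball, such that `∑ i, F i φ * φ (b i) = 1` there. -/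
theorem exists_contDiff_dual_reciprocal {ι E : Type*} [Fintype ι] [NormedAddCommGroup E]
    [NormedSpace ℝ E] [FiniteDimensional ℝ E] (b : Module.Basis ι ℝ E) :
    ∃ F : ι → (E →L[ℝ] ℝ) → ℝ, (∀ i, ContDiff ℝ (⊤ : ℕ∞) (F i)) ∧
      (∀ φ, 1 ≤ ‖φ‖ → ∑ i, F i φ * φ (b i) = 1) ∧
      ∀ n : ℕ, ∃ C, ∀ i, ∀ k ≤ n, ∀ φ, 1 ≤ ‖φ‖ → ‖iteratedFDeriv ℝ k (F i) φ‖ ≤ C := by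
  let Q : (E →L[ℝ] ℝ) → ℝ := fun φ => ∑ j, φ (b j) ^ 2
  have hQ : ContDiff ℝ (⊤ : ℕ∞) Q := by fun_prop
  have hQ0 : ∀ φ, φ ≠ 0 → Q φ ≠ 0 := by
    intro φ hφ h0
    rw [Finset.sum_eq_zero_iff_of_nonneg (fun _ _ => sq_nonneg _)] at h0
    refine hφ (ContinuousLinearMap.coe_injective (b.ext fun i => ?_))
    simpa using h0 i (Finset.mem_univ i)
  let χ : ContDiffBump (0 : E →L[ℝ] ℝ) := ⟨1 / 4, 1 / 2, by norm_num, by norm_num⟩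
  let F : ι → (E →L[ℝ] ℝ) → ℝ := fun i φ => (1 - χ φ) * (φ (b i) / Q φ)
  have hχ : ∀ φ : E →L[ℝ] ℝ, 1 / 2 < ‖φ‖ → χ φ = 0 := fun φ hφ =>
    χ.zero_of_le_dist (by simpa [χ] using hφ.le)
  have hFs : ∀ i, ContDiff ℝ (⊤ : ℕ∞) (F i) := by
    intro i
    rw [contDiff_iff_contDiffAt]
    intro φ
    by_cases hφ : φ = 0
    · subst hφ
      refine (contDiffAt_const (c := (0 : ℝ))).congr_of_eventuallyEq ?_
      filter_upwards [χ.eventuallyEq_one] with ψ hψ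
      simp [F, hψ]
    · refine (contDiffAt_const.sub χ.contDiff.contDiffAt).mul
        (ContDiffAt.div ?_ hQ.contDiffAt (hQ0 φ hφ))
      fun_prop
  have hhom : ∀ i z, 1 / 2 < ‖z‖ → ∀ r : ℝ, 1 ≤ r → F i (r • z) = r⁻¹ * F i z := by
    intro i z hz r hr
    have hr0 : 0 < r := by linarith
    have hrz : 1 / 2 < ‖r • z‖ := by
      rw [norm_smul, Real.norm_of_nonneg hr0.le]; nlinarith
    have hz0 : Q z ≠ 0 := hQ0 z (by rintro rfl; norm_num at hz)
    have hQr : Q (r • z) = r ^ 2 * Q z := by simp [Q, Finset.mul_sum, mul_pow]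
    simp only [F, hχ _ hz, hχ _ hrz, hQr]
    simp
    field_simp
  refine ⟨F, hFs, fun φ hφ => ?_, fun n => ?_⟩
  · have h0 := hQ0 φ (by rintro rfl; norm_num at hφ)
    simp only [F, hχ φ (by linarith), sub_zero, one_mul, div_mul_eq_mul_div, ← Finset.sum_div]
    rw [div_eq_one_iff_eq h0]
    exact Finset.sum_congr rfl fun i _ => by ring
  · choose C hC using fun i k => exists_norm_iteratedFDeriv_le_of_homogeneous (hFs i) (hhom i) k
    refine ⟨∑ i, ∑ k ∈ Finset.range (n + 1), |C i k|, fun i k hk φ hφ => ?_⟩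
    calc _ ≤ |C i k| := (hC i k φ hφ).trans (le_abs_self _)
      _ ≤ ∑ k ∈ Finset.range (n + 1), |C i k| :=
          Finset.single_le_sum (f := fun k => |C i k|) (fun _ _ => abs_nonneg _)
            (Finset.mem_range.2 (by omega))
      _ ≤ _ := Finset.single_le_sum (f := fun i => ∑ k ∈ Finset.range (n + 1), |C i k|)
            (fun _ _ => by positivity) (Finset.mem_univ i)

/-- The divergence `∑ i, ∂ᵢ (g vᵢ)` of the vector field `g v` in the coordinates of `b`. -/
noncomputable def weightedDivergence {ι E : Type*} [Fintype ι] [NormedAddCommGroup E]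
    [NormedSpace ℝ E] (b : ι → E) (v : ι → E → ℝ) (g : E → ℝ) (x : E) : ℝ :=
  ∑ i, fderiv ℝ (fun y => v i y * g y) x (b i)

section

variable {ι E : Type*} [Fintype ι] [NormedAddCommGroup E] [NormedSpace ℝ E]
  {b : ι → E} {v : ι → E → ℝ} {g : E → ℝ}

theorem contDiff_weightedDivergence (hv : ∀ i, ContDiff ℝ (⊤ : ℕ∞) (v i))
    (hg : ContDiff ℝ (⊤ : ℕ∞) g) : ContDiff ℝ (⊤ : ℕ∞) (weightedDivergence b v g) := by
  refine ContDiff.sum fun i _ => ?_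
  exact (((hv i).mul hg).fderiv_right (m := (⊤ : ℕ∞)) (by simp)).clm_apply contDiff_const

theorem tsupport_weightedDivergence_subset :
    tsupport (weightedDivergence b v g) ⊆ tsupport g := by
  refine closure_minimal (fun x hx => ?_) (isClosed_tsupport g)
  by_contra hxg
  refine hx (Finset.sum_eq_zero fun i _ => ?_)
  have : x ∉ tsupport (fderiv ℝ (fun y => v i y * g y) · (b i)) := fun h =>
    hxg (tsupport_mul_subset_right (tsupport_fderiv_apply_subset ℝ (b i) h))
  exact image_eq_zero_of_notMem_tsupport
    (f := fun x => fderiv ℝ (fun y => v i y * g y) x (b i)) this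

theorem norm_iteratedFDeriv_weightedDivergence_le (hv : ∀ i, ContDiff ℝ (⊤ : ℕ∞) (v i))
    (hg : ContDiff ℝ (⊤ : ℕ∞) g) {A ε : ℝ} (hε : 0 < ε) {m : ℕ} {x : E}
    (hA : ∀ i, ∀ k ≤ m + 1, ‖iteratedFDeriv ℝ k (v i) x‖ ≤ A * ε⁻¹ ^ k) :
    ε ^ m * ‖iteratedFDeriv ℝ m (weightedDivergence b v g) x‖ ≤
      (∑ i, ‖b i‖) * 2 ^ (m + 1) * A * ε⁻¹ *
        ∑ l ∈ Finset.range (m + 2), ε ^ l * ‖iteratedFDeriv ℝ l g x‖ := by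
  have hle : ∀ n : ℕ, (n : WithTop ℕ∞) ≤ ((⊤ : ℕ∞) : WithTop ℕ∞) := fun n => by
    exact_mod_cast (le_top : (n : ℕ∞) ≤ ⊤)
  set N := ∑ l ∈ Finset.range (m + 2), ε ^ l * ‖iteratedFDeriv ℝ l g x‖
  have hterm : ∀ i, ‖iteratedFDeriv ℝ (m + 1) (fun y => v i y * g y) x‖ ≤
      2 ^ (m + 1) * A * ε⁻¹ ^ (m + 1) * N := by
    intro i
    have hA0 : 0 ≤ A := by
      simpa using (norm_nonneg _).trans (hA i 0 (by omega))
    refine (norm_iteratedFDeriv_mul_le (hv i) hg x (hle (m + 1))).trans ?_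
    have h2 : (2 : ℝ) ^ (m + 1) = ∑ k ∈ Finset.range (m + 1 + 1), ((m + 1).choose k : ℝ) := by
      exact_mod_cast (Nat.sum_range_choose (m + 1)).symm
    rw [h2, Finset.sum_mul, Finset.sum_mul, Finset.sum_mul]
    refine Finset.sum_le_sum fun k hk => ?_
    have hk' : k ≤ m + 1 := by simpa [Nat.lt_succ_iff] using hk
    have hs : ε ^ (m + 1 - k) * ‖iteratedFDeriv ℝ (m + 1 - k) g x‖ ≤ N :=
      Finset.single_le_sum (f := fun l => ε ^ l * ‖iteratedFDeriv ℝ l g x‖)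
        (fun _ _ => by positivity) (Finset.mem_range.2 (by omega))
    have hpow : ε⁻¹ ^ k = ε⁻¹ ^ (m + 1) * ε ^ (m + 1 - k) := by
      conv_rhs => rw [← Nat.add_sub_cancel' hk', pow_add, Nat.add_sub_cancel_left, mul_assoc,
        ← mul_pow, inv_mul_cancel₀ hε.ne', one_pow, mul_one]
    calc _ ≤ ((m + 1).choose k : ℝ) * (A * ε⁻¹ ^ k) * ‖iteratedFDeriv ℝ (m + 1 - k) g x‖ := by
          gcongr; exact hA i k hk'
      _ = ((m + 1).choose k : ℝ) * A * ε⁻¹ ^ (m + 1) *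
            (ε ^ (m + 1 - k) * ‖iteratedFDeriv ℝ (m + 1 - k) g x‖) := by rw [hpow]; ring
      _ ≤ _ := by gcongr
  have hw : ∀ i, ContDiff ℝ (⊤ : ℕ∞) (fderiv ℝ (fun y => v i y * g y)) := fun i =>
    ((hv i).mul hg).fderiv_right (m := (⊤ : ℕ∞)) (by simp)
  have hsum : ‖iteratedFDeriv ℝ m (weightedDivergence b v g) x‖ ≤
      ∑ i, ‖b i‖ * (2 ^ (m + 1) * A * ε⁻¹ ^ (m + 1) * N) := by
    have : weightedDivergence b v g =
        ∑ i, fun x => fderiv ℝ (fun y => v i y * g y) x (b i) := by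
      ext; simp [weightedDivergence]
    rw [this, iteratedFDeriv_sum_apply
      (fun i _ => (((hw i).clm_apply contDiff_const).of_le (hle m)).contDiffAt)]
    refine (norm_sum_le _ _).trans (Finset.sum_le_sum fun i _ => ?_)
    refine (norm_iteratedFDeriv_clm_apply_const (hw i).contDiffAt (hle m)).trans ?_
    rw [norm_iteratedFDeriv_fderiv]
    gcongr
    exact hterm i
  calc _ ≤ ε ^ m * ∑ i, ‖b i‖ * (2 ^ (m + 1) * A * ε⁻¹ ^ (m + 1) * N) := by gcongr
    _ = (ε ^ m * ε⁻¹ ^ m) * ((∑ i, ‖b i‖) * 2 ^ (m + 1) * A * ε⁻¹ * N) := by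
        rw [← Finset.sum_mul]; ring
    _ = _ := by rw [← mul_pow, mul_inv_cancel₀ hε.ne', one_pow, one_mul]

theorem sum_norm_iteratedFDeriv_weightedDivergence_le (hv : ∀ i, ContDiff ℝ (⊤ : ℕ∞) (v i))
    (hg : ContDiff ℝ (⊤ : ℕ∞) g) {A ε : ℝ} (hA0 : 0 ≤ A) (hε : 0 < ε) {n : ℕ}
    (hA : ∀ x ∈ tsupport g, ∀ i, ∀ k ≤ n + 1, ‖iteratedFDeriv ℝ k (v i) x‖ ≤ A * ε⁻¹ ^ k)
    (x : E) :
    ∑ m ∈ Finset.range (n + 1), ε ^ m * ‖iteratedFDeriv ℝ m (weightedDivergence b v g) x‖ ≤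
      (n + 1) * (∑ i, ‖b i‖) * 2 ^ (n + 1) * A * ε⁻¹ *
        ∑ l ∈ Finset.range (n + 2), ε ^ l * ‖iteratedFDeriv ℝ l g x‖ := by
  by_cases hx : x ∈ tsupport g
  · have : ∀ m ∈ Finset.range (n + 1),
        ε ^ m * ‖iteratedFDeriv ℝ m (weightedDivergence b v g) x‖ ≤
        (∑ i, ‖b i‖) * 2 ^ (n + 1) * A * ε⁻¹ *
          ∑ l ∈ Finset.range (n + 2), ε ^ l * ‖iteratedFDeriv ℝ l g x‖ := by
      intro m hm
      have hm' : m ≤ n := by simpa [Nat.lt_succ_iff] using hm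
      refine (norm_iteratedFDeriv_weightedDivergence_le hv hg hε
        fun i k hk => hA x hx i k (by omega)).trans ?_
      gcongr
      norm_num
    refine (Finset.sum_le_card_nsmul _ _ _ this).trans_eq ?_
    simp only [Finset.card_range, nsmul_eq_mul]
    push_cast
    ring
  · have : ∀ m, iteratedFDeriv ℝ m (weightedDivergence b v g) x = 0 := fun m =>
      image_eq_zero_of_notMem_tsupport fun h =>
        hx (tsupport_weightedDivergence_subset (tsupport_iteratedFDeriv_subset m h))
    simp only [this, norm_zero, mul_zero, Finset.sum_const_zero]
    positivity

variable [FiniteDimensional ℝ E] [MeasurableSpace E] [BorelSpace E]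

theorem integral_exp_mul_eq_neg_integral_weightedDivergence (μ : Measure E) [μ.IsAddHaarMeasure]
    {f : E → ℝ} (K : ℝ) (hf : ContDiff ℝ (⊤ : ℕ∞) f) (hv : ∀ i, ContDiff ℝ (⊤ : ℕ∞) (v i))
    (hg : ContDiff ℝ (⊤ : ℕ∞) g) (hgc : HasCompactSupport g)
    (hvf : ∀ x ∈ tsupport g, ∑ i, v i x * fderiv ℝ f x (b i) = 1) :
    (I * K) * ∫ x, exp (I * ((K * f x : ℝ) : ℂ)) * (g x : ℂ) ∂μ =
      -∫ x, exp (I * ((K * f x : ℝ) : ℂ)) * (weightedDivergence b v g x : ℂ) ∂μ := by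
  set e : E → ℂ := fun x => exp (I * ((K * f x : ℝ) : ℂ)) with he
  have hes : ContDiff ℝ (⊤ : ℕ∞) e :=
    (contDiff_const.mul (ofRealCLM.contDiff.comp (contDiff_const.mul hf))).cexp
  have hde : ∀ x w, fderiv ℝ e x w = e x * (I * K * (fderiv ℝ f x w : ℝ)) := by
    intro x w
    have hfx : HasFDerivAt f (fderiv ℝ f x) x :=
      (hf.differentiable (by simp) x).hasFDerivAt
    have h1 := ((ofRealCLM.hasFDerivAt.comp x (hfx.const_mul K)).const_mul I).cexp
    have h2 : fderiv ℝ e x = _ := h1.fderiv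
    rw [h2]
    simp [e]
    ring
  let h : ι → E → ℝ := fun i y => v i y * g y
  have hhs : ∀ i, ContDiff ℝ (⊤ : ℕ∞) (h i) := fun i => (hv i).mul hg
  have hhc : ∀ i, HasCompactSupport (h i) := fun i => hgc.mul_left
  let H : ι → E → ℂ := fun i y => (h i y : ℂ)
  have hHs : ∀ i, ContDiff ℝ (⊤ : ℕ∞) (H i) := fun i => ofRealCLM.contDiff.comp (hhs i)
  have hHc : ∀ i, HasCompactSupport (H i) := fun i => (hhc i).comp_left ofReal_zero
  have hdH : ∀ i x w, fderiv ℝ (H i) x w = (fderiv ℝ (h i) x w : ℝ) := by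
    intro i x w
    have hx : HasFDerivAt (h i) (fderiv ℝ (h i) x) x :=
      ((hhs i).differentiable (by simp) x).hasFDerivAt
    have h2 : fderiv ℝ (H i) x = _ := (ofRealCLM.hasFDerivAt.comp x hx).fderiv
    rw [h2]
    simp
  have hcd : ∀ {u : E → ℂ}, ContDiff ℝ (⊤ : ℕ∞) u → ∀ w, Continuous fun x => fderiv ℝ u x w :=
    fun hu w => (hu.continuous_fderiv (by simp)).clm_apply continuous_const
  have hint1 : ∀ i, Integrable (fun x => fderiv ℝ (H i) x (b i) * e x) μ := fun i =>
    ((hcd (hHs i) _).mul hes.continuous).integrable_of_hasCompactSupport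
      ((hHc i).fderiv_apply ℝ (b i)).mul_right
  have hint2 : ∀ i, Integrable (fun x => H i x * fderiv ℝ e x (b i)) μ := fun i =>
    ((hHs i).continuous.mul (hcd hes _)).integrable_of_hasCompactSupport (hHc i).mul_right
  have hint3 : ∀ i, Integrable (fun x => H i x * e x) μ := fun i =>
    ((hHs i).continuous.mul hes.continuous).integrable_of_hasCompactSupport (hHc i).mul_right
  have hparts := fun i => integral_mul_fderiv_eq_neg_fderiv_mul_of_integrable (μ := μ)
    (hint1 i) (hint2 i) (hint3 i) (fun x _ => (hHs i).differentiable (by simp) x)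
    (fun x _ => hes.differentiable (by simp) x)
  calc (I * K) * ∫ x, e x * (g x : ℂ) ∂μ
      = ∫ x, ∑ i, H i x * fderiv ℝ e x (b i) ∂μ := by
        rw [← integral_const_mul]
        refine integral_congr_ae (.of_forall fun x => ?_)
        by_cases hx : x ∈ tsupport g
        · have h1 : ((∑ i, v i x * fderiv ℝ f x (b i) : ℝ) : ℂ) = 1 := by
            rw [hvf x hx, ofReal_one]
          calc I * K * (e x * (g x : ℂ))
              = I * K * (e x * (g x : ℂ)) * ((∑ i, v i x * fderiv ℝ f x (b i) : ℝ) : ℂ) := by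
                rw [h1, mul_one]
            _ = _ := by
                push_cast
                rw [Finset.mul_sum]
                refine Finset.sum_congr rfl fun i _ => ?_
                simp only [H, h, hde]
                push_cast
                ring
        · simp [H, h, image_eq_zero_of_notMem_tsupport hx]
    _ = -∫ x, ∑ i, fderiv ℝ (H i) x (b i) * e x ∂μ := by
        rw [integral_finsetSum _ fun i _ => hint2 i, integral_finsetSum _ fun i _ => hint1 i,
          ← Finset.sum_neg_distrib]
        exact Finset.sum_congr rfl fun i _ => hparts i
    _ = _ := by
        congr 1
        refine integral_congr_ae (.of_forall fun x => ?_)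
        simp only [weightedDivergence, hdH, h, ← Finset.sum_mul, ofReal_sum, he]
        ring

end

theorem norm_iteratedFDeriv_comp_fderiv_le {E : Type*} [NormedAddCommGroup E] [NormedSpace ℝ E]
    {F : (E →L[ℝ] ℝ) → ℝ} {f : E → ℝ} (hF : ContDiff ℝ (⊤ : ℕ∞) F)
    (hf : ContDiff ℝ (⊤ : ℕ∞) f) {C M ε : ℝ} (hM : 1 ≤ M) (hε : 0 < ε) {n : ℕ} {x : E}
    (hC : ∀ k ≤ n, ‖iteratedFDeriv ℝ k F (fderiv ℝ f x)‖ ≤ C)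
    (hfx : ∀ j : ℕ, 2 ≤ j → j ≤ n + 1 →
      ‖iteratedFDeriv ℝ j f x‖ ≤ M * ε ^ (1 - (j : ℤ))) {k : ℕ} (hk : k ≤ n) :
    ‖iteratedFDeriv ℝ k (fun y => F (fderiv ℝ f y)) x‖ ≤ n.factorial * C * M ^ n * ε⁻¹ ^ k := by
  have hC0 : 0 ≤ C := (norm_nonneg _).trans (hC 0 (Nat.zero_le n))
  have h := norm_iteratedFDeriv_comp_le (n := k) hF (hf.fderiv_right (m := (⊤ : ℕ∞)) (by simp))
    (by exact_mod_cast (le_top : (k : ℕ∞) ≤ ⊤)) x (fun i hi => hC i (hi.trans hk))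
    (D := M * ε⁻¹) fun i h1 hi => by
      have hz : (1 : ℤ) - ((i + 1 : ℕ) : ℤ) = -(i : ℤ) := by push_cast; ring
      rw [norm_iteratedFDeriv_fderiv, mul_pow]
      refine (hfx (i + 1) (by omega) (by omega)).trans ?_
      rw [hz, zpow_neg, zpow_natCast, ← inv_pow]
      gcongr
      exact le_self_pow₀ hM (by omega)
  refine h.trans ?_
  rw [mul_pow, ← mul_assoc]
  gcongr

/-- Nonstationary phase lemma (Lemma 6.1 of [Zh], integration by parts in phase space):
if `‖∇f‖ ≥ 1` on the support of `g` and the higher derivatives of `f` satisfy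
`‖∇ʲf‖ ≤ M ε^{1-j}` there, then the oscillatory integral `∫ e^{iKf} g` is bounded by
`C (Kε)^{-L} ∑_{l ≤ L} ε^l ‖∇ˡ g‖_{L¹}`. -/
theorem stmt0 (d L : ℕ) (hd : 1 ≤ d) (M : ℝ) (hM : 1 ≤ M) :
    ∃ C : ℝ, 0 < C ∧
      ∀ K ε : ℝ, 0 < ε → ε ≤ 1 → 1 ≤ K * ε →
      ∀ f g : EuclideanSpace ℝ (Fin d) → ℝ,
        ContDiff ℝ (⊤ : ℕ∞) f → ContDiff ℝ (⊤ : ℕ∞) g → HasCompactSupport g →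
        (∀ x ∈ tsupport g, 1 ≤ ‖fderiv ℝ f x‖) →
        (∀ j : ℕ, 2 ≤ j → j ≤ L + 1 → ∀ x ∈ tsupport g,
          ‖iteratedFDeriv ℝ j f x‖ ≤ M * ε ^ (1 - (j : ℤ))) →
        ‖∫ x : EuclideanSpace ℝ (Fin d),
            Complex.exp (Complex.I * ((K * f x : ℝ) : ℂ)) * ((g x : ℝ) : ℂ)‖ ≤
          C * (K * ε) ^ (-(L : ℤ)) *
            ∑ l ∈ Finset.range (L + 1),
              ε ^ l * ∫ x : EuclideanSpace ℝ (Fin d), ‖iteratedFDeriv ℝ l g x‖ := by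
  induction L with
  | zero =>
    refine ⟨1, one_pos, fun K ε _ _ _ f g _ _ _ _ _ => ?_⟩
    refine (norm_integral_le_integral_norm _).trans_eq ?_
    simp [Complex.norm_exp]
  | succ L ih =>
    obtain ⟨C, hC0, hC⟩ := ih
    let b := (EuclideanSpace.basisFun (Fin d) ℝ).toBasis
    obtain ⟨F, hFs, hF1, hFb⟩ := exists_contDiff_dual_reciprocal b
    obtain ⟨CF, hCF⟩ := hFb (L + 1)
    set A : ℝ := (L + 1).factorial * |CF| * M ^ (L + 1)
    set B : ℝ := (L + 1) * (∑ i, ‖b i‖) * 2 ^ (L + 1) * A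
    have hA0 : 0 ≤ A := by positivity
    have hB0 : 0 ≤ B := by positivity
    refine ⟨C * (B + 1), by positivity, fun K ε hε hε1 hKε f g hf hg hgc hf1 hfj => ?_⟩
    have hK : 0 < K := pos_of_mul_pos_left (one_pos.trans_le hKε) hε.le
    let v : Fin d → EuclideanSpace ℝ (Fin d) → ℝ := fun i y => F i (fderiv ℝ f y)
    have hv : ∀ i, ContDiff ℝ (⊤ : ℕ∞) (v i) := fun i =>
      (hFs i).comp (hf.fderiv_right (by simp))
    have hvb : ∀ x ∈ tsupport g, ∀ i, ∀ k ≤ L + 1,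
        ‖iteratedFDeriv ℝ k (v i) x‖ ≤ A * ε⁻¹ ^ k := fun x hx i k hk =>
      norm_iteratedFDeriv_comp_fderiv_le (hFs i) hf hM hε
        (fun k hk => (hCF i k hk _ (hf1 x hx)).trans (le_abs_self _))
        (fun j h2 hj => hfj j h2 hj x hx) hk
    set T := weightedDivergence b v g
    have hTs : ContDiff ℝ (⊤ : ℕ∞) T := contDiff_weightedDivergence hv hg
    have hTsub : tsupport T ⊆ tsupport g := tsupport_weightedDivergence_subset
    have hTc : HasCompactSupport T := hgc.of_isClosed_subset (isClosed_tsupport _) hTsub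
    have hint : ∀ {u : EuclideanSpace ℝ (Fin d) → ℝ}, ContDiff ℝ (⊤ : ℕ∞) u →
        HasCompactSupport u → ∀ l : ℕ,
        Integrable (fun x => ε ^ l * ‖iteratedFDeriv ℝ l u x‖) := fun hu huc l =>
      ((hu.continuous_iteratedFDeriv (by exact_mod_cast (le_top : (l : ℕ∞) ≤ ⊤))
        ).norm.integrable_of_hasCompactSupport (huc.iteratedFDeriv l).norm).const_mul _
    have hsum : ∑ l ∈ Finset.range (L + 1), ε ^ l * ∫ x, ‖iteratedFDeriv ℝ l T x‖ ≤
        B * ε⁻¹ * ∑ l ∈ Finset.range (L + 2), ε ^ l * ∫ x, ‖iteratedFDeriv ℝ l g x‖ := by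
      simp only [← integral_const_mul]
      rw [← integral_finsetSum _ fun l _ => hint hTs hTc l,
        ← integral_finsetSum _ fun l _ => hint hg hgc l, ← integral_const_mul]
      exact integral_mono (integrable_finsetSum _ fun l _ => hint hTs hTc l)
        ((integrable_finsetSum _ fun l _ => hint hg hgc l).const_mul _)
        (sum_norm_iteratedFDeriv_weightedDivergence_le hv hg hA0 hε hvb)
    have hparts := congrArg norm (integral_exp_mul_eq_neg_integral_weightedDivergence
      (b := b) (v := v) volume K hf hv hg hgc fun x hx => hF1 _ (hf1 x hx))
    rw [norm_mul, norm_neg, norm_mul, norm_I, one_mul, norm_real, Real.norm_of_nonneg hK.le]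
      at hparts
    have hT := hC K ε hε hε1 hKε f T hf hTs hTc (fun x hx => hf1 x (hTsub hx))
      fun j h2 hj x hx => hfj j h2 (by omega) x (hTsub hx)
    set S := ∑ l ∈ Finset.range (L + 2), ε ^ l * ∫ x, ‖iteratedFDeriv ℝ l g x‖
    have hS0 : 0 ≤ S := Finset.sum_nonneg fun l _ =>
      mul_nonneg (by positivity) (integral_nonneg fun _ => norm_nonneg _)
    have hzpow : (K * ε) ^ (-((L + 1 : ℕ) : ℤ)) = (K * ε) ^ (-(L : ℤ)) * ε⁻¹ * K⁻¹ := by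
      push_cast
      rw [neg_add, zpow_add₀ (by positivity), zpow_neg_one, mul_inv]
      ring
    have hP : 0 ≤ (K * ε) ^ (-(L : ℤ)) := by positivity
    rw [← mul_le_mul_iff_right₀ hK, hparts]
    calc _ ≤ _ := hT
      _ ≤ C * (K * ε) ^ (-(L : ℤ)) * (B * ε⁻¹ * S) := by gcongr
      _ ≤ C * (K * ε) ^ (-(L : ℤ)) * ((B + 1) * ε⁻¹ * S) := by gcongr; linarith
      _ = K * (C * (B + 1) * (K * ε) ^ (-((L + 1 : ℕ) : ℤ)) * S) := by
        rw [hzpow]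
        field_simp
end

section
/- Let d ≥ 1 and L ≥ 1 be integers and let M ≥ 1 and A > 0. There is a constant C = C(d, L, M) with the following property. Let r ≥ 2 and 0 < ε ≤ 1 satisfy rε ≥ 2. Let f : ℝ^d → ℝ be smooth and let g : ℝ^d → ℝ be smooth and compactly supported. Assume: (a) ‖∇f(ξ)‖ ≤ r/2 for every ξ in the support of g; (b) for every integer j with 2 ≤ j ≤ L + d + 1 and every ξ in the support of g, ‖∇^j f(ξ)‖ ≤ M r ε^{1−j}; (c) for every integer j with 0 ≤ j ≤ L + d, ∫_{ℝ^d} ‖∇^j g(ξ)‖ dξ ≤ A ε^{−j}. Define 𝒦(x) = ∫_{ℝ^d} e^{i(x·ξ + f(ξ))} g(ξ) dξ. Then ∫_{‖x‖ > r} |𝒦(x)| dx ≤ C A r^{−L} ε^{−L−d}. -/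
open MeasureTheory Complex
open scoped ENNReal RealInnerProductSpace

/-- Leibniz bound for the derivatives of a product. -/
theorem abs_iteratedDeriv_mul_le {a b : ℝ → ℝ} {x S C : ℝ} {n : ℕ}
    (ha : ContDiffAt ℝ n a x) (hb : ContDiffAt ℝ n b x)
    (hS : ∀ k ≤ n, |iteratedDeriv k a x| ≤ S) (hC : ∀ k ≤ n, |iteratedDeriv k b x| ≤ C) :
    |iteratedDeriv n (fun t => a t * b t) x| ≤ 2 ^ n * (S * C) := by
  have hS0 : 0 ≤ S := (abs_nonneg _).trans (hS 0 n.zero_le)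
  rw [iteratedDeriv_fun_mul ha hb]
  calc _ ≤ ∑ i ∈ Finset.range (n + 1), (n.choose i : ℝ) * (S * C) := by
        refine (Finset.abs_sum_le_sum_abs _ _).trans (Finset.sum_le_sum fun i hi => ?_)
        have hi' : i ≤ n := Nat.lt_succ_iff.1 (Finset.mem_range.1 hi)
        rw [abs_mul, abs_mul, Nat.abs_cast, mul_assoc]
        gcongr
        · exact hS i hi'
        · exact hC _ (Nat.sub_le _ _)
    _ = 2 ^ n * (S * C) := by
        rw [← Finset.sum_mul, ← Nat.cast_sum, Nat.sum_range_choose]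
        push_cast
        rfl

/-- The derivatives of `1 / q` are controlled by those of `q` where `q ≥ 1 / 2`. -/
theorem exists_abs_iteratedDeriv_inv_le (M : ℝ) (n : ℕ) :
    ∃ C : ℝ, 0 ≤ C ∧ ∀ (q : ℝ → ℝ) (x : ℝ), ContDiffAt ℝ n q x → 1 / 2 ≤ q x →
      (∀ k, 1 ≤ k → k ≤ n → |iteratedDeriv k q x| ≤ M) →
      ∀ k ≤ n, |iteratedDeriv k (fun t => (q t)⁻¹) x| ≤ C := by
  induction n with
  | zero =>
    refine ⟨2, by norm_num, fun q x _ hq _ k hk => ?_⟩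
    obtain rfl : k = 0 := by omega
    rw [iteratedDeriv_zero, abs_inv, abs_of_nonneg (by linarith)]
    exact inv_le_of_inv_le₀ (by norm_num) (by linarith)
  | succ n ih =>
    obtain ⟨C, hC, h⟩ := ih
    refine ⟨max C (2 * (2 ^ (n + 1) * (M * C))), le_max_of_le_left hC,
      fun q x hsm hq hM k hk => ?_⟩
    have hprev := h q x (hsm.of_le (by exact_mod_cast n.le_succ)) hq
      fun k h1 h2 => hM k h1 (h2.trans n.le_succ)
    have hM0 : 0 ≤ M := (abs_nonneg _).trans (hM 1 le_rfl (by omega))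
    rcases Nat.lt_or_ge n k with hnk | hnk
    · obtain rfl : k = n + 1 := by omega
      refine le_max_of_le_right ?_
      have hq0 : q x ≠ 0 := by linarith
      have hone : iteratedDeriv (n + 1) (fun t => q t * (q t)⁻¹) x = 0 := by
        have hev : (fun t => q t * (q t)⁻¹) =ᶠ[nhds x] fun _ => (1 : ℝ) := by
          filter_upwards [hsm.continuousAt.eventually_ne hq0] with t ht
          exact mul_inv_cancel₀ ht
        rw [hev.iteratedDeriv_eq, iteratedDeriv_succ']
        simp
      rw [iteratedDeriv_fun_mul hsm (show ContDiffAt ℝ _ (fun t => (q t)⁻¹) x from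
        hsm.inv hq0), Finset.sum_range_succ'] at hone
      simp only [Nat.choose_zero_right, Nat.cast_one, one_mul, iteratedDeriv_zero,
        Nat.sub_zero] at hone
      set T := ∑ i ∈ Finset.range (n + 1), ((n + 1).choose (i + 1) : ℝ) *
        iteratedDeriv (i + 1) q x * iteratedDeriv (n + 1 - (i + 1)) (fun t => (q t)⁻¹) x with hT
      have hTle : |T| ≤ 2 ^ (n + 1) * (M * C) := by
        calc |T| ≤ ∑ i ∈ Finset.range (n + 1), ((n + 1).choose (i + 1) : ℝ) * (M * C) := by
              refine (Finset.abs_sum_le_sum_abs _ _).trans (Finset.sum_le_sum fun i hi => ?_)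
              have hi' : i + 1 ≤ n + 1 := Finset.mem_range.1 hi
              rw [abs_mul, abs_mul, Nat.abs_cast, mul_assoc]
              gcongr
              · exact hM _ (by omega) hi'
              · exact hprev _ (by omega)
          _ ≤ ∑ i ∈ Finset.range (n + 1 + 1), ((n + 1).choose i : ℝ) * (M * C) := by
              rw [Finset.sum_range_succ' _ (n + 1)]
              exact le_add_of_nonneg_right (by positivity)
          _ = 2 ^ (n + 1) * (M * C) := by
              rw [← Finset.sum_mul, ← Nat.cast_sum, Nat.sum_range_choose]
              push_cast
              rfl
      have hmul : |q x| * |iteratedDeriv (n + 1) (fun t => (q t)⁻¹) x| = |T| := by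
        rw [← abs_mul, ← abs_neg T]
        congr 1
        linarith
      rw [abs_of_nonneg (by linarith : 0 ≤ q x)] at hmul
      nlinarith [abs_nonneg (iteratedDeriv (n + 1) (fun t => (q t)⁻¹) x)]
    · exact (hprev k hnk).trans (le_max_left _ _)

section Line

variable {E : Type*} [NormedAddCommGroup E] [NormedSpace ℝ E]

theorem iteratedDeriv_comp_line {f : E → ℝ} (hf : ContDiff ℝ (⊤ : ℕ∞) f) (ξ v : E) (k : ℕ) :
    iteratedDeriv k (fun t : ℝ => f (ξ + t • v)) 0 = iteratedFDeriv ℝ k f ξ fun _ => v := by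
  have hg : ContDiff ℝ (⊤ : ℕ∞) fun η => f (ξ + η) := by fun_prop
  have h := (ContinuousLinearMap.toSpanSingleton ℝ v).iteratedFDeriv_comp_right hg 0 (i := k)
    (by exact_mod_cast le_top)
  rw [iteratedFDeriv_comp_add_left] at h
  have hcomp : (fun t : ℝ => f (ξ + t • v)) =
      (fun η => f (ξ + η)) ∘ ContinuousLinearMap.toSpanSingleton ℝ v := by
    ext t
    simp
  rw [iteratedDeriv_eq_iteratedFDeriv, hcomp, h]
  simp [ContinuousMultilinearMap.compContinuousLinearMap_apply]

theorem abs_iteratedDeriv_comp_line_le {f : E → ℝ} (hf : ContDiff ℝ (⊤ : ℕ∞) f) (ξ v : E)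
    (k : ℕ) :
    |iteratedDeriv k (fun t : ℝ => f (ξ + t • v)) 0| ≤ ‖v‖ ^ k * ‖iteratedFDeriv ℝ k f ξ‖ := by
  rw [iteratedDeriv_comp_line hf, ← Real.norm_eq_abs, mul_comm]
  simpa using (iteratedFDeriv ℝ k f ξ).le_opNorm fun _ => v

theorem lineDeriv_comp_line (u : E → ℝ) (ξ v : E) :
    (fun t : ℝ => lineDeriv ℝ u (ξ + t • v) v) = deriv fun t : ℝ => u (ξ + t • v) := by
  ext t
  have := deriv_comp_const_add (f := fun s : ℝ => u (ξ + s • v)) t 0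
  simp only [add_zero] at this
  rw [lineDeriv, ← this]
  simp only [add_smul, add_assoc]

/-- The amplitude produced by one integration by parts in direction `v`. -/
noncomputable def oscStep (q : E → ℝ) (v : E) (u : E → ℝ) (ξ : E) : ℝ :=
  lineDeriv ℝ (fun η => u η * (q η)⁻¹) ξ v

variable {q u g : E → ℝ} {v : E}

theorem contDiff_mul_inv (hq : ContDiff ℝ (⊤ : ℕ∞) q) (hu : ContDiff ℝ (⊤ : ℕ∞) u)
    (hne : ∀ ξ ∈ tsupport u, q ξ ≠ 0) :
    ContDiff ℝ (⊤ : ℕ∞) fun η => u η * (q η)⁻¹ := by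
  rw [contDiff_iff_contDiffAt]
  intro ξ
  by_cases hξ : ξ ∈ tsupport u
  · exact hu.contDiffAt.mul (hq.contDiffAt.inv (hne ξ hξ))
  · have : (fun η => u η * (q η)⁻¹) =ᶠ[nhds ξ] fun _ => (0 : ℝ) := by
      filter_upwards [notMem_tsupport_iff_eventuallyEq.1 hξ] with η hη
      simp [hη]
    exact contDiffAt_const.congr_of_eventuallyEq this

theorem oscStep_eq (hq : ContDiff ℝ (⊤ : ℕ∞) q) (hu : ContDiff ℝ (⊤ : ℕ∞) u)
    (hne : ∀ ξ ∈ tsupport u, q ξ ≠ 0) :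
    oscStep q v u = fun ξ => fderiv ℝ (fun η => u η * (q η)⁻¹) ξ v := by
  ext ξ
  exact (((contDiff_mul_inv hq hu hne).differentiable (by simp)) ξ).lineDeriv_eq_fderiv

theorem contDiff_oscStep (hq : ContDiff ℝ (⊤ : ℕ∞) q) (hu : ContDiff ℝ (⊤ : ℕ∞) u)
    (hne : ∀ ξ ∈ tsupport u, q ξ ≠ 0) : ContDiff ℝ (⊤ : ℕ∞) (oscStep q v u) := by
  rw [oscStep_eq hq hu hne]
  exact ((contDiff_mul_inv hq hu hne).fderiv_right (by simp)).clm_apply contDiff_const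

theorem tsupport_oscStep_subset (hq : ContDiff ℝ (⊤ : ℕ∞) q) (hu : ContDiff ℝ (⊤ : ℕ∞) u)
    (hne : ∀ ξ ∈ tsupport u, q ξ ≠ 0) : tsupport (oscStep q v u) ⊆ tsupport u := by
  rw [oscStep_eq hq hu hne]
  exact (tsupport_fderiv_apply_subset ℝ v).trans tsupport_mul_subset_left

theorem contDiff_oscStep_iterate (hq : ContDiff ℝ (⊤ : ℕ∞) q) (hg : ContDiff ℝ (⊤ : ℕ∞) g)
    (hne : ∀ ξ ∈ tsupport g, q ξ ≠ 0) (n : ℕ) :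
    ContDiff ℝ (⊤ : ℕ∞) ((oscStep q v)^[n] g) ∧ tsupport ((oscStep q v)^[n] g) ⊆ tsupport g := by
  induction n with
  | zero => exact ⟨hg, subset_rfl⟩
  | succ n ih =>
    rw [Function.iterate_succ_apply']
    have hne' : ∀ ξ ∈ tsupport ((oscStep q v)^[n] g), q ξ ≠ 0 := fun ξ hξ => hne ξ (ih.2 hξ)
    exact ⟨contDiff_oscStep hq ih.1 hne', (tsupport_oscStep_subset hq ih.1 hne').trans ih.2⟩

end Line

theorem exists_abs_iteratedDeriv_oscStep_iterate_le (M : ℝ) (N n : ℕ) :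
    ∃ C : ℝ, 0 ≤ C ∧ ∀ {E : Type*} [NormedAddCommGroup E] [NormedSpace ℝ E] (q g : E → ℝ)
      (v ξ : E) (S : ℝ), ContDiff ℝ (⊤ : ℕ∞) q → ContDiff ℝ (⊤ : ℕ∞) g →
      (∀ η ∈ tsupport g, q η ≠ 0) → 1 / 2 ≤ q ξ →
      (∀ k, 1 ≤ k → k ≤ N → |iteratedDeriv k (fun t : ℝ => q (ξ + t • v)) 0| ≤ M) →
      (∀ k ≤ N, |iteratedDeriv k (fun t : ℝ => g (ξ + t • v)) 0| ≤ S) →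
      ∀ k, n + k ≤ N →
        |iteratedDeriv k (fun t : ℝ => (oscStep q v)^[n] g (ξ + t • v)) 0| ≤ C * S := by
  obtain ⟨D, hD, hinv⟩ := exists_abs_iteratedDeriv_inv_le M N
  induction n with
  | zero =>
    refine ⟨1, zero_le_one, fun q g v ξ S _ _ _ _ _ hS k hk => ?_⟩
    simpa using hS k (by omega)
  | succ n ih =>
    obtain ⟨C, hC, h⟩ := ih
    refine ⟨2 ^ N * (C * D), by positivity,
      fun q g v ξ S hq hg hne hq2 hM hS k hk => ?_⟩
    have hS0 : 0 ≤ S := (abs_nonneg _).trans (hS 0 N.zero_le)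
    have hsm : ContDiff ℝ (⊤ : ℕ∞) ((oscStep q v)^[n] g) :=
      (contDiff_oscStep_iterate hq hg hne n).1
    have hql : ContDiff ℝ (⊤ : ℕ∞) fun t : ℝ => q (ξ + t • v) := by fun_prop
    have hul : ContDiff ℝ (⊤ : ℕ∞) fun t : ℝ => (oscStep q v)^[n] g (ξ + t • v) := by fun_prop
    have hcoe (m : ℕ) : (m : WithTop ℕ∞) ≤ ((⊤ : ℕ∞) : WithTop ℕ∞) := by exact_mod_cast le_top
    simp only [Function.iterate_succ_apply']
    have hline : (fun t : ℝ => oscStep q v ((oscStep q v)^[n] g) (ξ + t • v)) =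
        deriv fun t : ℝ => (oscStep q v)^[n] g (ξ + t • v) * (q (ξ + t • v))⁻¹ :=
      lineDeriv_comp_line (fun η => (oscStep q v)^[n] g η * (q η)⁻¹) ξ v
    rw [hline, ← iteratedDeriv_succ']
    have hq0 : q (ξ + (0 : ℝ) • v) ≠ 0 := by
      simp only [zero_smul, add_zero]
      linarith
    refine (abs_iteratedDeriv_mul_le (hul.contDiffAt.of_le (hcoe _))
      ((hql.contDiffAt.of_le (hcoe _)).inv hq0)
      (fun j hj => h q g v ξ S hq hg hne hq2 hM hS j (by omega))
      (fun j hj => hinv _ 0 (hql.contDiffAt.of_le (hcoe _)) (by simpa using hq2) hM j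
        (by omega))).trans ?_
    calc (2 : ℝ) ^ (k + 1) * (C * S * D) ≤ 2 ^ N * (C * S * D) := by
          gcongr
          · norm_num
          · omega
      _ = 2 ^ N * (C * D) * S := by ring

section Kernel

variable {E : Type*} [NormedAddCommGroup E] [InnerProductSpace ℝ E] [FiniteDimensional ℝ E]
  [MeasurableSpace E] [BorelSpace E]

theorem integrable_exp_mul {φ u : E → ℝ} (hφ : Continuous φ) (hu : Continuous u)
    (hc : HasCompactSupport u) :
    Integrable fun ξ => exp (I * (φ ξ : ℂ)) * (u ξ : ℂ) := by
  refine Continuous.integrable_of_hasCompactSupport (by fun_prop) ?_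
  exact (hc.comp_left (g := ((↑) : ℝ → ℂ)) ofReal_zero).mul_left

/-- One integration by parts in direction `v` against the oscillating factor. -/
theorem mul_norm_integral_exp_mul {φ q u : E → ℝ} {v : E} {c : ℝ} (hc : 0 ≤ c)
    (hφ : ContDiff ℝ (⊤ : ℕ∞) φ) (hq : ContDiff ℝ (⊤ : ℕ∞) q) (hu : ContDiff ℝ (⊤ : ℕ∞) u)
    (hcs : HasCompactSupport u) (hne : ∀ ξ ∈ tsupport u, q ξ ≠ 0)
    (hφq : ∀ ξ, fderiv ℝ φ ξ v = c * q ξ) :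
    c * ‖∫ ξ, exp (I * (φ ξ : ℂ)) * (u ξ : ℂ)‖ =
      ‖∫ ξ, exp (I * (φ ξ : ℂ)) * (oscStep q v u ξ : ℂ)‖ := by
  have hw : ContDiff ℝ (⊤ : ℕ∞) fun η => u η * (q η)⁻¹ := contDiff_mul_inv hq hu hne
  have hwc : HasCompactSupport fun η => u η * (q η)⁻¹ := hcs.mul_right
  have hs : ContDiff ℝ (⊤ : ℕ∞) (oscStep q v u) := contDiff_oscStep hq hu hne
  have hsc : HasCompactSupport (oscStep q v u) :=
    hcs.of_isClosed_subset (isClosed_tsupport _) (tsupport_oscStep_subset hq hu hne)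
  have hcancel (ξ : E) : exp (I * (φ ξ : ℂ)) * (I * ((c * q ξ : ℝ) : ℂ)) *
      ((u ξ * (q ξ)⁻¹ : ℝ) : ℂ) = (I * c) * (exp (I * (φ ξ : ℂ)) * (u ξ : ℂ)) := by
    by_cases hξ : u ξ = 0
    · simp [hξ]
    · have hqξ : (q ξ : ℂ) ≠ 0 := ofReal_ne_zero.2 (hne ξ (subset_tsupport _ hξ))
      push_cast
      field_simp
  have hparts := integral_bilinear_hasLineDerivAt_right_eq_neg_left_of_integrable
    (μ := (volume : Measure E)) (B := ContinuousLinearMap.mul ℝ ℂ)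
    (f := fun ξ => exp (I * (φ ξ : ℂ)))
    (f' := fun ξ => exp (I * (φ ξ : ℂ)) * (I * ((c * q ξ : ℝ) : ℂ)))
    (g := fun ξ => ((u ξ * (q ξ)⁻¹ : ℝ) : ℂ)) (g' := fun ξ => (oscStep q v u ξ : ℂ)) (v := v)
    (by
      simp only [ContinuousLinearMap.mul_apply', hcancel]
      exact (integrable_exp_mul hφ.continuous hu.continuous hcs).const_mul _)
    (integrable_exp_mul hφ.continuous hs.continuous hsc)
    (integrable_exp_mul hφ.continuous hw.continuous hwc)
    (fun ξ _ => by
      have h1 : HasDerivAt (fun t : ℝ => φ (ξ + t • v)) (c * q ξ) 0 := by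
        rw [← hφq ξ]
        exact ((hφ.differentiable (by simp)) ξ).hasFDerivAt.hasLineDerivAt v
      have h2 := (h1.ofReal_comp.const_mul I).cexp
      simpa [HasLineDerivAt] using h2)
    (fun ξ _ => by
      have h1 : HasDerivAt (fun t : ℝ => u (ξ + t • v) * (q (ξ + t • v))⁻¹)
          (oscStep q v u ξ) 0 :=
        ((hw.differentiable (by simp)) ξ).lineDifferentiableAt.hasLineDerivAt
      exact h1.ofReal_comp)
  simp only [ContinuousLinearMap.mul_apply', hcancel] at hparts
  rw [hparts, norm_neg, integral_const_mul]
  simp [abs_of_nonneg hc]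

theorem pow_mul_norm_integral_exp_mul {φ q g : E → ℝ} {v : E} {c : ℝ} (hc : 0 ≤ c)
    (hφ : ContDiff ℝ (⊤ : ℕ∞) φ) (hq : ContDiff ℝ (⊤ : ℕ∞) q) (hg : ContDiff ℝ (⊤ : ℕ∞) g)
    (hcs : HasCompactSupport g) (hne : ∀ ξ ∈ tsupport g, q ξ ≠ 0)
    (hφq : ∀ ξ, fderiv ℝ φ ξ v = c * q ξ) (n : ℕ) :
    c ^ n * ‖∫ ξ, exp (I * (φ ξ : ℂ)) * (g ξ : ℂ)‖ =
      ‖∫ ξ, exp (I * (φ ξ : ℂ)) * ((oscStep q v)^[n] g ξ : ℂ)‖ := by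
  induction n with
  | zero => simp
  | succ n ih =>
    obtain ⟨hsm, hsupp⟩ := contDiff_oscStep_iterate (v := v) hq hg hne n
    simp only [Function.iterate_succ_apply']
    rw [← mul_norm_integral_exp_mul hc hφ hq hsm
      (hcs.of_isClosed_subset (isClosed_tsupport _) hsupp) (fun ξ hξ => hne ξ (hsupp hξ)) hφq,
      ← ih]
    ring

/-- Pointwise decay of the oscillatory kernel. -/
theorem exists_norm_oscillatory_integral_le (M : ℝ) (N : ℕ) :
    ∃ C : ℝ, 0 ≤ C ∧ ∀ (A r ε : ℝ) (f g : E → ℝ) (x : E), 0 < r → 0 < ε → r < ‖x‖ → 0 ≤ M →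
      ContDiff ℝ (⊤ : ℕ∞) f → ContDiff ℝ (⊤ : ℕ∞) g → HasCompactSupport g →
      (∀ ξ ∈ tsupport g, ‖fderiv ℝ f ξ‖ ≤ r / 2) →
      (∀ j : ℕ, 2 ≤ j → j ≤ N + 1 → ∀ ξ ∈ tsupport g,
        ‖iteratedFDeriv ℝ j f ξ‖ ≤ M * r * ε ^ (1 - (j : ℤ))) →
      (∀ j : ℕ, j ≤ N → (∫ ξ, ‖iteratedFDeriv ℝ j g ξ‖) ≤ A * ε ^ (-(j : ℤ))) →
      ‖∫ ξ, exp (I * ((⟪x, ξ⟫ + f ξ : ℝ) : ℂ)) * (g ξ : ℂ)‖ ≤ C * A * ((ε * ‖x‖) ^ N)⁻¹ := by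
  obtain ⟨C, hC, hbound⟩ := exists_abs_iteratedDeriv_oscStep_iterate_le M N N
  refine ⟨C * (N + 1), by positivity,
    fun A r ε f g x hr hε hx hM hf hg hcs hf1 hfj hgj => ?_⟩
  have hx0 : 0 < ‖x‖ := hr.trans hx
  set v : E := (ε / ‖x‖) • x with hv
  have hvn : ‖v‖ = ε := by
    rw [hv, norm_smul, Real.norm_of_nonneg (by positivity)]
    field_simp
  set c : ℝ := ε * ‖x‖ with hcdef
  have hc : 0 < c := by positivity
  set q : E → ℝ := fun ξ => 1 + c⁻¹ * fderiv ℝ f ξ v with hqdef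
  have hdf : ContDiff ℝ (⊤ : ℕ∞) fun ξ => fderiv ℝ f ξ v :=
    (hf.fderiv_right (by simp)).clm_apply contDiff_const
  have hq : ContDiff ℝ (⊤ : ℕ∞) q := contDiff_const.add (contDiff_const.mul hdf)
  have hφ : ContDiff ℝ (⊤ : ℕ∞) fun ξ => ⟪x, ξ⟫ + f ξ := (innerSL ℝ x).contDiff.add hf
  have hq2 : ∀ ξ ∈ tsupport g, 1 / 2 ≤ q ξ := by
    intro ξ hξ
    have h1 : |fderiv ℝ f ξ v| ≤ c / 2 := by
      rw [← Real.norm_eq_abs]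
      calc ‖fderiv ℝ f ξ v‖ ≤ ‖fderiv ℝ f ξ‖ * ‖v‖ := ContinuousLinearMap.le_opNorm _ _
        _ ≤ ‖x‖ / 2 * ε := by
            rw [hvn]
            gcongr
            exact (hf1 ξ hξ).trans (by linarith)
        _ = c / 2 := by ring
    have h2 : c⁻¹ * -(c / 2) ≤ c⁻¹ * fderiv ℝ f ξ v := by
      gcongr
      exact (abs_le.1 h1).1
    have h3 : c⁻¹ * -(c / 2) = -(1 / 2) := by field_simp
    simp only [hqdef]
    linarith
  have hne : ∀ ξ ∈ tsupport g, q ξ ≠ 0 := fun ξ hξ => by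
    have := hq2 ξ hξ
    linarith
  have hφq : ∀ ξ, fderiv ℝ (fun ξ => ⟪x, ξ⟫ + f ξ) ξ v = c * q ξ := by
    intro ξ
    have hd := ((innerSL ℝ x).hasFDerivAt (x := ξ)).add
      ((hf.differentiable (by simp)) ξ).hasFDerivAt
    have hd' : fderiv ℝ (fun ξ => ⟪x, ξ⟫ + f ξ) ξ = innerSL ℝ x + fderiv ℝ f ξ := hd.fderiv
    rw [hd', add_apply, innerSL_apply_apply, hv, real_inner_smul_right,
      real_inner_self_eq_norm_sq, ← hv]
    simp only [hqdef, hcdef]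
    field_simp
  have hqk : ∀ ξ ∈ tsupport g, ∀ k, 1 ≤ k → k ≤ N →
      |iteratedDeriv k (fun t : ℝ => q (ξ + t • v)) 0| ≤ M := by
    intro ξ hξ k hk1 hkN
    have hline : (fun t : ℝ => fderiv ℝ f (ξ + t • v) v) =
        deriv fun t : ℝ => f (ξ + t • v) := by
      rw [← lineDeriv_comp_line]
      ext t
      exact ((hf.differentiable (by simp)) _).lineDeriv_eq_fderiv.symm
    simp only [hqdef]
    rw [iteratedDeriv_const_add hk1, iteratedDeriv_const_mul_field, hline, ← iteratedDeriv_succ',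
      abs_mul, abs_of_pos (inv_pos.2 hc)]
    have hzpow : ε ^ (1 - ((k + 1 : ℕ) : ℤ)) = (ε ^ k)⁻¹ := by
      rw [← zpow_natCast, ← zpow_neg]
      congr 1
      push_cast
      ring
    calc _ ≤ c⁻¹ * (‖v‖ ^ (k + 1) * ‖iteratedFDeriv ℝ (k + 1) f ξ‖) := by
          gcongr
          exact abs_iteratedDeriv_comp_line_le hf ξ v (k + 1)
      _ ≤ c⁻¹ * (ε ^ (k + 1) * (M * ‖x‖ * (ε ^ k)⁻¹)) := by
          rw [hvn]
          gcongr
          refine (hfj (k + 1) (by omega) (by omega) ξ hξ).trans ?_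
          rw [hzpow]
          gcongr
      _ = M := by
          rw [hcdef]
          field_simp
          ring
  set S : E → ℝ := fun ξ => ∑ j ∈ Finset.range (N + 1), ε ^ j * ‖iteratedFDeriv ℝ j g ξ‖ with hS
  have hSint (j : ℕ) : Integrable fun ξ => ε ^ j * ‖iteratedFDeriv ℝ j g ξ‖ := by
    have hcont : Continuous (iteratedFDeriv ℝ j g) :=
      hg.continuous_iteratedFDeriv (by exact_mod_cast le_top)
    exact (hcont.integrable_of_hasCompactSupport (hcs.iteratedFDeriv j)).norm.const_mul _
  have hpt : ∀ ξ, ‖exp (I * ((⟪x, ξ⟫ + f ξ : ℝ) : ℂ)) * ((oscStep q v)^[N] g ξ : ℂ)‖ ≤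
      C * S ξ := by
    intro ξ
    have hS0 : 0 ≤ S ξ := Finset.sum_nonneg fun j _ => by positivity
    rw [norm_mul, mul_comm I, norm_exp_ofReal_mul_I, one_mul, norm_real, Real.norm_eq_abs]
    by_cases hξ : ξ ∈ tsupport g
    · have := hbound q g v ξ (S ξ) hq hg hne (hq2 ξ hξ) (hqk ξ hξ) (fun k hk => ?_) 0 le_rfl
      · simpa using this
      · refine (abs_iteratedDeriv_comp_line_le hg ξ v k).trans ?_
        rw [hvn]
        exact Finset.single_le_sum (f := fun j => ε ^ j * ‖iteratedFDeriv ℝ j g ξ‖)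
          (fun j _ => by positivity) (Finset.mem_range.2 (Nat.lt_succ_of_le hk))
    · rw [image_eq_zero_of_notMem_tsupport
        fun h => hξ ((contDiff_oscStep_iterate hq hg hne N).2 h), abs_zero]
      positivity
  have hSA : ∫ ξ, S ξ ≤ (N + 1) * A := by
    simp only [hS]
    rw [integral_finsetSum _ fun j _ => hSint j]
    calc _ ≤ ∑ _j ∈ Finset.range (N + 1), A := by
          refine Finset.sum_le_sum fun j hj => ?_
          rw [integral_const_mul]
          calc _ ≤ ε ^ j * (A * ε ^ (-(j : ℤ))) := by
                gcongr
                exact hgj j (Nat.lt_succ_iff.1 (Finset.mem_range.1 hj))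
            _ = A := by
                rw [zpow_neg, zpow_natCast]
                field_simp
      _ = (N + 1) * A := by simp
  rw [← div_eq_mul_inv, le_div_iff₀ (by positivity), mul_comm,
    pow_mul_norm_integral_exp_mul hc.le hφ hq hg hcs hne hφq N]
  calc _ ≤ ∫ ξ, C * S ξ := norm_integral_le_of_norm_le
        ((integrable_finsetSum _ fun j _ => hSint j).const_mul C) (ae_of_all _ hpt)
    _ ≤ C * ((N + 1) * A) := by
        rw [integral_const_mul]
        gcongr
    _ = C * (N + 1) * A := by ring

end Kernel

theorem exists_setIntegral_norm_gt_le {E : Type*} [NormedAddCommGroup E] [NormedSpace ℝ E]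
    [FiniteDimensional ℝ E] [MeasurableSpace E] [BorelSpace E] (L : ℕ) (hL : 1 ≤ L)
    (μ : Measure E) [μ.IsAddHaarMeasure] :
    ∃ C : ℝ, 0 ≤ C ∧ ∀ (F : E → ℝ) (B r : ℝ), 0 ≤ B → 0 < r → (∀ x, 0 ≤ F x) →
      (∀ x, r < ‖x‖ → F x ≤ B * (‖x‖ ^ (L + Module.finrank ℝ E))⁻¹) →
      ∫ x in {x | r < ‖x‖}, F x ∂μ ≤ B * C * (r ^ L)⁻¹ := by
  set N := L + Module.finrank ℝ E with hN
  have hint : Integrable (fun x : E => ((1 + ‖x‖) ^ N)⁻¹) μ := by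
    have h := integrable_one_add_norm (μ := μ) (r := (N : ℝ))
      (by rw [hN]; exact_mod_cast Nat.lt_add_of_pos_left hL)
    refine h.congr (ae_of_all _ fun x => ?_)
    simp only [Real.rpow_neg (by positivity : 0 ≤ 1 + ‖x‖), Real.rpow_natCast]
  refine ⟨2 ^ N * ∫ x, ((1 + ‖x‖) ^ N)⁻¹ ∂μ,
    mul_nonneg (by positivity) (integral_nonneg fun x => by positivity),
    fun F B r hB hr hF0 hF => ?_⟩
  set G : E → ℝ := fun x => B * 2 ^ N * (r ^ N)⁻¹ * ((1 + ‖r⁻¹ • x‖) ^ N)⁻¹ with hG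
  have hG0 (x : E) : 0 ≤ G x := by positivity
  have hGint : Integrable G μ :=
    ((integrable_comp_smul_iff μ (fun x : E => ((1 + ‖x‖) ^ N)⁻¹) (inv_ne_zero hr.ne')).2
      hint).const_mul _
  have hmeas : MeasurableSet {x : E | r < ‖x‖} :=
    (isOpen_lt continuous_const continuous_norm).measurableSet
  calc ∫ x in {x | r < ‖x‖}, F x ∂μ ≤ ∫ x in {x | r < ‖x‖}, G x ∂μ := by
        refine integral_mono_of_nonneg (ae_of_all _ hF0) hGint.integrableOn ?_
        filter_upwards [ae_restrict_mem hmeas] with x hx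
        have hx' : r < ‖x‖ := hx
        refine (hF x hx').trans ?_
        have hle : r * (1 + ‖r⁻¹ • x‖) ≤ 2 * ‖x‖ := by
          rw [norm_smul, norm_inv, Real.norm_of_nonneg hr.le, mul_add, mul_inv_cancel_left₀ hr.ne']
          linarith
        have hx0 : 0 < ‖x‖ := hr.trans hx'
        have hpow : (2 ^ N * ‖x‖ ^ N)⁻¹ ≤ (r ^ N * (1 + ‖r⁻¹ • x‖) ^ N)⁻¹ := by
          rw [← mul_pow, ← mul_pow]
          gcongr
        calc B * (‖x‖ ^ N)⁻¹ = B * 2 ^ N * (2 ^ N * ‖x‖ ^ N)⁻¹ := by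
              field_simp
          _ ≤ B * 2 ^ N * (r ^ N * (1 + ‖r⁻¹ • x‖) ^ N)⁻¹ := by gcongr
          _ = G x := by
              simp only [hG, mul_inv]
              ring
    _ ≤ ∫ x, G x ∂μ := setIntegral_le_integral hGint (ae_of_all _ hG0)
    _ = B * (2 ^ N * ∫ x, ((1 + ‖x‖) ^ N)⁻¹ ∂μ) * (r ^ L)⁻¹ := by
        simp only [hG]
        rw [integral_const_mul,
          Measure.integral_comp_inv_smul μ (fun x : E => ((1 + ‖x‖) ^ N)⁻¹) r,
          abs_of_pos (by positivity), smul_eq_mul, hN, pow_add r]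
        field_simp

/-- L¹ bound outside the ball of radius `r` for the oscillatory kernel
`𝒦(x) = ∫ e^{i(x·ξ + f(ξ))} g(ξ) dξ` (Lemma 6.2 / `int-part-cor` of the paper). -/
theorem stmt1 (d L : ℕ) (hd : 1 ≤ d) (hL : 1 ≤ L) (M : ℝ) (hM : 1 ≤ M) :
    ∃ C : ℝ, 0 < C ∧
      ∀ A r ε : ℝ, 0 < A → 2 ≤ r → 0 < ε → ε ≤ 1 → 2 ≤ r * ε →
      ∀ f g : EuclideanSpace ℝ (Fin d) → ℝ,
        ContDiff ℝ (⊤ : ℕ∞) f → ContDiff ℝ (⊤ : ℕ∞) g → HasCompactSupport g →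
        (∀ ξ ∈ tsupport g, ‖fderiv ℝ f ξ‖ ≤ r / 2) →
        (∀ j : ℕ, 2 ≤ j → j ≤ L + d + 1 → ∀ ξ ∈ tsupport g,
          ‖iteratedFDeriv ℝ j f ξ‖ ≤ M * r * ε ^ (1 - (j : ℤ))) →
        (∀ j : ℕ, j ≤ L + d →
          (∫ ξ : EuclideanSpace ℝ (Fin d), ‖iteratedFDeriv ℝ j g ξ‖) ≤ A * ε ^ (-(j : ℤ))) →
        (∫ x in {x : EuclideanSpace ℝ (Fin d) | r < ‖x‖},
            ‖∫ ξ : EuclideanSpace ℝ (Fin d),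
              Complex.exp (Complex.I * ((⟪x, ξ⟫ + f ξ : ℝ) : ℂ)) * ((g ξ : ℝ) : ℂ)‖) ≤
          C * A * r ^ (-(L : ℤ)) * ε ^ (-(L : ℤ) - (d : ℤ)) := by
  obtain ⟨C₁, hC₁, hker⟩ :=
    exists_norm_oscillatory_integral_le (E := EuclideanSpace ℝ (Fin d)) M (L + d)
  obtain ⟨C₂, hC₂, htail⟩ :=
    exists_setIntegral_norm_gt_le L hL (volume : Measure (EuclideanSpace ℝ (Fin d)))
  rw [finrank_euclideanSpace_fin] at htail
  refine ⟨C₁ * C₂ + 1, by positivity,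
    fun A r ε hA hr hε _ _ f g hf hg hcs hf1 hfj hgj => ?_⟩
  have hr0 : 0 < r := by linarith
  have hle := htail (fun x => ‖∫ ξ : EuclideanSpace ℝ (Fin d),
      Complex.exp (Complex.I * ((⟪x, ξ⟫ + f ξ : ℝ) : ℂ)) * ((g ξ : ℝ) : ℂ)‖)
    (C₁ * A * (ε ^ (L + d))⁻¹) r (by positivity) hr0 (fun x => norm_nonneg _) (fun x hx => by
      have := hker A r ε f g x hr0 hε hx (by linarith) hf hg hcs hf1 hfj hgj
      rwa [mul_pow, mul_inv, ← mul_assoc] at this)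
  refine hle.trans ?_
  have h1 : r ^ (-(L : ℤ)) = (r ^ L)⁻¹ := by rw [zpow_neg, zpow_natCast]
  have h2 : ε ^ (-(L : ℤ) - (d : ℤ)) = (ε ^ (L + d))⁻¹ := by
    rw [← zpow_natCast, ← zpow_neg]
    congr 1
    push_cast
    ring
  rw [h1, h2]
  calc _ = C₁ * C₂ * A * (r ^ L)⁻¹ * (ε ^ (L + d))⁻¹ := by ring
    _ ≤ _ := by
        gcongr
        linarith
end

section
/- Let h : ℝ² → ℝ be continuous and bounded, and let Ω = {(x, z) ∈ ℝ² × ℝ : z < h(x)}, so that the closure of Ω is {(x, z) : z ≤ h(x)} and its boundary is the graph Γ = {(x, h(x)) : x ∈ ℝ²}. Let u : ℝ³ → ℝ be continuous on the closure of Ω, twice continuously differentiable on Ω with Δu = ∂²u/∂x₁² + ∂²u/∂x₂² + ∂²u/∂z² = 0 on Ω, and equal to 0 on Γ. Assume moreover that u(x, z) = o(1 + |z|) at infinity in the closure of Ω, i.e. for every δ > 0 there exists R such that |u(x, z)| ≤ δ(1 + |z|) whenever (x, z) lies in the closure of Ω and ‖x‖ + |z| ≥ R. Then u = 0 on Ω.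 -/
open MeasureTheory

open Filter Topology in
/-- At a local maximum, the second derivative of a real function is nonpositive. -/
theorem IsLocalMax.deriv_deriv_nonpos {f : ℝ → ℝ} {a : ℝ} (hf : IsLocalMax f a)
    (hc : ContinuousAt f a) : deriv (deriv f) a ≤ 0 := by
  by_contra! hpos
  have hmin : IsLocalMin f a := isLocalMin_of_deriv_deriv_pos hpos hf.deriv_eq_zero hc
  have hconst : f =ᶠ[𝓝 a] fun _ => f a := by
    filter_upwards [hf, hmin] with x h₁ h₂ using le_antisymm h₁ h₂
  have hzero : deriv (deriv f) a = 0 := by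
    rw [hconst.deriv.deriv_eq]
    simp
  exact hpos.ne' hzero

/-- The second derivative along a line is the second iterated derivative on the diagonal. -/
theorem ContDiffAt.deriv_deriv_comp_add_smul {E : Type*} [NormedAddCommGroup E] [NormedSpace ℝ E]
    {f : E → ℝ} {q : E} (hf : ContDiffAt ℝ 2 f q) (v : E) :
    deriv (deriv fun t : ℝ => f (q + t • v)) 0 = iteratedFDeriv ℝ 2 f q ![v, v] := by
  have hline : ∀ t : ℝ, HasDerivAt (fun t : ℝ => q + t • v) v t := fun t => by
    simpa using ((hasDerivAt_id t).smul_const v).const_add q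
  have htend : Filter.Tendsto (fun t : ℝ => q + t • v) (nhds 0) (nhds q) := by
    simpa using (hline 0).continuousAt.tendsto
  have hev : ∀ᶠ p in nhds q, DifferentiableAt ℝ f p :=
    (hf.eventually (by simp)).mono fun p hp => hp.differentiableAt (by simp)
  have hfirst : (deriv fun t : ℝ => f (q + t • v)) =ᶠ[nhds 0]
      fun t => fderiv ℝ f (q + t • v) v := by
    filter_upwards [htend.eventually hev] with t ht
    exact (ht.hasFDerivAt.comp_hasDerivAt t (hline t)).deriv
  have hdiff : DifferentiableAt ℝ (fderiv ℝ f) q :=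
    (hf.fderiv_right (m := 1) (by norm_num)).differentiableAt (by simp)
  have hq : HasFDerivAt (fderiv ℝ f) (fderiv ℝ (fderiv ℝ f) q) (q + (0 : ℝ) • v) := by
    simpa using hdiff.hasFDerivAt
  have hgrad : HasDerivAt (fun t : ℝ => fderiv ℝ f (q + t • v)) (fderiv ℝ (fderiv ℝ f) q v) 0 :=
    hq.comp_hasDerivAt (0 : ℝ) (hline 0)
  have hsecond : HasDerivAt (fun t : ℝ => fderiv ℝ f (q + t • v) v)
      (fderiv ℝ (fderiv ℝ f) q v v) 0 :=
    (ContinuousLinearMap.apply ℝ ℝ v).hasFDerivAt.comp_hasDerivAt (0 : ℝ) hgrad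
  rw [hfirst.deriv_eq, iteratedFDeriv_two_apply]
  exact hsecond.deriv

/-- At a local maximum, the second derivative is nonpositive on the diagonal. -/
theorem IsLocalMax.iteratedFDeriv_two_nonpos {E : Type*} [NormedAddCommGroup E] [NormedSpace ℝ E]
    {f : E → ℝ} {q : E} (hmax : IsLocalMax f q) (hf : ContDiffAt ℝ 2 f q) (v : E) :
    iteratedFDeriv ℝ 2 f q ![v, v] ≤ 0 := by
  have hline : ContinuousAt (fun t : ℝ => q + t • v) 0 := by fun_prop
  have hq : q + (0 : ℝ) • v = q := by simp
  rw [← hf.deriv_deriv_comp_add_smul]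
  refine IsLocalMax.deriv_deriv_nonpos ?_
    (ContinuousAt.comp (f := fun t : ℝ => q + t • v) (by rw [hq]; exact hf.continuousAt) hline)
  have htend : Filter.Tendsto (fun t : ℝ => q + t • v) (nhds 0) (nhds q) := by
    simpa using hline.tendsto
  filter_upwards [htend.eventually hmax] with t ht
  simpa using ht

theorem iteratedFDeriv_two_quadratic_snd {E : Type*} [NormedAddCommGroup E] [NormedSpace ℝ E]
    (a b c : ℝ) (q v : E × ℝ) :
    iteratedFDeriv ℝ 2 (fun p : E × ℝ => a + b * p.2 + c * p.2 ^ 2) q ![v, v]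
      = 2 * c * v.2 ^ 2 := by
  rw [← ContDiffAt.deriv_deriv_comp_add_smul (by fun_prop)]
  have hfirst : (deriv fun t : ℝ => a + b * (q + t • v).2 + c * (q + t • v).2 ^ 2)
      = fun t => b * v.2 + 2 * c * v.2 * (q.2 + t * v.2) := by
    funext t
    have hz : HasDerivAt (fun t : ℝ => (q + t • v).2) v.2 t := by
      simpa using ((hasDerivAt_id t).mul_const v.2).const_add q.2
    have := ((hz.const_mul b).const_add a).add ((hz.pow 2).const_mul c)
    refine this.deriv.trans ?_
    simp
    ring
  rw [hfirst]
  have hz : HasDerivAt (fun t : ℝ => q.2 + t * v.2) v.2 0 := by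
    simpa using ((hasDerivAt_id (0 : ℝ)).mul_const v.2).const_add q.2
  rw [((hz.const_mul (2 * c * v.2)).const_add (b * v.2)).deriv]
  ring

/-- One-sided Phragmén–Lindelöf principle below a graph bounded above: a harmonic function that
is nonpositive on the graph and is eventually at most `δ * (1 + |z|)` for every `δ > 0` is
nonpositive. -/
theorem nonpos_of_harmonic_of_growth
    {h : EuclideanSpace ℝ (Fin 2) → ℝ} (hcont : Continuous h) {M : ℝ} (hM : ∀ x, h x ≤ M)
    {u : EuclideanSpace ℝ (Fin 2) × ℝ → ℝ}
    (hu_cont : ContinuousOn u {p : EuclideanSpace ℝ (Fin 2) × ℝ | p.2 ≤ h p.1})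
    (hu_diff : ∀ p : EuclideanSpace ℝ (Fin 2) × ℝ, p.2 < h p.1 → ContDiffAt ℝ 2 u p)
    (hu_harm : ∀ p : EuclideanSpace ℝ (Fin 2) × ℝ, p.2 < h p.1 →
      iteratedFDeriv ℝ 2 u p
          ![(EuclideanSpace.single (0 : Fin 2) (1 : ℝ), (0 : ℝ)),
            (EuclideanSpace.single (0 : Fin 2) (1 : ℝ), (0 : ℝ))]
        + iteratedFDeriv ℝ 2 u p
          ![(EuclideanSpace.single (1 : Fin 2) (1 : ℝ), (0 : ℝ)),
            (EuclideanSpace.single (1 : Fin 2) (1 : ℝ), (0 : ℝ))]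
        + iteratedFDeriv ℝ 2 u p
          ![((0 : EuclideanSpace ℝ (Fin 2)), (1 : ℝ)),
            ((0 : EuclideanSpace ℝ (Fin 2)), (1 : ℝ))] = 0)
    (hu_bdry : ∀ p : EuclideanSpace ℝ (Fin 2) × ℝ, p.2 = h p.1 → u p ≤ 0)
    (hu_growth : ∀ δ : ℝ, 0 < δ → ∃ R : ℝ, ∀ p : EuclideanSpace ℝ (Fin 2) × ℝ,
      p.2 ≤ h p.1 → R ≤ ‖p.1‖ + |p.2| → u p ≤ δ * (1 + |p.2|))
    {p₀ : EuclideanSpace ℝ (Fin 2) × ℝ} (hp₀ : p₀.2 < h p₀.1) : u p₀ ≤ 0 := by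
  set C : ℝ := 2 * |M| + 1
  have hbarrier : ∀ p : EuclideanSpace ℝ (Fin 2) × ℝ, p.2 ≤ h p.1 → 1 + |p.2| ≤ C - p.2 := by
    intro p hp
    have h₁ := hp.trans ((hM p.1).trans (le_abs_self M))
    have h₂ := abs_nonneg M
    rcases abs_cases p.2 with h₃ | h₃ <;> linarith
  suffices hε : ∀ ε : ℝ, 0 < ε → u p₀ ≤ ε * (C - p₀.2) by
    have hpos : 0 < C - p₀.2 := by
      linarith [hbarrier p₀ hp₀.le, abs_nonneg p₀.2]
    by_contra! hu
    have := hε (u p₀ / (2 * (C - p₀.2))) (by positivity)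
    have heq : u p₀ / (2 * (C - p₀.2)) * (C - p₀.2) = u p₀ / 2 := by
      field_simp
    linarith
  intro ε hε
  obtain ⟨R, hR⟩ := hu_growth ε hε
  by_contra! hw
  obtain ⟨η, hη, hηR⟩ : ∃ η : ℝ, 0 < η ∧ η * R ^ 2 < u p₀ - ε * (C - p₀.2) := by
    refine ⟨(u p₀ - ε * (C - p₀.2)) / (R ^ 2 + 1), by have := sub_pos.2 hw; positivity, ?_⟩
    rw [div_mul_eq_mul_div, div_lt_iff₀ (by positivity)]
    nlinarith
  set φ : EuclideanSpace ℝ (Fin 2) × ℝ → ℝ :=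
    u + fun p => -(ε * C) + ε * p.2 + η * p.2 ^ 2 with hφ
  set K : Set (EuclideanSpace ℝ (Fin 2) × ℝ) := {p | p.2 ≤ h p.1 ∧ ‖p.1‖ + |p.2| ≤ R}
  have hKcompact : IsCompact K := by
    refine Metric.isCompact_of_isClosed_isBounded ?_ ?_
    · exact (isClosed_le continuous_snd (hcont.comp continuous_fst)).inter
        (isClosed_le (continuous_fst.norm.add continuous_snd.abs) continuous_const)
    · refine (Metric.isBounded_closedBall (x := 0) (r := R)).subset fun p hp => ?_
      rw [mem_closedBall_zero_iff, Prod.norm_def, Real.norm_eq_abs]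
      exact max_le (by linarith [hp.2, abs_nonneg p.2]) (by linarith [hp.2, norm_nonneg p.1])
  have hfar : ∀ p : EuclideanSpace ℝ (Fin 2) × ℝ, p.2 ≤ h p.1 → ε * (C - p.2) < u p →
      p.2 < h p.1 ∧ ‖p.1‖ + |p.2| < R := by
    intro p hp hup
    have hb := mul_le_mul_of_nonneg_left (hbarrier p hp) hε.le
    refine ⟨lt_of_le_of_ne hp fun heq => ?_, ?_⟩
    · have := hu_bdry p heq
      nlinarith [abs_nonneg p.2]
    · by_contra! hle
      linarith [hR p hp hle]
  have hp₀K : p₀ ∈ K := ⟨hp₀.le, (hfar p₀ hp₀.le hw).2.le⟩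
  have hφcont : ContinuousOn φ K :=
    (hu_cont.mono fun p hp => hp.1).add (by fun_prop)
  obtain ⟨q, hqK, hqmax⟩ := hKcompact.exists_isMaxOn ⟨p₀, hp₀K⟩ hφcont
  have hq : q.2 < h q.1 ∧ ‖q.1‖ + |q.2| < R := by
    refine hfar q hqK.1 ?_
    have h₁ : φ p₀ ≤ φ q := hqmax hp₀K
    have h₂ : q.2 ^ 2 ≤ R ^ 2 := by
      rw [← sq_abs q.2]
      exact pow_le_pow_left₀ (abs_nonneg _) (by linarith [hqK.2, norm_nonneg q.1]) 2
    simp only [hφ, Pi.add_apply] at h₁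
    nlinarith [mul_le_mul_of_nonneg_left h₂ hη.le, mul_nonneg hη.le (sq_nonneg p₀.2)]
  have hnhds : K ∈ nhds q := by
    have h₁ : ∀ᶠ p in nhds q, p.2 < h p.1 :=
      (isOpen_lt continuous_snd (hcont.comp continuous_fst)).mem_nhds hq.1
    have h₂ : ∀ᶠ p : EuclideanSpace ℝ (Fin 2) × ℝ in nhds q, ‖p.1‖ + |p.2| < R :=
      (isOpen_lt (by fun_prop) continuous_const).mem_nhds hq.2
    filter_upwards [h₁, h₂] with p hp₁ hp₂ using ⟨hp₁.le, hp₂.le⟩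
  have hlocal : IsLocalMax φ q := hqmax.isLocalMax hnhds
  have hquad : ContDiffAt ℝ 2
      (fun p : EuclideanSpace ℝ (Fin 2) × ℝ => -(ε * C) + ε * p.2 + η * p.2 ^ 2) q := by
    fun_prop
  have hdir : ∀ v : EuclideanSpace ℝ (Fin 2) × ℝ,
      iteratedFDeriv ℝ 2 u q ![v, v] + 2 * η * v.2 ^ 2 ≤ 0 := by
    intro v
    have := hlocal.iteratedFDeriv_two_nonpos ((hu_diff q hq.1).add hquad) v
    rwa [hφ, iteratedFDeriv_add_apply (hu_diff q hq.1) hquad, add_apply,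
      iteratedFDeriv_two_quadratic_snd] at this
  have hx := hdir (EuclideanSpace.single 0 1, 0)
  have hy := hdir (EuclideanSpace.single 1 1, 0)
  have hz := hdir (0, 1)
  have hsum := hu_harm q hq.1
  norm_num at hx hy hz
  linarith

/-- Uniqueness for the Dirichlet problem in the domain `Ω = {(x,z) : z < h(x)}` below a bounded
continuous graph: a function continuous on the closure, harmonic in `Ω`, vanishing on the
boundary graph, and growing slower than `|z|` at infinity, vanishes identically
(Lemma `u-Diri-unique` of the paper). -/
theorem stmt2
    (h : EuclideanSpace ℝ (Fin 2) → ℝ) (hcont : Continuous h) (hbdd : ∃ M : ℝ, ∀ x, |h x| ≤ M)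
    (u : EuclideanSpace ℝ (Fin 2) × ℝ → ℝ)
    (hu_cont : ContinuousOn u {p : EuclideanSpace ℝ (Fin 2) × ℝ | p.2 ≤ h p.1})
    (hu_diff : ∀ p : EuclideanSpace ℝ (Fin 2) × ℝ, p.2 < h p.1 → ContDiffAt ℝ 2 u p)
    (hu_harm : ∀ p : EuclideanSpace ℝ (Fin 2) × ℝ, p.2 < h p.1 →
      iteratedFDeriv ℝ 2 u p
          ![(EuclideanSpace.single (0 : Fin 2) (1 : ℝ), (0 : ℝ)),
            (EuclideanSpace.single (0 : Fin 2) (1 : ℝ), (0 : ℝ))]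
        + iteratedFDeriv ℝ 2 u p
          ![(EuclideanSpace.single (1 : Fin 2) (1 : ℝ), (0 : ℝ)),
            (EuclideanSpace.single (1 : Fin 2) (1 : ℝ), (0 : ℝ))]
        + iteratedFDeriv ℝ 2 u p
          ![((0 : EuclideanSpace ℝ (Fin 2)), (1 : ℝ)),
            ((0 : EuclideanSpace ℝ (Fin 2)), (1 : ℝ))] = 0)
    (hu_bdry : ∀ p : EuclideanSpace ℝ (Fin 2) × ℝ, p.2 = h p.1 → u p = 0)
    (hu_growth : ∀ δ : ℝ, 0 < δ → ∃ R : ℝ, ∀ p : EuclideanSpace ℝ (Fin 2) × ℝ,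
      p.2 ≤ h p.1 → R ≤ ‖p.1‖ + |p.2| → |u p| ≤ δ * (1 + |p.2|)) :
    ∀ p : EuclideanSpace ℝ (Fin 2) × ℝ, p.2 < h p.1 → u p = 0 := by
  obtain ⟨M, hM⟩ := hbdd
  have hM' : ∀ x, h x ≤ M := fun x => (le_abs_self _).trans (hM x)
  intro p hp
  refine le_antisymm ?_ ?_
  · refine nonpos_of_harmonic_of_growth hcont hM' hu_cont hu_diff hu_harm
      (fun p hp => (hu_bdry p hp).le) (fun δ hδ => ?_) hp
    obtain ⟨R, hR⟩ := hu_growth δ hδ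
    exact ⟨R, fun p hp hpR => (le_abs_self _).trans (hR p hp hpR)⟩
  · refine neg_nonpos.1 (nonpos_of_harmonic_of_growth (u := -u) hcont hM' hu_cont.neg
      (fun p hp => (hu_diff p hp).neg) (fun p hp => ?_)
      (fun p hp => by simp [hu_bdry p hp]) (fun δ hδ => ?_) hp)
    · have := hu_harm p hp
      simp only [iteratedFDeriv_neg, Pi.neg_apply, neg_apply]
      linarith
    · obtain ⟨R, hR⟩ := hu_growth δ hδ
      exact ⟨R, fun p hp hpR => (neg_le_abs _).trans (hR p hp hpR)⟩
end

section
/- There is a constant c > 0 such that for all signs μ, ν ∈ {+1, −1} and all vectors ξ₁, ξ₂ ∈ ℝ², one has |Φ_{μν}(ξ₁, ξ₂)| ≥ c · min(‖ξ₁‖, ‖ξ₂‖, ‖ξ₁+ξ₂‖)^{1/2}. -/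
/-- Quantitative strict subadditivity: if `z² ≤ x² + y²` then `x + y` exceeds `z` by at least
half of any common lower bound of `x` and `y`. -/
theorem half_le_add_sub_of_sq_le {x y z m : ℝ} (hm : 0 ≤ m) (hx : m ≤ x) (hy : m ≤ y)
    (h : z ^ 2 ≤ x ^ 2 + y ^ 2) : 1 / 2 * m ≤ x + y - z := by
  have hz : z ≤ x + y - 1 / 2 * m := by
    refine (abs_le_of_sq_le_sq' ?_ (by linarith)).2
    nlinarith [mul_nonneg (hm.trans hx) (sub_nonneg.2 hy),
      mul_nonneg (hm.trans hy) (sub_nonneg.2 hx), sq_nonneg m]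
  linarith


/-- Lower bound on the phase `Φ_{μν}(ξ₁,ξ₂) = ‖ξ₁+ξ₂‖^{1/2} − μ‖ξ₁‖^{1/2} − ν‖ξ₂‖^{1/2}`
of the gravity water wave system: absence of time resonances away from vanishing
frequencies. -/
theorem stmt3 :
    ∃ c : ℝ, 0 < c ∧
      ∀ μ ν : ℝ, (μ = 1 ∨ μ = -1) → (ν = 1 ∨ ν = -1) →
      ∀ ξ₁ ξ₂ : EuclideanSpace ℝ (Fin 2),
        c * Real.sqrt (min (min ‖ξ₁‖ ‖ξ₂‖) ‖ξ₁ + ξ₂‖) ≤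
          |Real.sqrt ‖ξ₁ + ξ₂‖ - μ * Real.sqrt ‖ξ₁‖ - ν * Real.sqrt ‖ξ₂‖| := by
  refine ⟨1 / 2, by norm_num, fun μ ν hμ hν ξ₁ ξ₂ => ?_⟩
  have h₃ : ‖ξ₁ + ξ₂‖ ≤ ‖ξ₁‖ + ‖ξ₂‖ := norm_add_le _ _
  have h₁ : ‖ξ₁‖ ≤ ‖ξ₁ + ξ₂‖ + ‖ξ₂‖ := by
    simpa using norm_sub_le (ξ₁ + ξ₂) ξ₂
  have h₂ : ‖ξ₂‖ ≤ ‖ξ₁ + ξ₂‖ + ‖ξ₁‖ := by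
    simpa using norm_sub_le (ξ₁ + ξ₂) ξ₁
  rw [← Real.sq_sqrt (norm_nonneg ξ₁), ← Real.sq_sqrt (norm_nonneg ξ₂),
    ← Real.sq_sqrt (norm_nonneg (ξ₁ + ξ₂))] at h₁ h₂ h₃
  have hm := Real.sqrt_nonneg (min (min ‖ξ₁‖ ‖ξ₂‖) ‖ξ₁ + ξ₂‖)
  have hx : √(min (min ‖ξ₁‖ ‖ξ₂‖) ‖ξ₁ + ξ₂‖) ≤ √‖ξ₁‖ := Real.sqrt_le_sqrt (by simp)
  have hy : √(min (min ‖ξ₁‖ ‖ξ₂‖) ‖ξ₁ + ξ₂‖) ≤ √‖ξ₂‖ := Real.sqrt_le_sqrt (by simp)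
  have hz : √(min (min ‖ξ₁‖ ‖ξ₂‖) ‖ξ₁ + ξ₂‖) ≤ √‖ξ₁ + ξ₂‖ := Real.sqrt_le_sqrt (by simp)
  have k₁ := half_le_add_sub_of_sq_le hm hz hy h₁
  have k₂ := half_le_add_sub_of_sq_le hm hz hx h₂
  have k₃ := half_le_add_sub_of_sq_le hm hx hy h₃
  rw [le_abs]
  rcases hμ with rfl | rfl <;> rcases hν with rfl | rfl
  · right; linarith
  · left; linarith
  · left; linarith
  · left; linarith
end

section
/- For every integer L ≥ 0 there is a constant C_L such that for all signs μ, ν ∈ {+1, −1} and every point (ξ₁, ξ₂) of the open set U = {(ξ₁, ξ₂) ∈ ℝ² × ℝ² : ξ₁ ≠ 0, ξ₂ ≠ 0, ξ₁ + ξ₂ ≠ 0}, the function (ξ₁, ξ₂) ↦ 1/Φ_{μν}(ξ₁, ξ₂) is well defined and smooth on U and its L-th total derivative with respect to (ξ₁, ξ₂) ∈ ℝ⁴ satisfies ‖∇^L (1/Φ_{μν})(ξ₁, ξ₂)‖ ≤ C_L · min(‖ξ₁‖, ‖ξ₂‖, ‖ξ₁+ξ₂‖)^{−L−1/2}. -/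
noncomputable section

/-- The reciprocal of the phase function
`Φ_{μν}(ξ₁,ξ₂) = ‖ξ₁+ξ₂‖^{1/2} − μ‖ξ₁‖^{1/2} − ν‖ξ₂‖^{1/2}` of the gravity water wave
system, viewed as a function on `ℝ² × ℝ²`. -/
def PhiInv (μ ν : ℝ) (p : EuclideanSpace ℝ (Fin 2) × EuclideanSpace ℝ (Fin 2)) : ℝ :=
  (Real.sqrt ‖p.1 + p.2‖ - μ * Real.sqrt ‖p.1‖ - ν * Real.sqrt ‖p.2‖)⁻¹

section LinearPrecomposition

variable {E F G : Type*} [NormedAddCommGroup E] [NormedSpace ℝ E] [NormedAddCommGroup F]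
  [NormedSpace ℝ F] [NormedAddCommGroup G] [NormedSpace ℝ G]

/-- Local version of the bound on iterated derivatives under linear precomposition. -/
theorem norm_iteratedFDeriv_comp_clm_le {f : F → G} {s : Set F} (hs : IsOpen s) {n : ℕ}
    (hf : ContDiffOn ℝ n f s) (g : E →L[ℝ] F) {x : E} (hx : g x ∈ s) :
    ‖iteratedFDeriv ℝ n (f ∘ g) x‖ ≤ ‖iteratedFDeriv ℝ n f (g x)‖ * ‖g‖ ^ n := by
  have hs' : IsOpen (g ⁻¹' s) := hs.preimage g.continuous
  have h := g.iteratedFDerivWithin_comp_right hf hs.uniqueDiffOn hs'.uniqueDiffOn hx le_rfl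
  rw [iteratedFDerivWithin_of_isOpen n hs' hx, iteratedFDerivWithin_of_isOpen n hs hx] at h
  rw [h]
  simpa using (iteratedFDeriv ℝ n f (g x)).norm_compContinuousLinearMap_le fun _ => g

end LinearPrecomposition

section SqrtNorm

variable {E : Type*} [NormedAddCommGroup E] [InnerProductSpace ℝ E]

theorem contDiffAt_sqrt_norm {n : WithTop ℕ∞} {x : E} (hx : x ≠ 0) :
    ContDiffAt ℝ n (fun y : E => √‖y‖) x :=
  (contDiffAt_norm ℝ hx).sqrt (norm_ne_zero_iff.2 hx)

/-- Symbol estimates for `√‖x‖`, by homogeneity and compactness of the unit sphere. -/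
theorem exists_norm_iteratedFDeriv_sqrt_norm_le [FiniteDimensional ℝ E] (n : ℕ) :
    ∃ C : ℝ, 0 ≤ C ∧ ∀ x : E, x ≠ 0 →
      ‖iteratedFDeriv ℝ n (fun y : E => √‖y‖) x‖ ≤ C * (√‖x‖ / ‖x‖ ^ n) := by
  have hopen : IsOpen ({0}ᶜ : Set E) := isOpen_compl_singleton
  have hsmooth : ContDiffOn ℝ n (fun y : E => √‖y‖) {0}ᶜ :=
    fun y hy => (contDiffAt_sqrt_norm hy).contDiffWithinAt
  have hcont : ContinuousOn (iteratedFDeriv ℝ n (fun y : E => √‖y‖)) (Metric.sphere 0 1) :=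
    ((hsmooth.continuousOn_iteratedFDerivWithin le_rfl hopen.uniqueDiffOn).congr
      fun y hy => (iteratedFDerivWithin_of_isOpen n hopen hy).symm).mono
      fun y hy => Metric.ne_of_mem_sphere hy one_ne_zero
  obtain ⟨C, hC⟩ := (isCompact_sphere (0 : E) 1).exists_bound_of_continuousOn hcont
  refine ⟨max C 0, le_max_right _ _, fun x hx => ?_⟩
  have hr : 0 < ‖x‖ := norm_pos_iff.2 hx
  let g : E →L[ℝ] E := ‖x‖⁻¹ • ContinuousLinearMap.id ℝ E
  have hg : ‖g‖ ≤ ‖x‖⁻¹ :=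
    g.opNorm_le_bound (by positivity) fun y => by simp [g, norm_smul]
  have hgx : g x ∈ Metric.sphere (0 : E) 1 := by
    simp [g, norm_smul, hr.ne']
  have hgx0 : g x ∈ ({0}ᶜ : Set E) := Metric.ne_of_mem_sphere hgx one_ne_zero
  have hscale : (fun y : E => √‖y‖) = fun y => √‖x‖ • ((fun y : E => √‖y‖) ∘ g) y := by
    funext y
    simp only [g, Function.comp_apply, smul_eq_mul, smul_apply,
      ContinuousLinearMap.id_apply, norm_smul, norm_inv, norm_norm]
    rw [← Real.sqrt_mul hr.le, mul_inv_cancel_left₀ hr.ne']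
  have hcomp : ContDiffAt ℝ n ((fun y : E => √‖y‖) ∘ g) x :=
    (contDiffAt_sqrt_norm hgx0).comp x g.contDiff.contDiffAt
  rw [hscale, iteratedFDeriv_const_smul_apply' hcomp, norm_smul, Real.norm_of_nonneg (by positivity)]
  calc √‖x‖ * ‖iteratedFDeriv ℝ n ((fun y : E => √‖y‖) ∘ g) x‖
      ≤ √‖x‖ * (max C 0 * (‖x‖⁻¹) ^ n) := by
        gcongr
        refine (norm_iteratedFDeriv_comp_clm_le hopen hsmooth g hgx0).trans ?_
        gcongr
        exact (hC _ hgx).trans (le_max_left _ _)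
    _ = max C 0 * (√‖x‖ / ‖x‖ ^ n) := by
        rw [inv_pow]; ring

end SqrtNorm

theorem sqrt_div_pow_le {m r : ℝ} (hm : 0 < m) (hmr : m ≤ r) {k : ℕ} (hk : 1 ≤ k) :
    √r / r ^ k ≤ √m / m ^ k := by
  obtain ⟨j, rfl⟩ := Nat.exists_eq_add_of_le' hk
  have key : ∀ t : ℝ, 0 < t → √t / t ^ (j + 1) = (√t * t ^ j)⁻¹ := fun t ht => by
    have h1 : √t ≠ 0 := (Real.sqrt_pos.2 ht).ne'
    field_simp
    rw [Real.sq_sqrt ht.le, pow_succ']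
  rw [key r (hm.trans_le hmr), key m hm]
  gcongr

/-- If the squares of `a`, `b`, `c` satisfy `c² ≤ a² + b²`, then `a + b - c` is bounded below. -/
theorem half_le_add_sub {a b c s : ℝ} (hs : 0 < s) (ha : s ≤ a) (hb : s ≤ b) (hc : s ≤ c)
    (h : c ^ 2 ≤ a ^ 2 + b ^ 2) : s / 2 ≤ a + b - c := by
  by_contra! hlt
  nlinarith [mul_nonneg (sub_nonneg.2 ha) (sub_nonneg.2 hb)]

/-- Lower bound for the phase in terms of the square roots of the three norms. -/
theorem half_le_abs_phase {a b c s μ ν : ℝ} (hs : 0 < s) (ha : s ≤ a) (hb : s ≤ b) (hc : s ≤ c)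
    (hab : c ^ 2 ≤ a ^ 2 + b ^ 2) (hbc : a ^ 2 ≤ b ^ 2 + c ^ 2) (hca : b ^ 2 ≤ c ^ 2 + a ^ 2)
    (hμ : μ = 1 ∨ μ = -1) (hν : ν = 1 ∨ ν = -1) : s / 2 ≤ |c - μ * a - ν * b| := by
  rcases hμ with rfl | rfl <;> rcases hν with rfl | rfl
  · have := half_le_add_sub hs ha hb hc hab
    exact le_abs.2 (Or.inr (by linarith))
  · have := half_le_add_sub hs hb hc ha hbc
    exact le_abs.2 (Or.inl (by linarith))
  · have := half_le_add_sub hs hc ha hb hca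
    exact le_abs.2 (Or.inl (by linarith))
  · exact le_abs.2 (Or.inl (by linarith))

/-- Derivatives of the inverse function away from the origin. -/
theorem norm_iteratedFDeriv_inv_le {n i : ℕ} (hi : i ≤ n) {y : ℝ} (hy : 1 / 2 ≤ |y|) :
    ‖iteratedFDeriv ℝ i (fun t : ℝ => t⁻¹) y‖ ≤ n.factorial * 2 ^ (n + 1) := by
  have hpos : 0 < |y| := by linarith
  have hinv : |y|⁻¹ ≤ 2 := by
    rw [inv_le_comm₀ hpos two_pos]; linarith
  rw [norm_iteratedFDeriv_eq_norm_iteratedDeriv, iteratedDeriv_eq_iterate]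
  have h := iter_deriv_inv (𝕜 := ℝ) i y
  have hz : (-1 - (i : ℤ)) = -((i + 1 : ℕ) : ℤ) := by push_cast; ring
  have h' : deriv^[i] (fun t : ℝ => t⁻¹) y = (-1) ^ i * i.factorial * y ^ (-1 - (i : ℤ)) := h
  rw [h', hz, zpow_neg, zpow_natCast]
  simp only [norm_mul, norm_pow, norm_neg, norm_one, one_pow, one_mul, norm_inv, Real.norm_eq_abs,
    Nat.abs_cast]
  rw [← inv_pow]
  have hf : (i.factorial : ℝ) ≤ n.factorial := by exact_mod_cast Nat.factorial_le hi
  calc (i.factorial : ℝ) * |y|⁻¹ ^ (i + 1) ≤ n.factorial * 2 ^ (i + 1) := by gcongr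
    _ ≤ n.factorial * 2 ^ (n + 1) := by gcongr; norm_num

section NonresonantSet

variable {E : Type*} [NormedAddCommGroup E]

/-- The phase function `‖ξ₁+ξ₂‖^{1/2} − μ‖ξ₁‖^{1/2} − ν‖ξ₂‖^{1/2}`. -/
def phase (μ ν : ℝ) (p : E × E) : ℝ := √‖p.1 + p.2‖ - μ * √‖p.1‖ - ν * √‖p.2‖

/-- The pairs `(ξ₁, ξ₂)` with `ξ₁`, `ξ₂` and `ξ₁ + ξ₂` all nonzero. -/
def nonresonantSet (E : Type*) [NormedAddCommGroup E] : Set (E × E) :=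
  {p | p.1 ≠ 0 ∧ p.2 ≠ 0 ∧ p.1 + p.2 ≠ 0}

/-- The smallest of `‖ξ₁‖`, `‖ξ₂‖`, `‖ξ₁+ξ₂‖`. -/
def minNorm (p : E × E) : ℝ := min (min ‖p.1‖ ‖p.2‖) ‖p.1 + p.2‖

theorem isOpen_nonresonantSet : IsOpen (nonresonantSet E) :=
  (isOpen_ne_fun continuous_fst continuous_const).inter
    ((isOpen_ne_fun continuous_snd continuous_const).inter
      (isOpen_ne_fun (continuous_fst.add continuous_snd) continuous_const))

theorem minNorm_pos {p : E × E} (hp : p ∈ nonresonantSet E) : 0 < minNorm p :=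
  lt_min (lt_min (norm_pos_iff.2 hp.1) (norm_pos_iff.2 hp.2.1)) (norm_pos_iff.2 hp.2.2)

theorem minNorm_le_fst (p : E × E) : minNorm p ≤ ‖p.1‖ :=
  (min_le_left _ _).trans (min_le_left _ _)

theorem minNorm_le_snd (p : E × E) : minNorm p ≤ ‖p.2‖ :=
  (min_le_left _ _).trans (min_le_right _ _)

theorem minNorm_le_add (p : E × E) : minNorm p ≤ ‖p.1 + p.2‖ := min_le_right _ _

theorem half_sqrt_minNorm_le_abs_phase {μ ν : ℝ} (hμ : μ = 1 ∨ μ = -1) (hν : ν = 1 ∨ ν = -1)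
    {p : E × E} (hp : p ∈ nonresonantSet E) : √(minNorm p) / 2 ≤ |phase μ ν p| := by
  refine half_le_abs_phase (Real.sqrt_pos.2 (minNorm_pos hp))
    (Real.sqrt_le_sqrt (minNorm_le_fst p)) (Real.sqrt_le_sqrt (minNorm_le_snd p))
    (Real.sqrt_le_sqrt (minNorm_le_add p)) ?_ ?_ ?_ hμ hν <;>
  simp only [Real.sq_sqrt (norm_nonneg _)]
  · exact norm_add_le _ _
  · have := norm_sub_le (p.1 + p.2) p.2
    rw [add_sub_cancel_right] at this
    linarith
  · have := norm_sub_le (p.1 + p.2) p.1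
    rwa [add_sub_cancel_left] at this

end NonresonantSet

section Phase

variable {E : Type*} [NormedAddCommGroup E] [InnerProductSpace ℝ E]

theorem contDiffAt_sqrt_norm_comp {n : WithTop ℕ∞} (g : E × E →L[ℝ] E) {p : E × E}
    (hp : g p ≠ 0) : ContDiffAt ℝ n (fun q => √‖g q‖) p :=
  (contDiffAt_sqrt_norm hp).comp p g.contDiff.contDiffAt

theorem contDiffAt_phase {n : WithTop ℕ∞} (μ ν : ℝ) {p : E × E} (hp : p ∈ nonresonantSet E) :
    ContDiffAt ℝ n (phase μ ν) p :=
  ((contDiffAt_sqrt_norm_comp (.fst ℝ E E + .snd ℝ E E) hp.2.2).sub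
    (contDiffAt_const.mul (contDiffAt_sqrt_norm_comp (.fst ℝ E E) hp.1))).sub
    (contDiffAt_const.mul (contDiffAt_sqrt_norm_comp (.snd ℝ E E) hp.2.1))

/-- Symbol estimates for `√‖x‖` pulled back along a linear map. -/
theorem exists_norm_iteratedFDeriv_sqrt_norm_comp_le [FiniteDimensional ℝ E] {k : ℕ}
    (hk : 1 ≤ k) :
    ∃ C : ℝ, 0 ≤ C ∧ ∀ (g : E × E →L[ℝ] E) (p : E × E) (m : ℝ), ‖g‖ ≤ 2 → 0 < m → m ≤ ‖g p‖ →
      ‖iteratedFDeriv ℝ k (fun q => √‖g q‖) p‖ ≤ C * (√m / m ^ k) := by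
  obtain ⟨C, hC0, hC⟩ := exists_norm_iteratedFDeriv_sqrt_norm_le (E := E) k
  refine ⟨C * 2 ^ k, by positivity, fun g p m hg hm hgp => ?_⟩
  have hgp0 : g p ≠ 0 := norm_pos_iff.1 (hm.trans_le hgp)
  have hsmooth : ContDiffOn ℝ k (fun y : E => √‖y‖) {0}ᶜ :=
    fun y hy => (contDiffAt_sqrt_norm hy).contDiffWithinAt
  calc ‖iteratedFDeriv ℝ k ((fun y : E => √‖y‖) ∘ g) p‖
      ≤ ‖iteratedFDeriv ℝ k (fun y : E => √‖y‖) (g p)‖ * ‖g‖ ^ k :=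
        norm_iteratedFDeriv_comp_clm_le isOpen_compl_singleton hsmooth g hgp0
    _ ≤ C * (√m / m ^ k) * 2 ^ k := by
        gcongr
        refine (hC _ hgp0).trans ?_
        gcongr C * ?_
        exact sqrt_div_pow_le hm hgp hk
    _ = C * 2 ^ k * (√m / m ^ k) := by ring

/-- Norms of iterated derivatives of a combination `f - μ g - ν h` with signs `μ`, `ν`. -/
theorem norm_iteratedFDeriv_sub_smul_sub_smul_le {V : Type*} [NormedAddCommGroup V]
    [NormedSpace ℝ V] {f g h : V → ℝ} {p : V} {k : ℕ} (hf : ContDiffAt ℝ k f p)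
    (hg : ContDiffAt ℝ k g p) (hh : ContDiffAt ℝ k h p) {μ ν : ℝ}
    (hμ : μ = 1 ∨ μ = -1) (hν : ν = 1 ∨ ν = -1) :
    ‖iteratedFDeriv ℝ k (f - μ • g - ν • h) p‖ ≤
      ‖iteratedFDeriv ℝ k f p‖ + ‖iteratedFDeriv ℝ k g p‖ + ‖iteratedFDeriv ℝ k h p‖ := by
  have hμ1 : ‖μ‖ = 1 := by rcases hμ with rfl | rfl <;> simp
  have hν1 : ‖ν‖ = 1 := by rcases hν with rfl | rfl <;> simp
  have hμg : ContDiffAt ℝ k (μ • g) p := hg.const_smul μ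
  have hνh : ContDiffAt ℝ k (ν • h) p := hh.const_smul ν
  have hfg : ContDiffAt ℝ k (f - μ • g) p := hf.sub hμg
  rw [iteratedFDeriv_sub_apply hfg hνh, iteratedFDeriv_sub_apply hf hμg, iteratedFDeriv_const_smul_apply hg,
    iteratedFDeriv_const_smul_apply hh]
  refine (norm_sub_le _ _).trans ?_
  have h1 := norm_sub_le (iteratedFDeriv ℝ k f p) (μ • iteratedFDeriv ℝ k g p)
  rw [norm_smul, hμ1, one_mul] at h1
  rw [norm_smul, hν1, one_mul]
  gcongr

/-- Addition as a continuous linear map of norm at most `2`. -/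
theorem exists_clm_add :
    ∃ g : E × E →L[ℝ] E, ‖g‖ ≤ 2 ∧ ∀ q, g q = q.1 + q.2 := by
  refine ⟨.fst ℝ E E + .snd ℝ E E, ContinuousLinearMap.opNorm_le_bound _ two_pos.le fun q => ?_,
    fun q => rfl⟩
  have h1 := norm_fst_le q
  have h2 := norm_snd_le q
  have h3 := norm_add_le q.1 q.2
  change ‖q.1 + q.2‖ ≤ 2 * ‖q‖
  linarith

/-- Derivatives of positive order of the phase. -/
theorem exists_norm_iteratedFDeriv_phase_le [FiniteDimensional ℝ E] {k : ℕ} (hk : 1 ≤ k) :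
    ∃ C : ℝ, 0 ≤ C ∧ ∀ μ ν : ℝ, (μ = 1 ∨ μ = -1) → (ν = 1 ∨ ν = -1) →
      ∀ p ∈ nonresonantSet E,
        ‖iteratedFDeriv ℝ k (phase μ ν) p‖ ≤ C * (√(minNorm p) / minNorm p ^ k) := by
  obtain ⟨C, hC0, hC⟩ := exists_norm_iteratedFDeriv_sqrt_norm_comp_le (E := E) hk
  refine ⟨3 * C, by positivity, fun μ ν hμ hν p hp => ?_⟩
  have hm := minNorm_pos hp
  have hfst : ‖ContinuousLinearMap.fst ℝ E E‖ ≤ 1 := ContinuousLinearMap.norm_fst_le ℝ E E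
  have hsnd : ‖ContinuousLinearMap.snd ℝ E E‖ ≤ 1 := ContinuousLinearMap.norm_snd_le ℝ E E
  have h1 := hC (.fst ℝ E E) p _ (hfst.trans one_le_two) hm (minNorm_le_fst p)
  have h2 := hC (.snd ℝ E E) p _ (hsnd.trans one_le_two) hm (minNorm_le_snd p)
  obtain ⟨g, hg, hgq⟩ := exists_clm_add (E := E)
  have h3 := hC g p _ hg hm (by rw [hgq]; exact minNorm_le_add p)
  have c1 : ContDiffAt ℝ k (fun q : E × E => √‖ContinuousLinearMap.fst ℝ E E q‖) p :=
    contDiffAt_sqrt_norm_comp _ hp.1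
  have c2 : ContDiffAt ℝ k (fun q : E × E => √‖ContinuousLinearMap.snd ℝ E E q‖) p :=
    contDiffAt_sqrt_norm_comp _ hp.2.1
  have c3 : ContDiffAt ℝ k (fun q : E × E => √‖g q‖) p :=
    contDiffAt_sqrt_norm_comp g (by rw [hgq]; exact hp.2.2)
  have h := norm_iteratedFDeriv_sub_smul_sub_smul_le c3 c1 c2 hμ hν
  have heq : phase μ ν = (fun q : E × E => √‖g q‖) -
      (μ • fun q : E × E => √‖ContinuousLinearMap.fst ℝ E E q‖) -
      (ν • fun q : E × E => √‖ContinuousLinearMap.snd ℝ E E q‖) := by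
    funext q
    simp [phase, hgq]
  rw [heq]
  refine h.trans ((add_le_add (add_le_add h3 h1) h2).trans_eq ?_)
  ring

/-- Derivatives of the reciprocal of the phase. -/
theorem exists_norm_iteratedFDeriv_inv_phase_le [FiniteDimensional ℝ E] (n : ℕ) :
    ∃ C : ℝ, 0 < C ∧ ∀ μ ν : ℝ, (μ = 1 ∨ μ = -1) → (ν = 1 ∨ ν = -1) →
      ∀ p ∈ nonresonantSet E,
        ‖iteratedFDeriv ℝ n (fun q => (phase μ ν q)⁻¹) p‖ ≤
          C * minNorm p ^ (-(n : ℝ) - 1 / 2) := by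
  have hex (k : ℕ) := exists_norm_iteratedFDeriv_phase_le (E := E) (Nat.le_add_left 1 k)
  choose c hc0 hc using hex
  set K : ℝ := 1 + ∑ k ∈ Finset.range n, c k with hK
  have hsum : 0 ≤ ∑ k ∈ Finset.range n, c k := Finset.sum_nonneg fun k _ => hc0 k
  have hK1 : 1 ≤ K := by linarith
  refine ⟨n.factorial * (n.factorial * 2 ^ (n + 1)) * K ^ n, by positivity,
    fun μ ν hμ hν p hp => ?_⟩
  have hm := minNorm_pos hp
  set m := minNorm p with hmdef
  have hs : 0 < √m := Real.sqrt_pos.2 hm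
  let ψ : E × E → ℝ := (√m)⁻¹ • phase μ ν
  have hne : ∀ q ∈ nonresonantSet E, phase μ ν q ≠ 0 := fun q hq => abs_pos.1
    ((half_pos (Real.sqrt_pos.2 (minNorm_pos hq))).trans_le
      (half_sqrt_minNorm_le_abs_phase hμ hν hq))
  have hψ : ContDiffOn ℝ n ψ (nonresonantSet E) :=
    fun q hq => ((contDiffAt_phase μ ν hq).const_smul (√m)⁻¹).contDiffWithinAt
  have hmaps : Set.MapsTo ψ (nonresonantSet E) {0}ᶜ := fun q hq =>
    mul_ne_zero (inv_ne_zero hs.ne') (hne q hq)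
  have hopen : IsOpen ({0}ᶜ : Set ℝ) := isOpen_compl_singleton
  have hinv : ContDiffOn ℝ n (fun t : ℝ => t⁻¹) {0}ᶜ := contDiffOn_inv ℝ
  have hψp : 1 / 2 ≤ |ψ p| := by
    have h := half_sqrt_minNorm_le_abs_phase hμ hν hp
    have h' : |ψ p| = (√m)⁻¹ * |phase μ ν p| := by
      simp only [ψ, Pi.smul_apply, smul_eq_mul, abs_mul, abs_inv, abs_of_pos hs]
    rw [h', ← div_eq_inv_mul, le_div_iff₀ hs]
    linarith
  have hcomp := norm_iteratedFDerivWithin_comp_le hinv hψ le_rfl hopen.uniqueDiffOn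
    isOpen_nonresonantSet.uniqueDiffOn hmaps hp (C := n.factorial * 2 ^ (n + 1)) (D := K / m)
    (fun i hi => by
      rw [iteratedFDerivWithin_of_isOpen i hopen (hmaps hp)]
      exact norm_iteratedFDeriv_inv_le hi hψp)
    (fun i hi1 hin => by
      rw [iteratedFDerivWithin_of_isOpen i isOpen_nonresonantSet hp,
        iteratedFDeriv_const_smul_apply (contDiffAt_phase μ ν hp), norm_smul,
        Real.norm_of_nonneg (by positivity)]
      obtain ⟨j, rfl⟩ := Nat.exists_eq_add_of_le' hi1
      have hcK : c j ≤ K := by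
        have := Finset.single_le_sum (f := c) (fun k _ => hc0 k)
          (Finset.mem_range.2 (Nat.lt_of_succ_le hin))
        linarith
      calc (√m)⁻¹ * ‖iteratedFDeriv ℝ (j + 1) (phase μ ν) p‖
          ≤ (√m)⁻¹ * (c j * (√m / m ^ (j + 1))) := by
            gcongr
            exact hc j μ ν hμ hν p hp
        _ = c j / m ^ (j + 1) := by field_simp
        _ ≤ K ^ (j + 1) / m ^ (j + 1) := by
            gcongr
            exact hcK.trans (le_self_pow₀ hK1 (Nat.succ_ne_zero j))
        _ = (K / m) ^ (j + 1) := (div_pow _ _ _).symm)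
  rw [iteratedFDerivWithin_of_isOpen n isOpen_nonresonantSet hp] at hcomp
  have hcd : ContDiffAt ℝ n ((fun t : ℝ => t⁻¹) ∘ ψ) p :=
    (hinv.comp hψ hmaps).contDiffAt (isOpen_nonresonantSet.mem_nhds hp)
  have heq : (fun q : E × E => (phase μ ν q)⁻¹) = (√m)⁻¹ • ((fun t : ℝ => t⁻¹) ∘ ψ) := by
    funext q
    simp only [ψ, Pi.smul_apply, Function.comp_apply, smul_eq_mul, mul_inv, inv_inv]
    rw [inv_mul_cancel_left₀ hs.ne']
  have hpow : m ^ (-(n : ℝ) - 1 / 2) = (√m)⁻¹ * (m ^ n)⁻¹ := by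
    rw [sub_eq_add_neg, Real.rpow_add hm, Real.rpow_neg hm.le, Real.rpow_neg hm.le,
      Real.rpow_natCast, ← Real.sqrt_eq_rpow, mul_comm]
  rw [heq, iteratedFDeriv_const_smul_apply hcd, norm_smul, Real.norm_of_nonneg (by positivity),
    hpow]
  calc (√m)⁻¹ * ‖iteratedFDeriv ℝ n ((fun t : ℝ => t⁻¹) ∘ ψ) p‖
      ≤ (√m)⁻¹ * (n.factorial * (n.factorial * 2 ^ (n + 1)) * (K / m) ^ n) := by gcongr
    _ = _ := by rw [div_pow]; ring

end Phase

/-- On the set where `ξ₁, ξ₂, ξ₁+ξ₂` are all nonzero, `1/Φ_{μν}` is smooth and its `L`-th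
derivative is bounded by `C_L · min(‖ξ₁‖,‖ξ₂‖,‖ξ₁+ξ₂‖)^{-L-1/2}`. -/
theorem stmt4 (L : ℕ) :
    ∃ C : ℝ, 0 < C ∧
      ∀ μ ν : ℝ, (μ = 1 ∨ μ = -1) → (ν = 1 ∨ ν = -1) →
        ContDiffOn ℝ (⊤ : ℕ∞) (PhiInv μ ν)
          {p : EuclideanSpace ℝ (Fin 2) × EuclideanSpace ℝ (Fin 2) |
            p.1 ≠ 0 ∧ p.2 ≠ 0 ∧ p.1 + p.2 ≠ 0} ∧
        ∀ p : EuclideanSpace ℝ (Fin 2) × EuclideanSpace ℝ (Fin 2),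
          p.1 ≠ 0 → p.2 ≠ 0 → p.1 + p.2 ≠ 0 →
          ‖iteratedFDeriv ℝ L (PhiInv μ ν) p‖ ≤
            C * (min (min ‖p.1‖ ‖p.2‖) ‖p.1 + p.2‖) ^ (-(L : ℝ) - 1 / 2) := by
  obtain ⟨C, hC0, hC⟩ :=
    exists_norm_iteratedFDeriv_inv_phase_le (E := EuclideanSpace ℝ (Fin 2)) L
  refine ⟨C, hC0, fun μ ν hμ hν => ⟨fun p hp => ?_, fun p h1 h2 h3 =>
    hC μ ν hμ hν p ⟨h1, h2, h3⟩⟩⟩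
  refine ((contDiffAt_phase μ ν hp).inv ?_).contDiffWithinAt
  exact abs_pos.1 ((half_pos (Real.sqrt_pos.2 (minNorm_pos hp))).trans_le
    (half_sqrt_minNorm_le_abs_phase hμ hν hp))

end
end

section
/- For every integer L ≥ 0 there is a constant C_L such that for i ∈ {1, 2} and every point (ξ₁, ξ₂) of the open set U = {(ξ₁, ξ₂) ∈ ℝ² × ℝ² : ξ₁ ≠ 0, ξ₂ ≠ 0, ξ₁ + ξ₂ ≠ 0}, the L-th total derivative of m_i with respect to (ξ₁, ξ₂) ∈ ℝ⁴ satisfies ‖∇^L m_i(ξ₁, ξ₂)‖ ≤ C_L · (‖ξ₁‖ + ‖ξ₂‖)^{3/2} · min(‖ξ₁‖, ‖ξ₂‖, ‖ξ₁+ξ₂‖)^{−L}. -/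
open scoped RealInnerProductSpace

noncomputable section

/-- The quadratic interaction multiplier
`m₁(ξ₁,ξ₂) = (‖ξ₁+ξ₂‖·‖ξ₂‖ − ⟨ξ₁+ξ₂, ξ₂⟩)/‖ξ₂‖^{1/2}` of the gravity water wave system. -/
def mGWW1 (p : EuclideanSpace ℝ (Fin 2) × EuclideanSpace ℝ (Fin 2)) : ℝ :=
  (‖p.1 + p.2‖ * ‖p.2‖ - ⟪p.1 + p.2, p.2⟫) / Real.sqrt ‖p.2‖

/-- The quadratic interaction multiplier
`m₂(ξ₁,ξ₂) = ‖ξ₁+ξ₂‖^{1/2}·(‖ξ₁‖·‖ξ₂‖ + ⟨ξ₁, ξ₂⟩)/(‖ξ₁‖·‖ξ₂‖)^{1/2}` of the gravity water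
wave system. -/
def mGWW2 (p : EuclideanSpace ℝ (Fin 2) × EuclideanSpace ℝ (Fin 2)) : ℝ :=
  Real.sqrt ‖p.1 + p.2‖ * (‖p.1‖ * ‖p.2‖ + ⟪p.1, p.2⟫) / Real.sqrt (‖p.1‖ * ‖p.2‖)

open scoped ContDiff

section Symbols

variable {V : Type*} [NormedAddCommGroup V]

variable (V) in
/-- The pairs of frequencies with `ξ₁`, `ξ₂` and `ξ₁ + ξ₂` all nonzero. -/
def interactionRegion : Set (V × V) := {p | p.1 ≠ 0 ∧ p.2 ≠ 0 ∧ p.1 + p.2 ≠ 0}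

/-- The smallest of the three frequencies `‖ξ₁‖`, `‖ξ₂‖`, `‖ξ₁ + ξ₂‖`. -/
def minFrequency (p : V × V) : ℝ := min (min ‖p.1‖ ‖p.2‖) ‖p.1 + p.2‖

theorem isOpen_interactionRegion : IsOpen (interactionRegion V) :=
  (isOpen_ne_fun continuous_fst continuous_const).inter
    ((isOpen_ne_fun continuous_snd continuous_const).inter
      (isOpen_ne_fun (continuous_fst.add continuous_snd) continuous_const))

theorem minFrequency_pos {p : V × V} (hp : p ∈ interactionRegion V) : 0 < minFrequency p :=
  lt_min (lt_min (norm_pos_iff.2 hp.1) (norm_pos_iff.2 hp.2.1)) (norm_pos_iff.2 hp.2.2)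

theorem norm_fst_add_norm_snd_pos {p : V × V} (hp : p ∈ interactionRegion V) :
    0 < ‖p.1‖ + ‖p.2‖ :=
  add_pos (norm_pos_iff.2 hp.1) (norm_pos_iff.2 hp.2.1)

variable {F G H : Type*} [InnerProductSpace ℝ V]
  [NormedAddCommGroup F] [NormedSpace ℝ F] [NormedAddCommGroup G] [NormedSpace ℝ G]
  [NormedAddCommGroup H] [NormedSpace ℝ H]

/-- `f` is smooth on the interaction region, and its `n`-th derivative is bounded there by a
multiple of `(‖ξ₁‖ + ‖ξ₂‖) ^ a * minFrequency (ξ₁, ξ₂) ^ (-n)`. -/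
structure IsInteractionSymbol (f : V × V → F) (a : ℝ) : Prop where
  contDiffOn : ContDiffOn ℝ ∞ f (interactionRegion V)
  bound (n : ℕ) : ∃ C : ℝ, ∀ p ∈ interactionRegion V,
    ‖iteratedFDerivWithin ℝ n f (interactionRegion V) p‖ ≤
      C * (‖p.1‖ + ‖p.2‖) ^ a * (minFrequency p)⁻¹ ^ n

/-- Derivatives of order `n` of a positively homogeneous function of degree `a` which is smooth away
from the origin are `O(‖x‖ ^ (a - n))`. -/
theorem exists_norm_iteratedFDerivWithin_le_of_homogeneous [FiniteDimensional ℝ V]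
    {g : V → F} {a : ℝ} (hg : ContDiffOn ℝ ∞ g {0}ᶜ)
    (hom : ∀ t : ℝ, 0 < t → ∀ x, g (t • x) = t ^ a • g x) (n : ℕ) :
    ∃ C : ℝ, 0 ≤ C ∧ ∀ x ≠ 0,
      ‖iteratedFDerivWithin ℝ n g {0}ᶜ x‖ ≤ C * ‖x‖ ^ a * ‖x‖⁻¹ ^ n := by
  have : ProperSpace V := FiniteDimensional.proper ℝ V
  have hs : IsOpen ({0}ᶜ : Set V) := isOpen_compl_singleton
  have hn : ((n : ℕ∞) : ℕ∞ω) ≤ ∞ := by exact_mod_cast le_top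
  obtain ⟨K, hK⟩ := (isCompact_sphere (0 : V) 1).exists_bound_of_continuousOn
    ((hg.continuousOn_iteratedFDerivWithin hn hs.uniqueDiffOn).mono
      fun x hx => by simpa using ne_zero_of_mem_unit_sphere ⟨x, hx⟩)
  refine ⟨|K|, abs_nonneg K, fun x hx => ?_⟩
  have hr : 0 < ‖x‖ := norm_pos_iff.2 hx
  set r := ‖x‖
  let A : V →L[ℝ] V := r⁻¹ • ContinuousLinearMap.id ℝ V
  have hA : A ⁻¹' {0}ᶜ = {0}ᶜ := by ext y; simp [A, hr.ne']
  have hAx : A x ∈ ({0}ᶜ : Set V) := by simp [A, hr.ne', hx]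
  have hAn : ‖A‖ ≤ r⁻¹ := by
    refine (norm_smul_le r⁻¹ (ContinuousLinearMap.id ℝ V)).trans ?_
    rw [Real.norm_of_nonneg (inv_nonneg.2 hr.le)]
    exact mul_le_of_le_one_right (inv_nonneg.2 hr.le) ContinuousLinearMap.norm_id_le
  have hgA : g = r ^ a • (g ∘ A) := by
    ext y
    have := hom r hr (A y)
    simpa [A, smul_smul, hr.ne'] using this
  have hcomp := A.iteratedFDerivWithin_comp_right hg hs.uniqueDiffOn
    (by rw [hA]; exact hs.uniqueDiffOn) hAx hn
  rw [hA] at hcomp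
  have hgA' : ContDiffOn ℝ n (g ∘ A) {0}ᶜ :=
    (hg.of_le hn).comp A.contDiff.contDiffOn hA.ge
  have key : iteratedFDerivWithin ℝ n g {0}ᶜ x =
      r ^ a • (iteratedFDerivWithin ℝ n g {0}ᶜ (A x)).compContinuousLinearMap fun _ => A := by
    conv_lhs => rw [hgA]
    rw [iteratedFDerivWithin_const_smul_apply (hgA' x hx) hs.uniqueDiffOn hx, hcomp]
  have hKx : ‖iteratedFDerivWithin ℝ n g {0}ᶜ (A x)‖ ≤ |K| :=
    (hK _ (by simp [A, norm_smul, r, hr.ne'])).trans (le_abs_self K)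
  rw [key, norm_smul, Real.norm_of_nonneg (by positivity)]
  calc r ^ a * ‖(iteratedFDerivWithin ℝ n g {0}ᶜ (A x)).compContinuousLinearMap fun _ => A‖
      ≤ r ^ a * (‖iteratedFDerivWithin ℝ n g {0}ᶜ (A x)‖ * ∏ _i : Fin n, ‖A‖) := by
        gcongr
        exact ContinuousMultilinearMap.norm_compContinuousLinearMap_le _ _
    _ ≤ r ^ a * (|K| * r⁻¹ ^ n) := by
        rw [Finset.prod_const, Finset.card_univ, Fintype.card_fin]
        gcongr
    _ = |K| * r ^ a * r⁻¹ ^ n := by ring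

theorem isInteractionSymbol_comp_of_homogeneous [FiniteDimensional ℝ V]
    {g : V → F} {a : ℝ} (ha : 0 ≤ a) (hg : ContDiffOn ℝ ∞ g {0}ᶜ)
    (hom : ∀ t : ℝ, 0 < t → ∀ x, g (t • x) = t ^ a • g x) (A : V × V →L[ℝ] V)
    (hA : ∀ p, minFrequency p ≤ ‖A p‖) (hA' : ∀ p, ‖A p‖ ≤ ‖p.1‖ + ‖p.2‖) :
    IsInteractionSymbol (fun p => g (A p)) a := by
  have hs : IsOpen ({0}ᶜ : Set V) := isOpen_compl_singleton
  have hpos : ∀ p ∈ interactionRegion V, A p ∈ ({0}ᶜ : Set V) := fun p hp =>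
    norm_pos_iff.1 ((minFrequency_pos hp).trans_le (hA p))
  refine ⟨hg.comp A.contDiff.contDiffOn hpos, fun n => ?_⟩
  obtain ⟨C, hC, hb⟩ := exists_norm_iteratedFDerivWithin_le_of_homogeneous hg hom n
  refine ⟨C * ‖A‖ ^ n, fun p hp => ?_⟩
  have hm := minFrequency_pos hp
  have hpre : IsOpen (A ⁻¹' {0}ᶜ) := hs.preimage A.continuous
  have hcomp := A.iteratedFDerivWithin_comp_right hg hs.uniqueDiffOn hpre.uniqueDiffOn
    (hpos p hp) (i := n) (by exact_mod_cast le_top)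
  rw [iteratedFDerivWithin_of_isOpen n hpre (hpos p hp)] at hcomp
  rw [iteratedFDerivWithin_of_isOpen n isOpen_interactionRegion hp]
  change ‖iteratedFDeriv ℝ n (g ∘ A) p‖ ≤ _
  rw [hcomp]
  calc _ ≤ ‖iteratedFDerivWithin ℝ n g {0}ᶜ (A p)‖ * ∏ _i : Fin n, ‖A‖ :=
        ContinuousMultilinearMap.norm_compContinuousLinearMap_le _ _
    _ ≤ (C * ‖A p‖ ^ a * ‖A p‖⁻¹ ^ n) * ‖A‖ ^ n := by
        rw [Finset.prod_const, Finset.card_univ, Fintype.card_fin]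
        gcongr
        exact hb _ (hpos p hp)
    _ ≤ (C * (‖p.1‖ + ‖p.2‖) ^ a * (minFrequency p)⁻¹ ^ n) * ‖A‖ ^ n := by
        gcongr
        · exact hA' p
        · exact hA p
    _ = _ := by ring

namespace IsInteractionSymbol

theorem congr {f g : V × V → F} {a : ℝ} (hf : IsInteractionSymbol f a)
    (h : Set.EqOn g f (interactionRegion V)) : IsInteractionSymbol g a := by
  refine ⟨hf.contDiffOn.congr h, fun n => ?_⟩
  obtain ⟨C, hC⟩ := hf.bound n
  refine ⟨C, fun p hp => ?_⟩
  rw [iteratedFDerivWithin_congr h hp]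
  exact hC p hp

theorem add {f g : V × V → F} {a : ℝ} (hf : IsInteractionSymbol f a)
    (hg : IsInteractionSymbol g a) : IsInteractionSymbol (f + g) a := by
  refine ⟨hf.contDiffOn.add hg.contDiffOn, fun n => ?_⟩
  obtain ⟨C, hC⟩ := hf.bound n
  obtain ⟨D, hD⟩ := hg.bound n
  refine ⟨C + D, fun p hp => ?_⟩
  have hn : ((n : ℕ∞) : ℕ∞ω) ≤ ∞ := by exact_mod_cast le_top
  rw [iteratedFDerivWithin_add_apply ((hf.contDiffOn.of_le hn) p hp)
    ((hg.contDiffOn.of_le hn) p hp) isOpen_interactionRegion.uniqueDiffOn hp]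
  linarith [norm_add_le (iteratedFDerivWithin ℝ n f (interactionRegion V) p)
    (iteratedFDerivWithin ℝ n g (interactionRegion V) p), hC p hp, hD p hp]

theorem bilinear (B : F →L[ℝ] G →L[ℝ] H) {f : V × V → F} {g : V × V → G} {a b : ℝ}
    (hf : IsInteractionSymbol f a) (hg : IsInteractionSymbol g b) :
    IsInteractionSymbol (fun p => B (f p) (g p)) (a + b) := by
  refine ⟨B.isBoundedBilinearMap.contDiff.comp₂_contDiffOn hf.contDiffOn hg.contDiffOn,
    fun n => ?_⟩
  choose C hC using hf.bound
  choose D hD using hg.bound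
  refine ⟨‖B‖ * ∑ i ∈ Finset.range (n + 1), (n.choose i : ℝ) * C i * D (n - i), fun p hp => ?_⟩
  refine (B.norm_iteratedFDerivWithin_le_of_bilinear hf.contDiffOn hg.contDiffOn
    isOpen_interactionRegion.uniqueDiffOn hp (n := n) (by exact_mod_cast le_top)).trans ?_
  rw [mul_assoc, mul_assoc, Finset.sum_mul]
  refine mul_le_mul_of_nonneg_left (Finset.sum_le_sum fun i hi => ?_) (norm_nonneg B)
  have hin : i + (n - i) = n := Nat.add_sub_cancel' (Nat.lt_succ_iff.1 (Finset.mem_range.1 hi))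
  calc _ ≤ (n.choose i : ℝ) * (C i * (‖p.1‖ + ‖p.2‖) ^ a * (minFrequency p)⁻¹ ^ i) *
        (D (n - i) * (‖p.1‖ + ‖p.2‖) ^ b * (minFrequency p)⁻¹ ^ (n - i)) := by
        have := (norm_nonneg _).trans (hC i p hp)
        gcongr
        · exact hC i p hp
        · exact hD (n - i) p hp
    _ = (n.choose i : ℝ) * C i * D (n - i) * (((‖p.1‖ + ‖p.2‖) ^ a * (‖p.1‖ + ‖p.2‖) ^ b) *
        ((minFrequency p)⁻¹ ^ i * (minFrequency p)⁻¹ ^ (n - i))) := by ring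
    _ = _ := by rw [← Real.rpow_add (norm_fst_add_norm_snd_pos hp), ← pow_add, hin]

theorem mul {f g : V × V → ℝ} {a b : ℝ} (hf : IsInteractionSymbol f a)
    (hg : IsInteractionSymbol g b) : IsInteractionSymbol (fun p => f p * g p) (a + b) :=
  hf.bilinear (ContinuousLinearMap.mul ℝ ℝ) hg

theorem inner {f g : V × V → V} {a b : ℝ} (hf : IsInteractionSymbol f a)
    (hg : IsInteractionSymbol g b) : IsInteractionSymbol (fun p => ⟪f p, g p⟫) (a + b) :=
  hf.bilinear (isBoundedBilinearMap_inner (𝕜 := ℝ) (E := V)).toContinuousLinearMap hg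

theorem neg {f : V × V → F} {a : ℝ} (hf : IsInteractionSymbol f a) :
    IsInteractionSymbol (-f) a := by
  refine ⟨hf.contDiffOn.neg, fun n => ?_⟩
  obtain ⟨C, hC⟩ := hf.bound n
  refine ⟨C, fun p hp => ?_⟩
  rw [iteratedFDerivWithin_neg_apply isOpen_interactionRegion.uniqueDiffOn hp, norm_neg]
  exact hC p hp

end IsInteractionSymbol

theorem contDiffOn_norm_rpow_compl_zero (a : ℝ) :
    ContDiffOn ℝ ∞ (fun x : V => ‖x‖ ^ a) {0}ᶜ := fun _ hx =>
  ((contDiffAt_norm ℝ hx).rpow_const_of_ne (norm_ne_zero_iff.2 hx)).contDiffWithinAt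

theorem isInteractionSymbol_norm_rpow [FiniteDimensional ℝ V] {a : ℝ} (ha : 0 ≤ a)
    (A : V × V →L[ℝ] V) (hA : ∀ p, minFrequency p ≤ ‖A p‖)
    (hA' : ∀ p, ‖A p‖ ≤ ‖p.1‖ + ‖p.2‖) :
    IsInteractionSymbol (fun p => ‖A p‖ ^ a) a :=
  isInteractionSymbol_comp_of_homogeneous ha (contDiffOn_norm_rpow_compl_zero a)
    (fun t ht x => by
      rw [norm_smul, Real.norm_of_nonneg ht.le, Real.mul_rpow ht.le (norm_nonneg x), smul_eq_mul])
    A hA hA'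

theorem isInteractionSymbol_norm_rpow_smul [FiniteDimensional ℝ V] {a : ℝ} (ha : 0 ≤ a + 1)
    (A : V × V →L[ℝ] V) (hA : ∀ p, minFrequency p ≤ ‖A p‖)
    (hA' : ∀ p, ‖A p‖ ≤ ‖p.1‖ + ‖p.2‖) :
    IsInteractionSymbol (fun p => ‖A p‖ ^ a • A p) (a + 1) :=
  isInteractionSymbol_comp_of_homogeneous (g := fun x : V => ‖x‖ ^ a • x) ha
    ((contDiffOn_norm_rpow_compl_zero a).smul contDiffOn_id)
    (fun t ht x => by
      rw [norm_smul, Real.norm_of_nonneg ht.le, Real.mul_rpow ht.le (norm_nonneg x), smul_smul,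
        smul_smul, Real.rpow_add_one ht.ne']
      congr 1
      ring)
    A hA hA'

theorem minFrequency_le_norm_fst (p : V × V) :
    minFrequency p ≤ ‖ContinuousLinearMap.fst ℝ V V p‖ :=
  (min_le_left _ _).trans (min_le_left _ _)

theorem minFrequency_le_norm_snd (p : V × V) :
    minFrequency p ≤ ‖ContinuousLinearMap.snd ℝ V V p‖ :=
  (min_le_left _ _).trans (min_le_right _ _)

theorem minFrequency_le_norm_add (p : V × V) :
    minFrequency p ≤ ‖(ContinuousLinearMap.fst ℝ V V + ContinuousLinearMap.snd ℝ V V) p‖ :=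
  min_le_right _ _

theorem norm_fst_le_norm_add_norm (p : V × V) :
    ‖ContinuousLinearMap.fst ℝ V V p‖ ≤ ‖p.1‖ + ‖p.2‖ :=
  le_add_of_nonneg_right (norm_nonneg _)

theorem norm_snd_le_norm_add_norm (p : V × V) :
    ‖ContinuousLinearMap.snd ℝ V V p‖ ≤ ‖p.1‖ + ‖p.2‖ :=
  le_add_of_nonneg_left (norm_nonneg _)

theorem norm_fst_add_snd_le (p : V × V) :
    ‖(ContinuousLinearMap.fst ℝ V V + ContinuousLinearMap.snd ℝ V V) p‖ ≤ ‖p.1‖ + ‖p.2‖ :=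
  norm_add_le _ _

end Symbols

theorem isInteractionSymbol_mGWW1 : IsInteractionSymbol mGWW1 (3 / 2) := by
  have hN := (isInteractionSymbol_norm_rpow (V := EuclideanSpace ℝ (Fin 2)) zero_le_one _
    minFrequency_le_norm_add norm_fst_add_snd_le).mul
    (isInteractionSymbol_norm_rpow (a := 1 / 2) (by norm_num) _
      minFrequency_le_norm_snd norm_snd_le_norm_add_norm)
  have hI := (isInteractionSymbol_norm_rpow_smul (V := EuclideanSpace ℝ (Fin 2)) (a := 0)
    (by norm_num) _ minFrequency_le_norm_add norm_fst_add_snd_le).inner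
    (isInteractionSymbol_norm_rpow_smul (a := -(1 / 2)) (by norm_num) _
      minFrequency_le_norm_snd norm_snd_le_norm_add_norm)
  rw [show (1 : ℝ) + 1 / 2 = 3 / 2 by norm_num] at hN
  rw [show (0 : ℝ) + 1 + (-(1 / 2) + 1) = 3 / 2 by norm_num] at hI
  refine (hN.add hI.neg).congr fun p hp => ?_
  have h₂ : 0 < √‖p.2‖ := Real.sqrt_pos.2 (norm_pos_iff.2 hp.2.1)
  simp only [mGWW1, Pi.add_apply, Pi.neg_apply, add_apply,
    ContinuousLinearMap.coe_fst', ContinuousLinearMap.coe_snd', Real.rpow_one, Real.rpow_zero,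
    one_smul, real_inner_smul_right, Real.rpow_neg (norm_nonneg _), ← Real.sqrt_eq_rpow]
  field_simp
  rw [Real.sq_sqrt (norm_nonneg _)]
  ring

theorem isInteractionSymbol_mGWW2 : IsInteractionSymbol mGWW2 (3 / 2) := by
  have hN := (isInteractionSymbol_norm_rpow (V := EuclideanSpace ℝ (Fin 2)) (a := 1 / 2)
    (by norm_num) _ minFrequency_le_norm_fst norm_fst_le_norm_add_norm).mul
    (isInteractionSymbol_norm_rpow (a := 1 / 2) (by norm_num) _
      minFrequency_le_norm_snd norm_snd_le_norm_add_norm)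
  have hI := (isInteractionSymbol_norm_rpow_smul (V := EuclideanSpace ℝ (Fin 2)) (a := -(1 / 2))
    (by norm_num) _ minFrequency_le_norm_fst norm_fst_le_norm_add_norm).inner
    (isInteractionSymbol_norm_rpow_smul (a := -(1 / 2)) (by norm_num) _
      minFrequency_le_norm_snd norm_snd_le_norm_add_norm)
  rw [show (1 : ℝ) / 2 + 1 / 2 = 1 by norm_num] at hN
  rw [show -((1 : ℝ) / 2) + 1 + (-(1 / 2) + 1) = 1 by norm_num] at hI
  have h := (isInteractionSymbol_norm_rpow (a := 1 / 2) (by norm_num) _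
    minFrequency_le_norm_add norm_fst_add_snd_le).mul (hN.add hI)
  rw [show (1 : ℝ) / 2 + 1 = 3 / 2 by norm_num] at h
  refine h.congr fun p hp => ?_
  have h₁ : 0 < √‖p.1‖ := Real.sqrt_pos.2 (norm_pos_iff.2 hp.1)
  have h₂ : 0 < √‖p.2‖ := Real.sqrt_pos.2 (norm_pos_iff.2 hp.2.1)
  simp only [mGWW2, Pi.add_apply, add_apply,
    ContinuousLinearMap.coe_fst', ContinuousLinearMap.coe_snd', real_inner_smul_left,
    real_inner_smul_right, Real.rpow_neg (norm_nonneg _), ← Real.sqrt_eq_rpow,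
    Real.sqrt_mul (norm_nonneg _)]
  field_simp
  rw [Real.sq_sqrt (norm_nonneg _), Real.sq_sqrt (norm_nonneg _)]

/-- Derivative bounds for the quadratic multipliers `m₁, m₂` on the set where
`ξ₁, ξ₂, ξ₁+ξ₂` are all nonzero:
`‖∇^L m_i‖ ≤ C_L (‖ξ₁‖+‖ξ₂‖)^{3/2} min(‖ξ₁‖,‖ξ₂‖,‖ξ₁+ξ₂‖)^{-L}`. -/
theorem stmt5 (L : ℕ) :
    ∃ C : ℝ, 0 < C ∧
      ∀ m : EuclideanSpace ℝ (Fin 2) × EuclideanSpace ℝ (Fin 2) → ℝ,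
        (m = mGWW1 ∨ m = mGWW2) →
        ∀ p : EuclideanSpace ℝ (Fin 2) × EuclideanSpace ℝ (Fin 2),
          p.1 ≠ 0 → p.2 ≠ 0 → p.1 + p.2 ≠ 0 →
          ‖iteratedFDeriv ℝ L m p‖ ≤
            C * (‖p.1‖ + ‖p.2‖) ^ ((3 : ℝ) / 2) *
              (min (min ‖p.1‖ ‖p.2‖) ‖p.1 + p.2‖) ^ (-(L : ℤ)) := by
  obtain ⟨C, hC⟩ := isInteractionSymbol_mGWW1.bound L
  obtain ⟨D, hD⟩ := isInteractionSymbol_mGWW2.bound L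
  refine ⟨max 1 (max C D), lt_max_of_lt_left one_pos, fun m hm p h₁ h₂ h₃ => ?_⟩
  have hp : p ∈ interactionRegion (EuclideanSpace ℝ (Fin 2)) := ⟨h₁, h₂, h₃⟩
  have hpos := minFrequency_pos hp
  rw [← iteratedFDerivWithin_of_isOpen L isOpen_interactionRegion hp, zpow_neg, zpow_natCast,
    ← inv_pow]
  change _ ≤ _ * (minFrequency p)⁻¹ ^ L
  rcases hm with rfl | rfl
  · refine (hC p hp).trans ?_
    gcongr
    exact (le_max_left C D).trans (le_max_right _ _)
  · refine (hD p hp).trans ?_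
    gcongr
    exact (le_max_right C D).trans (le_max_right _ _)

end
end

section
/- Let ψ : ℝ² → ℂ be smooth and supported in the annulus {ξ : 1/4 ≤ ‖ξ‖ ≤ 2}. There is a constant C = C(ψ) such that for every k ∈ ℤ, every t ≥ 0, all exponents 1 ≤ p ≤ 2 ≤ q ≤ ∞ with 1/p + 1/q = 1, and every Schwartz function u : ℝ² → ℂ, one has ‖K_{k,t} ⋆ u‖_{L^q(ℝ²)} ≤ C · [2^{2k}(1 + 2^{k/2} t)^{−1}]^{(1/p − 1/q)} · ‖u‖_{L^p(ℝ²)}, where ⋆ denotes convolution. -/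
open MeasureTheory Complex
open scoped ENNReal RealInnerProductSpace

noncomputable section

/-- The kernel `K_{k,t}(z) = ∫_{ℝ²} e^{i(z·ξ − t‖ξ‖^{1/2})} ψ(2^{−k}ξ) dξ` of the
frequency-localized linear evolution `e^{−itΛ}`, `Λ(ξ) = ‖ξ‖^{1/2}`, of the gravity water
wave equation. -/
def waveKernel (ψ : EuclideanSpace ℝ (Fin 2) → ℂ) (k : ℤ) (t : ℝ)
    (z : EuclideanSpace ℝ (Fin 2)) : ℂ :=
  ∫ ξ : EuclideanSpace ℝ (Fin 2),
    Complex.exp (Complex.I * ((⟪z, ξ⟫ - t * Real.sqrt ‖ξ‖ : ℝ) : ℂ)) * ψ ((2 : ℝ) ^ (-k) • ξ)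

open scoped ContDiff ComplexConjugate

section Oscillatory

variable {P E : Type*} [NormedAddCommGroup P] [NormedAddCommGroup E]

/-- The integrals over the fibres of a continuous compactly supported function on a product are
uniformly bounded. -/
lemma exists_norm_fiber_integral_le [NormedSpace ℝ E] [FiniteDimensional ℝ E] [MeasurableSpace E]
    [BorelSpace E] (μ : Measure E) [IsFiniteMeasureOnCompacts μ] {a : P × E → ℂ}
    (ha : Continuous a) (hc : HasCompactSupport a) :
    ∃ C, ∀ p, ∀ f : E → ℂ, (∀ η, ‖f η‖ ≤ ‖a (p, η)‖) → ‖∫ η, f η ∂μ‖ ≤ C := by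
  obtain ⟨M, hM⟩ := hc.exists_bound_of_continuous ha
  set S : Set E := Prod.snd '' tsupport a with hS
  have hSc : IsCompact S := hc.isCompact.image continuous_snd
  refine ⟨M * μ.real S, fun p f hf => ?_⟩
  have hzero : ∀ η, η ∉ S → f η = 0 := by
    intro η hη
    have h0 : a (p, η) = 0 := by
      by_contra h
      exact hη ⟨(p, η), subset_tsupport _ h, rfl⟩
    simpa [h0] using hf η
  rw [← setIntegral_eq_integral_of_forall_compl_eq_zero hzero]
  exact norm_setIntegral_le_of_norm_le_const hSc.measure_lt_top fun η _ => (hf η).trans (hM _)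

/-- Non-stationary phase, uniformly in parameters. -/
lemma exists_norm_oscillatory_integral_le_s6 [NormedSpace ℝ P] [InnerProductSpace ℝ E]
    [FiniteDimensional ℝ E]
    [MeasurableSpace E] [BorelSpace E] {U : Set (P × E)} (hU : IsOpen U) {Φ : P × E → ℝ}
    (hΦ : ContDiffOn ℝ ∞ Φ U) (hcrit : ∀ x ∈ U, ∃ v : E, fderiv ℝ Φ x (0, v) ≠ 0) (N : ℕ) :
    ∀ a : P × E → ℂ, ContDiff ℝ ∞ a → HasCompactSupport a → tsupport a ⊆ U →
      ∃ C, ∀ (p : P) (l : ℝ), l ≠ 0 →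
        ‖∫ η, cexp (I * ((l * Φ (p, η) : ℝ) : ℂ)) * a (p, η)‖ ≤ C / |l| ^ N := by
  induction N with
  | zero =>
    intro a ha hc hsub
    obtain ⟨C, hC⟩ := exists_norm_fiber_integral_le (volume : Measure E) ha.continuous hc
    refine ⟨C, fun p l hl => ?_⟩
    rw [pow_zero, div_one]
    refine hC p _ fun η => ?_
    rw [norm_mul, mul_comm I, Complex.norm_exp_ofReal_mul_I, one_mul]
  | succ N ih =>
    intro a ha hc hsub
    set b := stdOrthonormalBasis ℝ E
    set e : Fin (Module.finrank ℝ E) → P × E := fun j => (0, b j) with he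
    set G : P × E → ℝ := fun x => ∑ j, fderiv ℝ Φ x (e j) ^ 2 with hG
    have hDsm : ∀ x ∈ U, ∀ j, ContDiffAt ℝ ∞ (fun x => fderiv ℝ Φ x (e j)) x := by
      intro x hx j
      have h1 : ContDiffAt ℝ ∞ Φ x := hΦ.contDiffAt (hU.mem_nhds hx)
      exact (h1.fderiv_right (m := ∞) (by simp)).clm_apply contDiffAt_const
    have hGpos : ∀ x ∈ U, 0 < G x := by
      intro x hx
      by_contra hneg
      have h0 : ∀ j, fderiv ℝ Φ x (e j) = 0 := by
        have h1 : G x = 0 := le_antisymm (not_lt.1 hneg) (Finset.sum_nonneg fun j _ => sq_nonneg _)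
        intro j
        have := (Finset.sum_eq_zero_iff_of_nonneg (fun j _ => sq_nonneg _)).1 h1 j
          (Finset.mem_univ _)
        simpa using this
      obtain ⟨v, hv⟩ := hcrit x hx
      apply hv
      have h2 : ((fderiv ℝ Φ x).comp (ContinuousLinearMap.inr ℝ P E) : E →ₗ[ℝ] ℝ) = 0 := by
        refine b.toBasis.ext fun j => ?_
        simpa [he] using h0 j
      simpa using LinearMap.congr_fun h2 v
    have hGsm : ∀ x ∈ U, ContDiffAt ℝ ∞ G x := fun x hx =>
      ContDiffAt.sum fun j _ => (hDsm x hx j).pow 2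
    set B : Fin (Module.finrank ℝ E) → P × E → ℂ := fun j x =>
      a x * ((fderiv ℝ Φ x (e j) / G x : ℝ) : ℂ) with hB
    have hBsupp : ∀ j, tsupport (B j) ⊆ tsupport a := fun j => tsupport_mul_subset_left
    have hBsm : ∀ j, ContDiff ℝ ∞ (B j) := by
      intro j
      rw [contDiff_iff_contDiffAt]
      intro x
      by_cases hx : x ∈ tsupport a
      · have hxU := hsub hx
        exact ha.contDiffAt.mul (ofRealCLM.contDiff.contDiffAt.comp x
          ((hDsm x hxU j).div (hGsm x hxU) (hGpos x hxU).ne'))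
      · have : B j =ᶠ[nhds x] fun _ => 0 :=
          notMem_tsupport_iff_eventuallyEq.1 fun h => hx (hBsupp j h)
        exact contDiffAt_const.congr_of_eventuallyEq this
    set a' : P × E → ℂ := fun x => ∑ j, fderiv ℝ (B j) x (e j) with ha'
    have ha'supp : tsupport a' ⊆ tsupport a := by
      refine closure_minimal ?_ (isClosed_tsupport a)
      intro x hx
      obtain ⟨j, -, hj⟩ := Finset.exists_ne_zero_of_sum_ne_zero hx
      refine hBsupp j (support_fderiv_subset ℝ (f := B j) fun h => hj ?_)
      simp [h]
    have ha'sm : ContDiff ℝ ∞ a' := ContDiff.sum fun j _ =>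
      ((hBsm j).fderiv_right (m := ∞) (by simp)).clm_apply contDiff_const
    have ha'c : HasCompactSupport a' :=
      hc.isCompact.of_isClosed_subset (isClosed_tsupport _) ha'supp
    obtain ⟨C, hC⟩ := ih a' ha'sm ha'c (ha'supp.trans hsub)
    refine ⟨C, fun p l hl => ?_⟩
    set w : P × E → ℂ := fun x => cexp (I * ((l * Φ x : ℝ) : ℂ)) with hw
    have hwsm : ∀ x ∈ U, ContDiffAt ℝ ∞ w x := by
      intro x hx
      have h1 : ContDiffAt ℝ ∞ Φ x := hΦ.contDiffAt (hU.mem_nhds hx)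
      exact (contDiffAt_const.mul (ofRealCLM.contDiff.contDiffAt.comp x
        (contDiffAt_const.mul h1))).cexp
    have hwB : ∀ c : P × E → ℂ, ContDiff ℝ ∞ c → tsupport c ⊆ tsupport a →
        ContDiff ℝ ∞ (fun x => w x * c x) := by
      intro c hcs hct
      rw [contDiff_iff_contDiffAt]
      intro x
      by_cases hx : x ∈ tsupport a
      · exact (hwsm x (hsub hx)).mul hcs.contDiffAt
      · have : c =ᶠ[nhds x] fun _ => 0 :=
          notMem_tsupport_iff_eventuallyEq.1 fun h => hx (hct h)
        refine (contDiffAt_const (c := (0 : ℂ))).congr_of_eventuallyEq ?_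
        filter_upwards [this] with y hy
        simp [hy]
    have hemb : Topology.IsClosedEmbedding (fun η : E => (p, η)) :=
      ⟨isEmbedding_prodMkRight p, by
        have : Set.range (fun η : E => (p, η)) = Prod.fst ⁻¹' {p} := by
          ext ⟨x, y⟩; simp [eq_comm]
        rw [this]
        exact isClosed_singleton.preimage continuous_fst⟩
    have hint : ∀ c : P × E → ℂ, Continuous c → HasCompactSupport c →
        Integrable (fun η => c (p, η)) := fun c h1 h2 =>
      (h1.comp (by fun_prop)).integrable_of_hasCompactSupport (h2.comp_isClosedEmbedding hemb)
    have hparts : ∀ j, ∫ η, fderiv ℝ (fun x => w x * B j x) (p, η) (e j) = 0 := by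
      intro j
      set c := fun x => w x * B j x
      have hcsm : ContDiff ℝ ∞ c := hwB _ (hBsm j) (hBsupp j)
      have hcc : HasCompactSupport c := (hc.mul_right : HasCompactSupport (B j)).mul_left
      have hder : ∀ η, fderiv ℝ (fun η => c (p, η)) η (b j) = fderiv ℝ c (p, η) (e j) := by
        intro η
        have h1 : HasFDerivAt (fun η : E => (p, η)) (ContinuousLinearMap.inr ℝ P E) η :=
          hasFDerivAt_prodMk_right p η
        have h2 := ((hcsm.differentiable (by simp)) (p, η)).hasFDerivAt.comp η h1
        have h3 := h2.fderiv
        simp only [Function.comp_def] at h3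
        rw [h3]
        simp [he]
      have hi1 : Integrable (fun η => fderiv ℝ (fun η => c (p, η)) η (b j)) := by
        simp_rw [hder]
        exact hint (fun x => fderiv ℝ c x (e j))
          ((hcsm.continuous_fderiv (by simp)).clm_apply continuous_const)
          (hcc.fderiv_apply ℝ _)
      have := integral_mul_fderiv_eq_neg_fderiv_mul_of_integrable (μ := (volume : Measure E))
        (f := fun _ => (1 : ℂ)) (g := fun η => c (p, η)) (v := b j) (by simp)
        (by simpa using hi1) (by simpa using hint c hcsm.continuous hcc) (by simp)
        (fun η _ => (hcsm.differentiable (by simp) _).comp η (by fun_prop))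
      simpa [hder] using this
    have hpt : ∀ x, ∑ j, fderiv ℝ (fun x => w x * B j x) x (e j) =
        I * l * (w x * a x) + w x * a' x := by
      intro x
      by_cases hx : x ∈ tsupport a
      · have hxU := hsub hx
        have hΦd : HasFDerivAt Φ (fderiv ℝ Φ x) x :=
          ((hΦ.contDiffAt (hU.mem_nhds hxU)).differentiableAt (by simp)).hasFDerivAt
        have hwd : HasFDerivAt w (w x • (I • (ofRealCLM.comp (l • fderiv ℝ Φ x)))) x := by
          have h1 : HasFDerivAt (fun x => ((l * Φ x : ℝ) : ℂ))
              (ofRealCLM.comp (l • fderiv ℝ Φ x)) x :=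
            ofRealCLM.hasFDerivAt.comp x (hΦd.const_mul l)
          exact (h1.const_mul I).cexp
        have hj : ∀ j, fderiv ℝ (fun x => w x * B j x) x (e j) =
            I * l * (w x * a x) * (((fderiv ℝ Φ x (e j)) ^ 2 / G x : ℝ) : ℂ)
              + w x * fderiv ℝ (B j) x (e j) := by
          intro j
          have hBd := ((hBsm j).differentiable (by simp) x).hasFDerivAt
          have := (hwd.mul hBd).fderiv
          change fderiv ℝ (fun x => w x * B j x) x = _ at this
          rw [this]
          simp [hB]
          ring
        simp_rw [hj]
        rw [Finset.sum_add_distrib, ← Finset.mul_sum, ← Finset.mul_sum, ← ofReal_sum,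
          ← Finset.sum_div]
        rw [show (∑ j, (fderiv ℝ Φ x) (e j) ^ 2) = G x from rfl, div_self (hGpos x hxU).ne']
        simp [ha']
      · have h1 : a x = 0 := image_eq_zero_of_notMem_tsupport hx
        have h2 : a' x = 0 := image_eq_zero_of_notMem_tsupport fun h => hx (ha'supp h)
        rw [h1, h2]
        simp only [mul_zero, add_zero]
        refine Finset.sum_eq_zero fun j _ => ?_
        have : (fun x => w x * B j x) =ᶠ[nhds x] fun _ => 0 := by
          filter_upwards [notMem_tsupport_iff_eventuallyEq.1 fun h => hx (hBsupp j h)] with y hy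
          simp [hy]
        rw [this.fderiv_eq]
        simp
    have hia : Integrable (fun η => w (p, η) * a (p, η)) :=
      hint (fun x => w x * a x) (hwB a ha subset_rfl).continuous hc.mul_left
    have hia' : Integrable (fun η => w (p, η) * a' (p, η)) :=
      hint (fun x => w x * a' x) (hwB a' ha'sm ha'supp).continuous ha'c.mul_left
    have hij : ∀ j, Integrable (fun η => fderiv ℝ (fun x => w x * B j x) (p, η) (e j)) := by
      intro j
      have hcsm : ContDiff ℝ ∞ (fun x => w x * B j x) := hwB _ (hBsm j) (hBsupp j)
      have hcc : HasCompactSupport (fun x => w x * B j x) :=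
        (hc.mul_right : HasCompactSupport (B j)).mul_left
      exact hint (fun x => fderiv ℝ _ x (e j))
          ((hcsm.continuous_fderiv (by simp)).clm_apply continuous_const)
          (hcc.fderiv_apply ℝ _)
    have hsum : I * l * (∫ η, w (p, η) * a (p, η)) + ∫ η, w (p, η) * a' (p, η) = 0 := by
      rw [← integral_const_mul, ← integral_add (hia.const_mul _) hia']
      simp_rw [← hpt]
      rw [integral_finsetSum _ fun j _ => hij j]
      simp [hparts]
    have hnorm : |l| * ‖∫ η, w (p, η) * a (p, η)‖ = ‖∫ η, w (p, η) * a' (p, η)‖ := by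
      have := congrArg norm (eq_neg_of_add_eq_zero_left hsum)
      simpa using this
    have hl' : 0 < |l| := abs_pos.2 hl
    have := hC p l hl
    change ‖∫ η, w (p, η) * a (p, η)‖ ≤ _
    rw [pow_succ, ← div_div, le_div_iff₀ hl', mul_comm, hnorm]
    exact this

end Oscillatory

section Geometry

variable {E : Type*} [NormedAddCommGroup E] [InnerProductSpace ℝ E]

/-- The difference quotient `(√‖η + ρw‖ - √‖η‖) / ρ` of the dispersion relation, at
`x = ((ρ, w), η)`, in a form which makes sense at `ρ = 0`. -/
def dispersionQuotient (x : (ℝ × E) × E) : ℝ :=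
  ⟪x.1.2, (2 : ℝ) • x.2 + x.1.1 • x.1.2⟫ /
    ((√‖x.2 + x.1.1 • x.1.2‖ + √‖x.2‖) * (‖x.2 + x.1.1 • x.1.2‖ + ‖x.2‖))

/-- The domain on which `dispersionQuotient` is smooth without critical points. -/
def dispersionDomain (E : Type*) [NormedAddCommGroup E] [InnerProductSpace ℝ E] :
    Set ((ℝ × E) × E) :=
  {x | x.1.2 ≠ 0 ∧ x.2 ≠ 0 ∧ x.2 + x.1.1 • x.1.2 ≠ 0}

lemma isOpen_dispersionDomain : IsOpen (dispersionDomain E) :=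
  (isOpen_ne_fun (by fun_prop) continuous_const).inter
    ((isOpen_ne_fun (by fun_prop) continuous_const).inter
      (isOpen_ne_fun (by fun_prop) continuous_const))

lemma contDiffOn_dispersionQuotient :
    ContDiffOn ℝ ∞ (dispersionQuotient (E := E)) (dispersionDomain E) := by
  rintro x ⟨hw, hη, hξ⟩
  apply ContDiffAt.contDiffWithinAt
  have h1 : ContDiffAt ℝ ∞ (fun x : (ℝ × E) × E => ‖x.2‖) x :=
    contDiffAt_snd.norm ℝ hη
  have h2 : ContDiffAt ℝ ∞ (fun x : (ℝ × E) × E => ‖x.2 + x.1.1 • x.1.2‖) x :=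
    ContDiffAt.norm ℝ (by fun_prop) hξ
  have p1 := norm_pos_iff.2 hη
  have p2 := norm_pos_iff.2 hξ
  refine ContDiffAt.div (ContDiffAt.inner ℝ (by fun_prop) (by fun_prop))
    (((h2.sqrt p2.ne').add (h1.sqrt p1.ne')).mul (h2.add h1)) ?_
  positivity

lemma mul_dispersionQuotient {ρ : ℝ} (w η : E) (h : η ≠ 0 ∨ η + ρ • w ≠ 0) :
    ρ * dispersionQuotient ((ρ, w), η) = √‖η + ρ • w‖ - √‖η‖ := by
  have hden : 0 < (√‖η + ρ • w‖ + √‖η‖) * (‖η + ρ • w‖ + ‖η‖) := by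
    rcases h with h | h
    · have := norm_pos_iff.2 h
      positivity
    · have := norm_pos_iff.2 h
      positivity
  have hnum : ρ * ⟪w, (2 : ℝ) • η + ρ • w⟫ = ‖η + ρ • w‖ ^ 2 - ‖η‖ ^ 2 := by
    rw [norm_add_sq_real, inner_add_right, real_inner_smul_right, real_inner_smul_right,
      real_inner_smul_right, real_inner_self_eq_norm_sq, norm_smul, mul_pow, Real.norm_eq_abs,
      sq_abs, real_inner_comm η w]
    ring
  unfold dispersionQuotient
  simp only
  rw [← mul_div_assoc, div_eq_iff hden.ne', hnum]
  have e1 := Real.mul_self_sqrt (norm_nonneg (η + ρ • w))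
  have e2 := Real.mul_self_sqrt (norm_nonneg η)
  linear_combination (-(‖η + ρ • w‖ + ‖η‖)) * (e1 - e2)

lemma hasFDerivAt_sqrt_norm {ξ : E} (hξ : ξ ≠ 0) :
    HasFDerivAt (fun x : E => √‖x‖) ((2 * (‖ξ‖ * √‖ξ‖))⁻¹ • innerSL ℝ ξ) ξ := by
  have hp := norm_pos_iff.2 hξ
  have h1 : HasFDerivAt (fun x : E => ‖x‖ ^ 2) (2 • innerSL ℝ ξ) ξ :=
    (hasStrictFDerivAt_norm_sq ξ).hasFDerivAt
  have h2 := (h1.sqrt (by positivity)).sqrt (by positivity)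
  simp only [Real.sqrt_sq (norm_nonneg _)] at h2
  convert h2 using 1
  ext v
  simp
  field_simp

lemma exists_fderiv_dispersionQuotient_ne_zero {x : (ℝ × E) × E} (hx : x ∈ dispersionDomain E) :
    ∃ v : E, fderiv ℝ (dispersionQuotient (E := E)) x (0, v) ≠ 0 := by
  have hd : HasFDerivAt (dispersionQuotient (E := E)) (fderiv ℝ dispersionQuotient x) x :=
    ((contDiffOn_dispersionQuotient.contDiffAt
      (isOpen_dispersionDomain.mem_nhds hx)).differentiableAt (by simp)).hasFDerivAt
  obtain ⟨⟨ρ, w⟩, η⟩ := x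
  obtain ⟨hw, hη, hξ⟩ := hx
  simp only at hw hη hξ
  set L := fderiv ℝ (dispersionQuotient (E := E)) ((ρ, w), η) with hL
  have hfib : HasFDerivAt (fun y : E => dispersionQuotient ((ρ, w), y))
      (L.comp (ContinuousLinearMap.inr ℝ (ℝ × E) E)) η :=
    hd.comp η (hasFDerivAt_prodMk_right (ρ, w) η)
  by_contra! hcon
  have hzero : L.comp (ContinuousLinearMap.inr ℝ (ℝ × E) E) = 0 := by
    ext v
    simpa using hcon v
  rw [hzero] at hfib
  rcases eq_or_ne ρ 0 with rfl | hρ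
  · have hp := norm_pos_iff.2 hη
    have heq : ∀ y : E, dispersionQuotient (((0 : ℝ), w), y) * (‖y‖ * √‖y‖) * 2 = ⟪w, y⟫ := by
      intro y
      rcases eq_or_ne y 0 with rfl | hy
      · simp
      have := norm_pos_iff.2 hy
      unfold dispersionQuotient
      simp only [zero_smul, add_zero, real_inner_smul_right]
      field_simp
      ring
    have h3 : HasFDerivAt (fun y : E => dispersionQuotient (((0 : ℝ), w), y) * (‖y‖ * √‖y‖) * 2)
        (innerSL ℝ w) η := by
      simp_rw [heq]
      exact (innerSL ℝ w).hasFDerivAt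
    have h4 : HasFDerivAt (fun x : E => ‖x‖ * √‖x‖)
        (‖η‖ • ((2 * (‖η‖ * √‖η‖))⁻¹ • innerSL ℝ η) +
          √‖η‖ • ((1 / (2 * ‖η‖)) • (2 • innerSL ℝ η))) η := by
      have h1 : HasFDerivAt (fun x : E => ‖x‖ ^ 2) (2 • innerSL ℝ η) η :=
        (hasStrictFDerivAt_norm_sq η).hasFDerivAt
      have h2 := (h1.sqrt (by positivity))
      simp only [Real.sqrt_sq (norm_nonneg _)] at h2
      exact h2.mul (hasFDerivAt_sqrt_norm hη)
    have h5 := ((hfib.mul h4).mul_const 2).unique h3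
    have e1 := congrArg (fun T : E →L[ℝ] ℝ => T η) h5
    have e2 := congrArg (fun T : E →L[ℝ] ℝ => T w) h5
    have e3 := heq η
    simp at e1 e2
    set s := √‖η‖ with hs
    have hss : s * s = ‖η‖ := Real.mul_self_sqrt hp.le
    have hsp : 0 < s := Real.sqrt_pos.2 hp
    have e4 : ⟪w, η⟫ = 0 := by
      rw [← e3] at e1 ⊢
      field_simp at e1
      have e5 : dispersionQuotient (((0 : ℝ), w), η) * ‖η‖ = 0 := by linarith
      linear_combination 2 * s * e5
    rw [real_inner_comm, e4] at e2
    have : ‖w‖ ^ 2 = 0 := by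
      rw [← e2]
      simp
    exact hw (by simpa using this)
  · have h1 : HasFDerivAt (fun y : E => √‖y + ρ • w‖ - √‖y‖)
        ((2 * (‖η + ρ • w‖ * √‖η + ρ • w‖))⁻¹ • innerSL ℝ (η + ρ • w)
          - (2 * (‖η‖ * √‖η‖))⁻¹ • innerSL ℝ η) η :=
      ((hasFDerivAt_comp_add_right (ρ • w)).2 (hasFDerivAt_sqrt_norm hξ)).sub
        (hasFDerivAt_sqrt_norm hη)
    have h2 := hfib.const_mul ρ
    have h3 : (fun y : E => ρ * dispersionQuotient ((ρ, w), y)) =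
        fun y => √‖y + ρ • w‖ - √‖y‖ := by
      ext y
      apply mul_dispersionQuotient
      by_contra! h
      rw [h.1, zero_add] at h
      exact smul_ne_zero hρ hw h.2
    rw [h3] at h2
    have h4 := h1.unique h2
    set ξ := η + ρ • w with hξdef
    have p1 := norm_pos_iff.2 hη
    have p2 := norm_pos_iff.2 hξ
    have h5 : (2 * (‖ξ‖ * √‖ξ‖))⁻¹ • ξ = (2 * (‖η‖ * √‖η‖))⁻¹ • η := by
      refine ext_inner_right ℝ fun v => ?_
      have := congrArg (fun T : E →L[ℝ] ℝ => T v) h4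
      simp only [sub_apply, smul_apply, innerSL_apply_apply,
        smul_zero, zero_apply, smul_eq_mul] at this
      rw [real_inner_smul_left, real_inner_smul_left]
      linarith
    have h6 : √‖ξ‖ = √‖η‖ := by
      have := congrArg norm h5
      rw [norm_smul, norm_smul, Real.norm_of_nonneg (by positivity),
        Real.norm_of_nonneg (by positivity)] at this
      field_simp at this
      linarith
    have h7 : ‖ξ‖ = ‖η‖ := by
      rwa [Real.sqrt_inj (norm_nonneg _) (norm_nonneg _)] at h6
    rw [h6, h7] at h5
    have h8 : ξ = η := by
      have hc : (2 * (‖η‖ * √‖η‖))⁻¹ ≠ 0 := by positivity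
      exact smul_right_injective E hc h5
    rw [hξdef, add_eq_left] at h8
    exact smul_ne_zero hρ hw h8

end Geometry

section Dispersive

variable {E : Type*} [NormedAddCommGroup E] [InnerProductSpace ℝ E] [FiniteDimensional ℝ E]

/-- The amplitude `ψ (η + ρw) conj (ψ η)`, cut off to the directions `w`
close to the unit sphere. -/
lemma exists_amplitude {ψ : E → ℂ} (hψ : ContDiff ℝ ∞ ψ)
    (hsupp : tsupport ψ ⊆ {ξ : E | 1 / 4 ≤ ‖ξ‖ ∧ ‖ξ‖ ≤ 2}) :
    ∃ a : (ℝ × E) × E → ℂ, ContDiff ℝ ∞ a ∧ HasCompactSupport a ∧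
      tsupport a ⊆ dispersionDomain E ∧
      ∀ (ρ : ℝ) (w η : E), ‖w‖ = 1 → a ((ρ, w), η) = ψ (η + ρ • w) * conj (ψ η) := by
  let χ : ContDiffBump (1 : ℝ) := ⟨1 / 4, 1 / 2, by norm_num, by norm_num⟩
  set a : (ℝ × E) × E → ℂ := fun x =>
    ((χ (‖x.1.2‖ ^ 2) : ℝ) : ℂ) * (ψ (x.2 + x.1.1 • x.1.2) * conj (ψ x.2)) with ha
  have hasm : ContDiff ℝ ∞ a := by
    refine (ofRealCLM.contDiff.comp (χ.contDiff.comp (ContDiff.norm_sq ℝ (by fun_prop)))).mul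
      ((hψ.comp (by fun_prop)).mul (conjCLE.contDiff.comp (hψ.comp (by fun_prop))))
  have hψb : ∀ ξ, ψ ξ ≠ 0 → 1 / 4 ≤ ‖ξ‖ ∧ ‖ξ‖ ≤ 2 := fun ξ h => hsupp (subset_tsupport _ h)
  have hχb : ∀ r, χ r ≠ 0 → 1 / 2 ≤ r ∧ r ≤ 3 / 2 := by
    intro r hr
    have h1 : r ∈ Function.support χ := hr
    rw [χ.support_eq, Metric.mem_ball, Real.dist_eq, abs_lt] at h1
    have h2 : χ.rOut = 1 / 2 := rfl
    rw [h2] at h1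
    constructor <;> linarith [h1.1, h1.2]
  have hab : ∀ x, a x ≠ 0 → (1 / 2 ≤ ‖x.1.2‖ ^ 2 ∧ ‖x.1.2‖ ^ 2 ≤ 3 / 2) ∧
      (1 / 4 ≤ ‖x.2‖ ∧ ‖x.2‖ ≤ 2) ∧
      (1 / 4 ≤ ‖x.2 + x.1.1 • x.1.2‖ ∧ ‖x.2 + x.1.1 • x.1.2‖ ≤ 2) := by
    intro x hx
    simp only [ha, ne_eq, mul_eq_zero, not_or, map_eq_zero, ofReal_eq_zero] at hx
    exact ⟨hχb _ hx.1, hψb _ hx.2.2, hψb _ hx.2.1⟩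
  have hac : HasCompactSupport a := by
    refine HasCompactSupport.intro (isCompact_closedBall 0 16) fun x hx => ?_
    by_contra hax
    obtain ⟨⟨h1, h2⟩, ⟨-, h3⟩, ⟨-, h4⟩⟩ := hab x hax
    apply hx
    have h5 : 1 / 2 ≤ ‖x.1.2‖ := by nlinarith [norm_nonneg x.1.2]
    have h6 : ‖x.1.2‖ ≤ 2 := by nlinarith [norm_nonneg x.1.2]
    have h7 : ‖x.1.1 • x.1.2‖ ≤ 4 := by
      have := norm_sub_le (x.2 + x.1.1 • x.1.2) x.2
      rw [add_sub_cancel_left] at this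
      linarith
    rw [norm_smul] at h7
    have h8 : ‖x.1.1‖ ≤ 8 := by nlinarith [norm_nonneg x.1.1]
    rw [mem_closedBall_zero_iff, Prod.norm_def, Prod.norm_def]
    simp only [sup_le_iff]
    refine ⟨⟨?_, ?_⟩, ?_⟩ <;> linarith
  have hsub : tsupport a ⊆ dispersionDomain E := by
    have hcl : IsClosed {x : (ℝ × E) × E | 1 / 2 ≤ ‖x.1.2‖ ^ 2 ∧ 1 / 4 ≤ ‖x.2‖ ∧
        1 / 4 ≤ ‖x.2 + x.1.1 • x.1.2‖} := by
      simp only [Set.ofPred_and]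
      exact (isClosed_le continuous_const (by fun_prop)).inter
        ((isClosed_le continuous_const (by fun_prop)).inter
          (isClosed_le continuous_const (by fun_prop)))
    refine (closure_minimal (fun x hx => ?_) hcl).trans fun x hx => ⟨?_, ?_, ?_⟩
    · obtain ⟨⟨h1, -⟩, ⟨h3, -⟩, ⟨h4, -⟩⟩ := hab x hx
      exact ⟨h1, h3, h4⟩
    · rintro h
      have := hx.1
      norm_num [h] at this
    · rintro h
      have := hx.2.1
      norm_num [h] at this
    · rintro h
      have := hx.2.2
      norm_num [h] at this
  refine ⟨a, hasm, hac, hsub, fun ρ w η hw => ?_⟩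
  have h2 : χ (‖w‖ ^ 2) = 1 := by
    rw [hw, one_pow]
    exact χ.one_of_mem_closedBall (Metric.mem_closedBall_self χ.rIn_pos.le)
  simp [ha, h2]

variable [MeasurableSpace E] [BorelSpace E]

/-- The `TT*` bound for the square of an oscillatory integral. -/
lemma norm_integral_sq_le {g : E → ℂ} (hg : Integrable g) :
    ‖∫ x, g x‖ ^ 2 ≤ ∫ h, ‖∫ y, g (y + h) * conj (g y)‖ := by
  set f : E → ℂ := fun x => conj (g (-x)) with hf
  have hfi : Integrable f := by
    have h1 : Integrable (fun x => g (-x)) := hg.comp_neg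
    exact (Complex.conjCLE.toContinuousLinearMap.integrable_comp h1)
  have h1 := integral_convolution (μ := (volume : Measure E)) (ν := (volume : Measure E))
    (ContinuousLinearMap.mul ℝ ℂ) hfi hg
  have h2 : ∀ h, convolution f g (ContinuousLinearMap.mul ℝ ℂ) volume h =
      ∫ y, g (y + h) * conj (g y) := by
    intro h
    rw [convolution_def, ← integral_neg_eq_self]
    congr 1
    ext y
    simp [hf, mul_comm, add_comm]
  have h3 : ∫ x, f x = conj (∫ x, g x) := by
    rw [hf, integral_neg_eq_self (fun x => conj (g x)), integral_conj]
  simp_rw [h2, h3] at h1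
  have h4 : ‖∫ x, g x‖ ^ 2 = ‖∫ h, ∫ y, g (y + h) * conj (g y)‖ := by
    rw [h1]
    simp [sq]
  rw [h4]
  exact norm_integral_le_integral_norm _

/-- Decay of the correlation integrals of the oscillatory factor of the dispersive kernel. -/
lemma exists_norm_shifted_integral_le {ψ : E → ℂ} (hψ : ContDiff ℝ ∞ ψ)
    (hsupp : tsupport ψ ⊆ {ξ : E | 1 / 4 ≤ ‖ξ‖ ∧ ‖ξ‖ ≤ 2}) (N : ℕ) :
    ∃ C, ∀ (s : ℝ) (h : E), 0 < s → h ≠ 0 →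
      ‖∫ η, cexp (I * ((-(s * (√‖η + h‖ - √‖η‖)) : ℝ) : ℂ)) * (ψ (η + h) * conj (ψ η))‖ ≤
        C / (s * ‖h‖) ^ N := by
  obtain ⟨a, hasm, hac, hsub, hval⟩ := exists_amplitude hψ hsupp
  obtain ⟨C, hC⟩ := exists_norm_oscillatory_integral_le_s6 (P := ℝ × E) (E := E)
    (U := dispersionDomain E) (Φ := dispersionQuotient (E := E)) isOpen_dispersionDomain
    contDiffOn_dispersionQuotient
    (fun x hx => exists_fderiv_dispersionQuotient_ne_zero hx) N a hasm hac hsub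
  refine ⟨C, fun s h hs hh => ?_⟩
  have hp := norm_pos_iff.2 hh
  have key := hC (‖h‖, ‖h‖⁻¹ • h) (-(s * ‖h‖)) (by
    have := mul_pos hs hp
    linarith)
  rw [abs_neg, abs_of_pos (mul_pos hs hp)] at key
  have hsm : ‖h‖ • ‖h‖⁻¹ • h = h := smul_inv_smul₀ hp.ne' h
  have h1 : ∀ η, ‖h‖ * dispersionQuotient ((‖h‖, ‖h‖⁻¹ • h), η) = √‖η + h‖ - √‖η‖ := by
    intro η
    have := mul_dispersionQuotient (ρ := ‖h‖) (‖h‖⁻¹ • h) η (by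
      rw [hsm]
      by_contra! hcon
      rw [hcon.1, zero_add] at hcon
      exact hh hcon.2)
    rwa [hsm] at this
  have h2 : ‖‖h‖⁻¹ • h‖ = 1 := by
    rw [norm_smul, norm_inv, norm_norm, inv_mul_cancel₀ hp.ne']
  refine le_of_eq_of_le (congrArg norm (integral_congr_ae (.of_forall fun η => ?_))) key
  simp only [hval _ _ _ h2, hsm, ← h1 η, neg_mul, mul_assoc]

end Dispersive

section KernelBound

variable {E : Type*} [NormedAddCommGroup E] [InnerProductSpace ℝ E] [FiniteDimensional ℝ E]
  [MeasurableSpace E] [BorelSpace E]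

/-- The pointwise decay of the kernel at unit frequency in dimension two. -/
lemma exists_norm_unit_kernel_le (hdim : Module.finrank ℝ E = 2) {ψ : E → ℂ}
    (hψ : ContDiff ℝ ∞ ψ) (hsupp : tsupport ψ ⊆ {ξ : E | 1 / 4 ≤ ‖ξ‖ ∧ ‖ξ‖ ≤ 2}) :
    ∃ C, 0 < C ∧ ∀ (s : ℝ) (z : E), 0 ≤ s →
      ‖∫ ξ, cexp (I * ((⟪z, ξ⟫ - s * √‖ξ‖ : ℝ) : ℂ)) * ψ ξ‖ ≤ C * (1 + s)⁻¹ := by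
  have hc : HasCompactSupport ψ := (isCompact_closedBall (0 : E) 2).of_isClosed_subset
    (isClosed_tsupport _) fun x hx => mem_closedBall_zero_iff.2 (hsupp hx).2
  have hψi : Integrable ψ := hψ.continuous.integrable_of_hasCompactSupport hc
  obtain ⟨M, hM⟩ := hc.exists_bound_of_continuous hψ.continuous
  have hM0 : 0 ≤ M := (norm_nonneg _).trans (hM 0)
  obtain ⟨C₃, hC₃⟩ := exists_norm_shifted_integral_le hψ hsupp 3
  set A := ∫ ξ, ‖ψ ξ‖ with hA
  have hA0 : 0 ≤ A := integral_nonneg fun _ => norm_nonneg _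
  set J := ∫ h : E, (1 + ‖h‖) ^ (-3 : ℝ) with hJ
  have hJ0 : 0 ≤ J := integral_nonneg fun _ => by positivity
  have hJi : Integrable (fun h : E => (1 + ‖h‖) ^ (-3 : ℝ)) :=
    integrable_one_add_norm (by rw [hdim]; norm_num)
  set W := 8 * (M * A + |C₃|) with hW
  have hW0 : 0 ≤ W := by positivity
  set g : ℝ → E → E → ℂ := fun s z ξ => cexp (I * ((⟪z, ξ⟫ - s * √‖ξ‖ : ℝ) : ℂ)) * ψ ξ with hg
  have hgn : ∀ s z ξ, ‖g s z ξ‖ = ‖ψ ξ‖ := by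
    intro s z ξ
    rw [hg, norm_mul, mul_comm I, Complex.norm_exp_ofReal_mul_I, one_mul]
  have hgi : ∀ s z, Integrable (g s z) := by
    intro s z
    refine hψi.norm.mono' ?_ (.of_forall fun ξ => (hgn s z ξ).le)
    have : Continuous (g s z) := by fun_prop
    exact this.aestronglyMeasurable
  have htriv : ∀ s z, ‖∫ ξ, g s z ξ‖ ≤ A := by
    intro s z
    refine (norm_integral_le_integral_norm _).trans_eq ?_
    simp_rw [hgn]
    exact hA.symm
  have hcorr : ∀ s z h, ‖∫ η, g s z (η + h) * conj (g s z η)‖ =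
      ‖∫ η, cexp (I * ((-(s * (√‖η + h‖ - √‖η‖)) : ℝ) : ℂ)) * (ψ (η + h) * conj (ψ η))‖ := by
    intro s z h
    have : ∀ η, g s z (η + h) * conj (g s z η) = cexp ((⟪z, h⟫ : ℝ) * I) *
        (cexp (I * ((-(s * (√‖η + h‖ - √‖η‖)) : ℝ) : ℂ)) * (ψ (η + h) * conj (ψ η))) := by
      intro η
      simp only [hg, map_mul, ← Complex.exp_conj, conj_I, conj_ofReal, inner_add_right]
      rw [mul_mul_mul_comm, ← Complex.exp_add, ← mul_assoc (cexp _) (cexp _), ← Complex.exp_add]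
      congr 2
      push_cast
      ring
    simp_rw [this]
    rw [integral_const_mul, norm_mul, Complex.norm_exp_ofReal_mul_I, one_mul]
  have hF : ∀ s z h, 0 < s → h ≠ 0 → ‖∫ η, g s z (η + h) * conj (g s z η)‖ ≤
      W * (1 + ‖s • h‖) ^ (-3 : ℝ) := by
    intro s z h hs hh
    have hx0 : 0 < s * ‖h‖ := mul_pos hs (norm_pos_iff.2 hh)
    rw [norm_smul, Real.norm_of_nonneg hs.le, Real.rpow_neg (by positivity), ← div_eq_mul_inv,
      show (3 : ℝ) = ((3 : ℕ) : ℝ) by norm_num, Real.rpow_natCast]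
    rcases le_total (s * ‖h‖) 1 with hx | hx
    · have h1 : ‖∫ η, g s z (η + h) * conj (g s z η)‖ ≤ M * A := by
        refine (norm_integral_le_of_norm_le (hψi.norm.const_mul M)
          (.of_forall fun η => ?_)).trans_eq
          (integral_const_mul _ _)
        rw [norm_mul, RCLike.norm_conj, hgn, hgn]
        exact mul_le_mul_of_nonneg_right (hM _) (norm_nonneg _)
      refine h1.trans ?_
      rw [le_div_iff₀ (by positivity)]
      have h2 : (1 + s * ‖h‖) ^ 3 ≤ 2 ^ 3 := pow_le_pow_left₀ (by positivity) (by linarith) 3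
      have h3 : 0 ≤ M * A := by positivity
      have h4 := abs_nonneg C₃
      nlinarith
    · rw [hcorr]
      refine (hC₃ s h hs hh).trans ?_
      rw [div_le_div_iff₀ (by positivity) (by positivity)]
      have h2 : (1 + s * ‖h‖) ^ 3 ≤ (2 * (s * ‖h‖)) ^ 3 :=
        pow_le_pow_left₀ (by positivity) (by linarith) 3
      have h3 : 0 ≤ M * A := by positivity
      calc C₃ * (1 + s * ‖h‖) ^ 3 ≤ |C₃| * (2 * (s * ‖h‖)) ^ 3 := by
            gcongr
            exact le_abs_self _
        _ = 8 * |C₃| * (s * ‖h‖) ^ 3 := by ring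
        _ ≤ W * (s * ‖h‖) ^ 3 := by
            gcongr
            rw [hW]
            linarith
  have hdecay : ∀ s z, 0 < s → ‖∫ ξ, g s z ξ‖ ≤ √(W * J) / s := by
    intro s z hs
    have h1 := norm_integral_sq_le (hgi s z)
    have h2 : ∫ h, ‖∫ η, g s z (η + h) * conj (g s z η)‖ ≤ W * J / s ^ 2 := by
      have hi : Integrable (fun h : E => W * (1 + ‖s • h‖) ^ (-3 : ℝ)) :=
        (hJi.comp_smul hs.ne').const_mul W
      have hne : ∀ᵐ h : E, h ≠ 0 := by
        have : Nontrivial E := Module.nontrivial_of_finrank_pos (R := ℝ) (by omega)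
        exact Measure.ae_ne volume 0
      refine (integral_mono_of_nonneg (.of_forall fun _ => norm_nonneg _) hi ?_).trans_eq ?_
      · filter_upwards [hne] with h hh using hF s z h hs hh
      · rw [integral_const_mul,
          Measure.integral_comp_smul volume (fun h : E => (1 + ‖h‖) ^ (-3 : ℝ)) s, hdim, ← hJ,
          abs_of_pos (by positivity), smul_eq_mul]
        field_simp
    refine le_of_sq_le_sq ?_ (by positivity)
    rw [div_pow, Real.sq_sqrt (by positivity)]
    exact h1.trans h2
  refine ⟨2 * (√(W * J) + A) + 1, by positivity, fun s z hs => ?_⟩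
  rw [← div_eq_mul_inv, le_div_iff₀ (by positivity)]
  have hsq := Real.sqrt_nonneg (W * J)
  have hn := norm_nonneg (∫ ξ, g s z ξ)
  change ‖∫ ξ, g s z ξ‖ * (1 + s) ≤ _
  rcases le_total s 1 with h1 | h1
  · nlinarith [htriv s z]
  · have := hdecay s z (by linarith)
    rw [le_div_iff₀ (by linarith)] at this
    nlinarith [htriv s z]

/-- The scaling of the kernel. -/
lemma waveKernel_eq (ψ : EuclideanSpace ℝ (Fin 2) → ℂ) (k : ℤ) (t : ℝ)
    (z : EuclideanSpace ℝ (Fin 2)) :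
    waveKernel ψ k t z = ((2 : ℝ) ^ (2 * k) : ℝ) • ∫ ξ : EuclideanSpace ℝ (Fin 2),
      cexp (I * ((⟪(2 : ℝ) ^ k • z, ξ⟫ - (2 : ℝ) ^ ((k : ℝ) / 2) * t * √‖ξ‖ : ℝ) : ℂ)) * ψ ξ := by
  have h2 : (0 : ℝ) < 2 ^ (-k) := by positivity
  have hr : √((2 : ℝ) ^ k) = (2 : ℝ) ^ ((k : ℝ) / 2) := by
    rw [Real.sqrt_eq_rpow, ← Real.rpow_intCast, ← Real.rpow_mul (by norm_num)]
    congr 1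
    ring
  have := Measure.integral_comp_smul (volume : Measure (EuclideanSpace ℝ (Fin 2)))
    (fun ξ => cexp (I * ((⟪(2 : ℝ) ^ k • z, ξ⟫ - (2 : ℝ) ^ ((k : ℝ) / 2) * t * √‖ξ‖ : ℝ) : ℂ)) *
      ψ ξ)
    ((2 : ℝ) ^ (-k))
  rw [finrank_euclideanSpace_fin, abs_of_pos (by positivity)] at this
  have h3 : (((2 : ℝ) ^ (-k)) ^ 2)⁻¹ = (2 : ℝ) ^ (2 * k) := by
    rw [zpow_neg, inv_pow, inv_inv, mul_comm, zpow_mul]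
    norm_cast
  rw [h3] at this
  rw [← this]
  unfold waveKernel
  congr 1
  ext ξ
  congr 3
  rw [real_inner_smul_left, real_inner_smul_right, ← mul_assoc, ← zpow_add₀ (by norm_num),
    add_neg_cancel, zpow_zero, one_mul, norm_smul, Real.norm_of_nonneg h2.le,
    Real.sqrt_mul h2.le, zpow_neg, Real.sqrt_inv, hr]
  have : (0 : ℝ) < (2 : ℝ) ^ ((k : ℝ) / 2) := by positivity
  congr 2
  field_simp

end KernelBound

section Multiplier

open scoped FourierTransform SchwartzMap

variable {E : Type*} [NormedAddCommGroup E] [InnerProductSpace ℝ E] [FiniteDimensional ℝ E]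
  [MeasurableSpace E] [BorelSpace E]

lemma eLpNorm_fourier_two (f : 𝓢(E, ℂ)) :
    eLpNorm (𝓕 f : 𝓢(E, ℂ)) 2 volume = eLpNorm f 2 volume := by
  have := SchwartzMap.norm_fourier_toL2_eq f
  rw [SchwartzMap.norm_toLp, SchwartzMap.norm_toLp] at this
  have h1 : eLpNorm (𝓕 f : 𝓢(E, ℂ)) 2 volume ≠ ⊤ := (SchwartzMap.memLp (𝓕 f) 2 volume).2.ne
  have h2 : eLpNorm f 2 volume ≠ ⊤ := (SchwartzMap.memLp f 2 volume).2.ne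
  exact (ENNReal.toReal_eq_toReal_iff' h1 h2).1 this

/-- A Fourier multiplier bounded by `B` is bounded by `B` on `L²`. -/
lemma eLpNorm_convolution_two_le {M : 𝓢(E, ℂ)} {B : ℝ} (hB : ∀ ζ, ‖M ζ‖ ≤ B) (u : 𝓢(E, ℂ)) :
    eLpNorm (SchwartzMap.convolution (ContinuousLinearMap.mul ℂ ℂ) (𝓕⁻ M) u) 2 volume ≤
      ENNReal.ofReal B * eLpNorm u 2 volume := by
  rw [← eLpNorm_fourier_two, ← eLpNorm_fourier_two u]
  refine eLpNorm_le_mul_eLpNorm_of_ae_le_mul (.of_forall fun ζ => ?_) 2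
  rw [SchwartzMap.fourier_convolution, SchwartzMap.pairing_apply_apply,
    FourierTransform.fourier_fourierInv_eq]
  simpa using mul_le_mul_of_nonneg_right (hB ζ) (norm_nonneg _)

/-- The kernel `K_{k,t}` is the inverse Fourier transform of a Schwartz function that is bounded
uniformly in `k` and `t`. -/
lemma exists_waveKernel_eq_fourierInv {ψ : EuclideanSpace ℝ (Fin 2) → ℂ} (hψ : ContDiff ℝ ∞ ψ)
    (hsupp : tsupport ψ ⊆ {ξ : EuclideanSpace ℝ (Fin 2) | 1 / 4 ≤ ‖ξ‖ ∧ ‖ξ‖ ≤ 2}) :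
    ∃ B, 0 < B ∧ ∀ (k : ℤ) (t : ℝ), ∃ M : 𝓢(EuclideanSpace ℝ (Fin 2), ℂ),
      (∀ ζ, ‖M ζ‖ ≤ B) ∧ ∀ z, waveKernel ψ k t z = (𝓕⁻ M) z := by
  have hc : HasCompactSupport ψ :=
    (isCompact_closedBall (0 : EuclideanSpace ℝ (Fin 2)) 2).of_isClosed_subset
      (isClosed_tsupport _) fun x hx => mem_closedBall_zero_iff.2 (hsupp hx).2
  obtain ⟨S, hS⟩ := hc.exists_bound_of_continuous hψ.continuous
  have hS0 : 0 ≤ S := (norm_nonneg _).trans (hS 0)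
  refine ⟨(2 * Real.pi) ^ 2 * S + 1, by positivity, fun k t => ?_⟩
  set c : ℝ := (2 : ℝ) ^ (-k) with hcdef
  have hc0 : 0 < c := by positivity
  set m : EuclideanSpace ℝ (Fin 2) → ℂ := fun ξ =>
    cexp (I * ((-(t * √‖ξ‖) : ℝ) : ℂ)) * ψ (c • ξ) with hm
  have hψ0 : ψ =ᶠ[nhds 0] 0 := by
    rw [← notMem_tsupport_iff_eventuallyEq]
    intro h
    have := (hsupp h).1
    norm_num at this
  have hψc : HasCompactSupport fun ξ => ψ (c • ξ) := hc.comp_smul hc0.ne'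
  have hms : ContDiff ℝ ∞ m := by
    rw [contDiff_iff_contDiffAt]
    intro ξ
    by_cases hξ : ξ = 0
    · have : m =ᶠ[nhds ξ] fun _ => 0 := by
        have ht : Filter.Tendsto (fun ξ : EuclideanSpace ℝ (Fin 2) => c • ξ) (nhds ξ) (nhds 0) := by
          have : Continuous (fun ξ : EuclideanSpace ℝ (Fin 2) => c • ξ) := by fun_prop
          simpa [hξ] using this.tendsto ξ
        filter_upwards [ht.eventually hψ0] with x hx
        simp [hm, hx]
      exact contDiffAt_const.congr_of_eventuallyEq this
    · have h1 : ContDiffAt ℝ ∞ (fun ξ : EuclideanSpace ℝ (Fin 2) => √‖ξ‖) ξ :=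
        (contDiffAt_norm ℝ hξ).sqrt (norm_ne_zero_iff.2 hξ)
      have h2 : ContDiffAt ℝ ∞ (fun ξ : EuclideanSpace ℝ (Fin 2) => ((-(t * √‖ξ‖) : ℝ) : ℂ)) ξ :=
        Complex.ofRealCLM.contDiff.contDiffAt.comp ξ (contDiffAt_const.mul h1).neg
      refine ((contDiffAt_const.mul h2).cexp).mul ?_
      exact (hψ.comp (contDiff_const_smul c)).contDiffAt
  have hmc : HasCompactSupport m := hψc.mul_left
  have h2π : (0 : ℝ) < 2 * Real.pi := by positivity
  set f : EuclideanSpace ℝ (Fin 2) → ℂ := fun ζ =>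
    (((2 * Real.pi) ^ 2 : ℝ) : ℂ) * m ((2 * Real.pi) • ζ) with hf
  have hfc : HasCompactSupport f := (hmc.comp_smul h2π.ne').mul_left
  have hfs : ContDiff ℝ ∞ f := contDiff_const.mul (hms.comp (contDiff_const_smul _))
  refine ⟨hfc.toSchwartzMap hfs, fun ζ => ?_, fun z => ?_⟩
  · change ‖f ζ‖ ≤ _
    rw [hf, norm_mul, hm, norm_mul, mul_comm I, Complex.norm_exp_ofReal_mul_I, one_mul,
      Complex.norm_real, Real.norm_of_nonneg (by positivity)]
    nlinarith [hS (c • (2 * Real.pi) • ζ), sq_nonneg (2 * Real.pi)]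
  · rw [SchwartzMap.fourierInv_coe, Real.fourierInv_eq']
    have := Measure.integral_comp_smul (volume : Measure (EuclideanSpace ℝ (Fin 2)))
      (fun ξ => cexp (I * ((⟪z, ξ⟫ : ℝ) : ℂ)) * m ξ) (2 * Real.pi)
    rw [finrank_euclideanSpace_fin, abs_of_pos (by positivity), eq_inv_smul_iff₀ (by positivity),
      ← integral_smul] at this
    unfold waveKernel
    have h3 : ∀ ξ, cexp (I * ((⟪z, ξ⟫ - t * √‖ξ‖ : ℝ) : ℂ)) * ψ (c • ξ) =
        cexp (I * ((⟪z, ξ⟫ : ℝ) : ℂ)) * m ξ := by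
      intro ξ
      rw [hm, ← mul_assoc, ← Complex.exp_add, ← mul_add, ← ofReal_add, sub_eq_add_neg]
    simp_rw [← hcdef, h3, ← this]
    congr 1
    ext ζ
    rw [real_smul, smul_eq_mul, HasCompactSupport.toSchwartzMap_toFun, hf,
      real_inner_smul_right, real_inner_comm ζ z, mul_left_comm]
    congr 2
    push_cast
    ring_nf

end Multiplier

section Interpolation

open Filter Topology Complex.HadamardThreeLines

lemma enorm_integral_mul_le_eLpNorm_two {α : Type*} [MeasurableSpace α] {μ : Measure α}
    {f g : α → ℂ} (hf : AEStronglyMeasurable f μ) (hg : AEStronglyMeasurable g μ) :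
    ‖∫ x, f x * g x ∂μ‖ₑ ≤ eLpNorm f 2 μ * eLpNorm g 2 μ :=
  calc ‖∫ x, f x * g x ∂μ‖ₑ ≤ ∫⁻ x, ‖f x * g x‖ₑ ∂μ := enorm_integral_le_lintegral_enorm _
    _ = eLpNorm (f • g) 1 μ := by simp [eLpNorm_one_eq_lintegral_enorm]
    _ ≤ eLpNorm f 2 μ * eLpNorm g 2 μ := eLpNorm_smul_le_mul_eLpNorm hg hf

open scoped SchwartzMap in
/-- An `L²` bound for the convolution with a Schwartz kernel, valid for Schwartz functions, extends
to all of `L²`. -/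
lemma eLpNorm_integral_kernel_two_le {E : Type*} [NormedAddCommGroup E] [InnerProductSpace ℝ E]
    [FiniteDimensional ℝ E] [MeasurableSpace E] [BorelSpace E] {K : 𝓢(E, ℂ)} {b : ℝ≥0∞}
    (hb : b ≠ ⊤)
    (h : ∀ u : 𝓢(E, ℂ), eLpNorm (fun x => ∫ y, K (x - y) * u y) 2 volume ≤ b * eLpNorm u 2 volume)
    {f : E → ℂ} (hf : MemLp f 2 volume) :
    eLpNorm (fun x => ∫ y, K (x - y) * f y) 2 volume ≤ b * eLpNorm f 2 volume := by
  have hmem : hf.toLp f ∈ closure (Set.range (SchwartzMap.toLpCLM ℝ (E := E) ℂ 2 volume)) :=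
    SchwartzMap.denseRange_toLpCLM (by norm_num) _
  obtain ⟨v, hv, hlim⟩ := mem_closure_iff_seq_limit.1 hmem
  choose u hu using hv
  have hlim' : Tendsto (fun n => eLpNorm (⇑(u n) - f) 2 volume) atTop (𝓝 0) := by
    refine (Lp.tendsto_Lp_iff_tendsto_eLpNorm'' (fun n => ⇑(u n)) (fun n => (u n).memLp 2 volume)
      f hf).1 ?_
    convert hlim using 2 with n
    exact hu n
  have hK : ∀ x, MemLp (fun y => K (x - y)) 2 volume := fun x =>
    (K.memLp 2 volume).comp_measurePreserving (Measure.measurePreserving_sub_left volume x)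
  have hpt : ∀ x, Tendsto (fun n => ∫ y, K (x - y) * u n y) atTop (𝓝 (∫ y, K (x - y) * f y)) := by
    intro x
    rw [tendsto_iff_edist_tendsto_0]
    have h0 : Tendsto (fun n => eLpNorm (fun y => K (x - y)) 2 volume *
        eLpNorm (⇑(u n) - f) 2 volume) atTop (𝓝 0) := by
      simpa using ENNReal.Tendsto.const_mul hlim' (.inr (hK x).2.ne)
    refine tendsto_of_tendsto_of_tendsto_of_le_of_le tendsto_const_nhds h0 (fun _ => zero_le)
      fun n => ?_
    have hun := (u n).memLp 2 volume
    have hi₁ : Integrable fun y => K (x - y) * u n y := (hK x).integrable_mul hun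
    have hi₂ : Integrable fun y => K (x - y) * f y := (hK x).integrable_mul hf
    rw [edist_eq_enorm_sub, ← integral_sub hi₁ hi₂]
    simp_rw [← mul_sub]
    exact enorm_integral_mul_le_eLpNorm_two (hK x).1 (hun.sub hf).1
  have hcont : ∀ n, AEStronglyMeasurable (fun x => ∫ y, K (x - y) * u n y) volume := by
    intro n
    refine AEStronglyMeasurable.integral_prod_right' (f := fun z : E × E => K (z.1 - z.2) * u n z.2)
      ?_
    have h1 := K.continuous
    have h2 := (u n).continuous
    have : Continuous (fun z : E × E => K (z.1 - z.2) * u n z.2) := by fun_prop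
    exact this.aestronglyMeasurable
  have hbd : ∀ n, eLpNorm (fun x => ∫ y, K (x - y) * u n y) 2 volume ≤
      b * (eLpNorm f 2 volume + eLpNorm (⇑(u n) - f) 2 volume) := by
    intro n
    refine (h (u n)).trans ?_
    gcongr
    have h3 := eLpNorm_add_le (p := 2) hf.1 (((u n).memLp 2 volume).sub hf).1 (by norm_num)
    rwa [add_sub_cancel] at h3
  refine (Lp.eLpNorm_lim_le_liminf_eLpNorm hcont _ (.of_forall hpt)).trans ?_
  refine (liminf_le_liminf (.of_forall hbd)).trans_eq (Tendsto.liminf_eq ?_)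
  simpa using ENNReal.Tendsto.const_mul (hlim'.const_add (eLpNorm f 2 volume)) (.inr hb)

lemma rpow_le_add_sqrt {x s : ℝ} (hx : 0 ≤ x) (hs : 1 / 2 ≤ s) (hs' : s ≤ 1) :
    x ^ s ≤ x + √x := by
  rcases le_total x 1 with h | h
  · have := Real.rpow_le_rpow_of_exponent_ge' hx h (by norm_num) hs
    rw [← Real.sqrt_eq_rpow] at this
    linarith
  · have := Real.rpow_le_rpow_of_exponent_le h hs'
    rw [Real.rpow_one] at this
    linarith [Real.sqrt_nonneg x]

lemma abs_log_mul_rpow_le {x s δ : ℝ} (hx : 0 ≤ x) (hδ : 0 < δ) (hs : 1 / 2 + δ ≤ s)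
    (hs' : s + δ ≤ 1) : |Real.log x| * x ^ s ≤ (x + √x) / δ := by
  rcases hx.eq_or_lt with rfl | hx0
  · simp
  rcases le_total x 1 with h | h
  · have h1 := Real.log_le_rpow_div (inv_nonneg.2 hx) hδ
    rw [Real.log_inv, ← abs_of_nonpos (Real.log_nonpos hx h)] at h1
    calc |Real.log x| * x ^ s ≤ x⁻¹ ^ δ / δ * x ^ s := by gcongr
      _ = x ^ (s - δ) / δ := by
        rw [Real.inv_rpow hx, Real.rpow_sub hx0]
        field_simp
      _ ≤ _ := by
        gcongr
        exact rpow_le_add_sqrt hx (by linarith) (by linarith)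
  · have h1 := Real.log_le_rpow_div hx hδ
    rw [← abs_of_nonneg (Real.log_nonneg h)] at h1
    calc |Real.log x| * x ^ s ≤ x ^ δ / δ * x ^ s := by gcongr
      _ = x ^ (s + δ) / δ := by
        rw [Real.rpow_add hx0]
        ring
      _ ≤ _ := by
        gcongr
        exact rpow_le_add_sqrt hx (by linarith) (by linarith)

section Holomorphy

variable {α : Type*} [MeasurableSpace α] {μ : Measure α} {w : α → ℂ} {r : α → ℝ}

lemma norm_mul_cpow_le {c : ℂ} {x : ℝ} (hx : 0 ≤ x) {z : ℂ} (hz : z ∈ verticalClosedStrip 0 1) :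
    ‖c * (x : ℂ) ^ (1 - z / 2)‖ ≤ ‖c‖ * (x + √x) := by
  obtain ⟨h0, h1⟩ := hz
  have hre : (1 - z / 2).re = 1 - z.re / 2 := by simp
  rw [norm_mul, Complex.norm_cpow_eq_rpow_re_of_nonneg hx (by rw [hre]; linarith), hre]
  gcongr
  exact rpow_le_add_sqrt hx (by linarith) (by linarith)

lemma bddAbove_norm_integral_mul_cpow (hr0 : ∀ a, 0 ≤ r a)
    (hi : Integrable (fun a => ‖w a‖ * (r a + √(r a))) μ) :
    BddAbove ((norm ∘ fun z : ℂ => ∫ a, w a * (r a : ℂ) ^ (1 - z / 2) ∂μ) ''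
      verticalClosedStrip 0 1) := by
  refine ⟨∫ a, ‖w a‖ * (r a + √(r a)) ∂μ, ?_⟩
  rintro _ ⟨z, hz, rfl⟩
  exact norm_integral_le_of_norm_le hi (.of_forall fun a => norm_mul_cpow_le (hr0 a) hz)

lemma diffContOnCl_integral_mul_cpow (hw : Measurable w) (hr : Measurable r) (hr0 : ∀ a, 0 ≤ r a)
    (hi : Integrable (fun a => ‖w a‖ * (r a + √(r a))) μ) :
    DiffContOnCl ℂ (fun z : ℂ => ∫ a, w a * (r a : ℂ) ^ (1 - z / 2) ∂μ) (verticalStrip 0 1) := by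
  have hmeas : ∀ z : ℂ, AEStronglyMeasurable (fun a => w a * (r a : ℂ) ^ (1 - z / 2)) μ := by
    intro z
    have : Measurable (fun a => w a * (r a : ℂ) ^ (1 - z / 2)) := by fun_prop
    exact this.aestronglyMeasurable
  have hne : ∀ {z : ℂ}, z.re ≤ 1 → 1 - z / 2 ≠ 0 := by
    intro z hz h
    have := congrArg Complex.re h
    simp at this
    linarith
  have hd : ∀ (a : α) {z : ℂ}, z.re ≤ 1 → HasDerivAt (fun z : ℂ => w a * (r a : ℂ) ^ (1 - z / 2))
      (w a * ((r a : ℂ) ^ (1 - z / 2) * Complex.log (r a) * (-(1 / 2)))) z := by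
    intro a z hz
    exact ((((hasDerivAt_id z).div_const 2).const_sub 1).const_cpow (.inr (hne hz))).const_mul _
  constructor
  · intro z₀ hz₀
    obtain ⟨h0, h1⟩ := hz₀
    set δ := min z₀.re (1 - z₀.re) / 4 with hδ
    have hδ0 : 0 < δ := by
      have := lt_min h0 (sub_pos.2 h1)
      positivity
    have hδ1 : δ ≤ z₀.re / 4 := by
      rw [hδ]; gcongr; exact min_le_left _ _
    have hδ2 : δ ≤ (1 - z₀.re) / 4 := by
      rw [hδ]; gcongr; exact min_le_right _ _
    have hball : ∀ z ∈ Metric.ball z₀ δ, |z.re - z₀.re| < δ := by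
      intro z hz
      rw [Metric.mem_ball, dist_eq] at hz
      exact (Complex.abs_re_le_norm (z - z₀)).trans_lt hz
    refine (hasDerivAt_integral_of_dominated_loc_of_deriv_le (Metric.ball_mem_nhds z₀ hδ0)
      (.of_forall hmeas) ?_ (F' := fun z a =>
        w a * ((r a : ℂ) ^ (1 - z / 2) * Complex.log (r a) * (-(1 / 2)))) ?_
      (bound := fun a => (‖w a‖ * (r a + √(r a))) * δ⁻¹) (.of_forall fun a z hz => ?_)
      (hi.mul_const _) (.of_forall fun a z hz => ?_)).2.differentiableAt.differentiableWithinAt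
    · exact hi.mono' (hmeas z₀) (.of_forall fun a => norm_mul_cpow_le (hr0 a) ⟨h0.le, h1.le⟩)
    · have : Measurable fun a =>
        w a * ((r a : ℂ) ^ (1 - z₀ / 2) * Complex.log (r a) * (-(1 / 2))) := by fun_prop
      exact this.aestronglyMeasurable
    · obtain ⟨h2, h3⟩ := abs_lt.1 (hball z hz)
      have hre : (1 - z / 2).re = 1 - z.re / 2 := by simp
      rw [norm_mul, norm_mul, norm_mul, ← Complex.ofReal_log (hr0 a), Complex.norm_real,
        Complex.norm_cpow_eq_rpow_re_of_nonneg (hr0 a) (by rw [hre]; linarith), hre,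
        mul_assoc ‖w a‖, ← div_eq_mul_inv (r a + _)]
      gcongr
      have h4 := abs_log_mul_rpow_le (hr0 a) (δ := δ) (s := 1 - z.re / 2) hδ0 (by linarith)
        (by linarith)
      have h5 : 0 ≤ |Real.log (r a)| * r a ^ (1 - z.re / 2) := by
        have := hr0 a
        positivity
      have h6 : ‖(-(1 / 2) : ℂ)‖ = 1 / 2 := by norm_num
      rw [h6, Real.norm_eq_abs]
      linarith
    · have := (abs_lt.1 (hball z hz)).2
      exact hd a (by linarith)
  · have hcl : closure (verticalStrip 0 1) ⊆ verticalClosedStrip 0 1 :=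
      closure_minimal (Set.preimage_mono Set.Ioo_subset_Icc_self)
        (isClosed_Icc.preimage Complex.continuous_re)
    refine ContinuousOn.mono ?_ hcl
    exact continuousOn_of_dominated (fun z _ => hmeas z)
      (fun z hz => .of_forall fun a => norm_mul_cpow_le (hr0 a) hz) hi
      (.of_forall fun a z hz => (hd a hz.2).continuousAt.continuousWithinAt)

end Holomorphy

end Interpolation

section RieszThorin

open Complex.HadamardThreeLines

variable {α : Type*} [MeasurableSpace α] {μ : Measure α}

lemma memLp_two_of_norm_le_sqrt {f : α → ℂ} {a : α → ℝ} (hf : Measurable f) (ha : Integrable a μ)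
    (ha0 : ∀ x, 0 ≤ a x) (h : ∀ x, ‖f x‖ ≤ √(a x)) :
    MemLp f 2 μ ∧ eLpNorm f 2 μ ≤ ENNReal.ofReal √(∫ x, a x ∂μ) := by
  have hsq : Integrable (fun x => ‖f x‖ ^ 2) μ :=
    ha.mono' (by fun_prop) (.of_forall fun x => by
      rw [Real.norm_of_nonneg (by positivity)]
      exact (Real.le_sqrt (norm_nonneg _) (ha0 x)).1 (h x))
  have hmem : MemLp f 2 μ := (memLp_two_iff_integrable_sq_norm hf.aestronglyMeasurable).2 hsq
  refine ⟨hmem, ?_⟩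
  rw [hmem.eLpNorm_eq_integral_rpow_norm (by norm_num) (by norm_num), Real.sqrt_eq_rpow]
  simp only [ENNReal.toReal_ofNat, Real.rpow_ofNat, one_div]
  gcongr
  exact fun x => (Real.le_sqrt (norm_nonneg _) (ha0 x)).1 (h x)

/-- The three lines argument: an integral operator with kernel bounded by `A`, which is bounded
by `B` on `L²`, tested against the analytic families interpolating between `L¹` and `L²`. -/
lemma norm_integral_kernel_interp_le [SFinite μ] {k : α × α → ℂ} (hk : Measurable k) {A B : ℝ}
    (hA : ∀ z, ‖k z‖ ≤ A) (hB0 : 0 ≤ B)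
    (hB : ∀ f : α → ℂ, MemLp f 2 μ →
      eLpNorm (fun x => ∫ y, k (x, y) * f y ∂μ) 2 μ ≤ ENNReal.ofReal B * eLpNorm f 2 μ)
    {σ τ : α → ℂ} (hσ : Measurable σ) (hτ : Measurable τ) (hσ1 : ∀ x, ‖σ x‖ ≤ 1)
    (hτ1 : ∀ x, ‖τ x‖ ≤ 1) {a b : α → ℝ} (ha : Measurable a) (hb : Measurable b)
    (ha0 : ∀ x, 0 ≤ a x) (hb0 : ∀ x, 0 ≤ b x) (hai : Integrable a μ) (hbi : Integrable b μ)
    (hai' : Integrable (fun x => √(a x)) μ) (hbi' : Integrable (fun x => √(b x)) μ)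
    {θ : ℝ} (hθ0 : 0 ≤ θ) (hθ1 : θ ≤ 1) :
    ‖∫ x, (∫ y, k (x, y) * (σ y * (a y : ℂ) ^ (1 - θ / 2 : ℂ)) ∂μ) *
        (τ x * (b x : ℂ) ^ (1 - θ / 2 : ℂ)) ∂μ‖ ≤
      (A * ((∫ x, a x ∂μ) * ∫ x, b x ∂μ)) ^ (1 - θ) *
        (B * √((∫ x, a x ∂μ) * ∫ x, b x ∂μ)) ^ θ := by
  set X := ∫ x, a x ∂μ
  set Y := ∫ x, b x ∂μ
  have hX : 0 ≤ X := integral_nonneg ha0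
  set w : α × α → ℂ := fun p => k p * (τ p.1 * σ p.2) with hw
  set r : α × α → ℝ := fun p => b p.1 * a p.2 with hr
  have hr0 : ∀ p, 0 ≤ r p := fun p => mul_nonneg (hb0 _) (ha0 _)
  have hwm : Measurable w := by fun_prop
  have hrm : Measurable r := by fun_prop
  have hwA : ∀ p, ‖w p‖ ≤ A := by
    intro p
    rw [hw, norm_mul, norm_mul]
    exact (mul_le_of_le_one_right (norm_nonneg _)
      (mul_le_one₀ (hτ1 _) (norm_nonneg _) (hσ1 _))).trans (hA p)
  have hi : Integrable (fun p => ‖w p‖ * (r p + √(r p))) (μ.prod μ) := by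
    refine (((hbi.mul_prod hai).add (hbi'.mul_prod hai')).const_mul A).mono' (by fun_prop)
      (.of_forall fun p => ?_)
    rw [Real.norm_of_nonneg (mul_nonneg (norm_nonneg _) (add_nonneg (hr0 p) (Real.sqrt_nonneg _))),
      hr, Real.sqrt_mul (hb0 _)]
    exact mul_le_mul_of_nonneg_right (hwA p)
      (add_nonneg (hr0 p) (mul_nonneg (Real.sqrt_nonneg _) (Real.sqrt_nonneg _)))
  have hH : ∀ z ∈ verticalClosedStrip 0 1, ∫ p, w p * (r p : ℂ) ^ (1 - z / 2) ∂μ.prod μ =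
      ∫ x, (∫ y, k (x, y) * (σ y * (a y : ℂ) ^ (1 - z / 2)) ∂μ) *
        (τ x * (b x : ℂ) ^ (1 - z / 2)) ∂μ := by
    intro z hz
    have hint : Integrable (fun p => w p * (r p : ℂ) ^ (1 - z / 2)) (μ.prod μ) :=
      hi.mono' (by fun_prop) (.of_forall fun p => norm_mul_cpow_le (hr0 p) hz)
    rw [integral_prod _ hint]
    congr 1
    ext x
    rw [← integral_mul_const]
    congr 1
    ext y
    simp only [hw, hr, ofReal_mul]
    rw [Complex.mul_cpow_ofReal_nonneg (hb0 _) (ha0 _)]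
    ring
  have h0 : ∀ z ∈ re ⁻¹' {0}, ‖∫ p, w p * (r p : ℂ) ^ (1 - z / 2) ∂μ.prod μ‖ ≤ A * (X * Y) := by
    intro z hz
    have hz : z.re = 0 := hz
    refine (norm_integral_le_of_norm_le ((hbi.mul_prod hai).const_mul A)
      (.of_forall fun p => ?_)).trans_eq ?_
    · have hre : (1 - z / 2).re = 1 := by simp [hz]
      rw [norm_mul, Complex.norm_cpow_eq_rpow_re_of_nonneg (hr0 p) (by rw [hre]; norm_num), hre,
        Real.rpow_one]
      exact mul_le_mul_of_nonneg_right (hwA p) (hr0 p)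
    · rw [integral_const_mul, integral_prod_mul, mul_comm X]
  have h1 : ∀ z ∈ re ⁻¹' {1},
      ‖∫ p, w p * (r p : ℂ) ^ (1 - z / 2) ∂μ.prod μ‖ ≤ B * √(X * Y) := by
    intro z hz
    have hz : z.re = 1 := hz
    have hnorm : ∀ {c : ℂ} {x : ℝ}, ‖c‖ ≤ 1 → 0 ≤ x → ‖c * (x : ℂ) ^ (1 - z / 2)‖ ≤ √x := by
      intro c x hc hx
      have hre : (1 - z / 2).re = 1 / 2 := by simp [hz]; norm_num
      rw [norm_mul, Complex.norm_cpow_eq_rpow_re_of_nonneg hx (by rw [hre]; norm_num), hre,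
        ← Real.sqrt_eq_rpow]
      exact mul_le_of_le_one_left (Real.sqrt_nonneg _) hc
    obtain ⟨hf, hf'⟩ := memLp_two_of_norm_le_sqrt (f := fun y => σ y * (a y : ℂ) ^ (1 - z / 2))
      (by fun_prop) hai ha0 fun y => hnorm (hσ1 y) (ha0 y)
    obtain ⟨hg, hg'⟩ := memLp_two_of_norm_le_sqrt (f := fun x => τ x * (b x : ℂ) ^ (1 - z / 2))
      (by fun_prop) hbi hb0 fun y => hnorm (hτ1 y) (hb0 y)
    have hm : AEStronglyMeasurable
        (fun x => ∫ y, k (x, y) * (σ y * (a y : ℂ) ^ (1 - z / 2)) ∂μ) μ := by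
      refine AEStronglyMeasurable.integral_prod_right'
        (f := fun p : α × α => k p * (σ p.2 * (a p.2 : ℂ) ^ (1 - z / 2))) ?_
      have : Measurable fun p : α × α => k p * (σ p.2 * (a p.2 : ℂ) ^ (1 - z / 2)) := by fun_prop
      exact this.aestronglyMeasurable
    rw [hH z ⟨by rw [hz]; norm_num, hz.le⟩]
    have h2 := (enorm_integral_mul_le_eLpNorm_two hm hg.1).trans
      (mul_le_mul' ((hB _ hf).trans (mul_le_mul' le_rfl hf')) hg')
    rw [← ENNReal.ofReal_mul hB0, ← ENNReal.ofReal_mul (by positivity), mul_assoc,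
      ← Real.sqrt_mul hX, ← ofReal_norm] at h2
    exact (ENNReal.ofReal_le_ofReal_iff (by positivity)).1 h2
  have hθ : (θ : ℂ) ∈ verticalClosedStrip 0 1 := ⟨by simpa using hθ0, by simpa using hθ1⟩
  have := norm_le_interp_of_mem_verticalClosedStrip₀₁' _ hθ
    (diffContOnCl_integral_mul_cpow hwm hrm hr0 hi) (bddAbove_norm_integral_mul_cpow hr0 hi) h0 h1
  rwa [hH _ hθ, ofReal_re] at this

end RieszThorin

section RieszThorinSchwartz

open scoped SchwartzMap

variable {E : Type*} [NormedAddCommGroup E] [InnerProductSpace ℝ E] [FiniteDimensional ℝ E]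
  [MeasurableSpace E] [BorelSpace E]

lemma integrable_norm_rpow (f : 𝓢(E, ℂ)) {s : ℝ} (hs : 0 < s) :
    Integrable fun x => ‖f x‖ ^ s := by
  have := (f.memLp (ENNReal.ofReal s) volume).integrable_norm_rpow (by simpa using hs) (by simp)
  rwa [ENNReal.toReal_ofReal hs.le] at this

lemma sqrt_rpow_eq {x : ℝ} (hx : 0 ≤ x) (s : ℝ) : √(x ^ s) = x ^ (s / 2) := by
  rw [Real.sqrt_eq_rpow, ← Real.rpow_mul hx]
  congr 1
  ring

/-- The Riesz–Thorin interpolation between the bounds `L¹ → L^∞` and `L² → L²` for the convolution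
with a Schwartz kernel. -/
lemma integral_norm_rpow_convolution_le {K u G : 𝓢(E, ℂ)} (hG : ∀ x, G x = ∫ y, K (x - y) * u y)
    {A B : ℝ} (hA : ∀ z, ‖K z‖ ≤ A) (hB0 : 0 ≤ B)
    (hB : ∀ f : E → ℂ, MemLp f 2 volume →
      eLpNorm (fun x => ∫ y, K (x - y) * f y) 2 volume ≤ ENNReal.ofReal B * eLpNorm f 2 volume)
    {p q : ℝ} (hpq : p.HolderConjugate q) (hp2 : p ≤ 2) :
    (∫ x, ‖G x‖ ^ q) ^ q⁻¹ ≤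
      A ^ (p⁻¹ - q⁻¹) * B ^ (1 - (p⁻¹ - q⁻¹)) * (∫ x, ‖u x‖ ^ p) ^ p⁻¹ := by
  have hp0 := hpq.pos
  have hq0 := hpq.symm.pos
  have hpq1 := hpq.inv_add_inv_eq_one
  have hA0 : 0 ≤ A := (norm_nonneg _).trans (hA 0)
  have hp2' : 2⁻¹ ≤ p⁻¹ := inv_anti₀ hp0 hp2
  have hq0' : 0 < q⁻¹ := inv_pos.2 hq0
  set θ : ℝ := 1 - (p⁻¹ - q⁻¹) with hθ
  have hexp : (1 - (θ : ℂ) / 2) = ((p⁻¹ : ℝ) : ℂ) := by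
    rw [← ofReal_ofNat, ← ofReal_one, ← ofReal_div, ← ofReal_sub]
    congr 1
    linarith
  have hKm := K.continuous
  have hum := u.continuous.measurable
  have hGm := G.continuous.measurable
  set X := ∫ x, ‖u x‖ ^ p
  set Y := ∫ x, ‖G x‖ ^ q
  have hX0 : 0 ≤ X := integral_nonneg fun _ => by positivity
  have hY0 : 0 ≤ Y := integral_nonneg fun _ => by positivity
  have hphase : ∀ c : ℂ, ‖c / (‖c‖ : ℂ)‖ ≤ 1 := by
    intro c
    rw [norm_div, Complex.norm_real, norm_norm]
    exact div_self_le_one _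
  have hroot : ∀ {x s : ℝ}, 0 ≤ x → ((x ^ s : ℝ) : ℂ) ^ ((p⁻¹ : ℝ) : ℂ) = (x ^ (s / p) : ℝ) := by
    intro x s hx
    rw [← ofReal_cpow (by positivity), ← Real.rpow_mul hx, div_eq_mul_inv]
  have key := norm_integral_kernel_interp_le (μ := (volume : Measure E))
    (k := fun p => K (p.1 - p.2)) (by fun_prop) (fun _ => hA _) hB0 hB
    (σ := fun y => u y / (‖u y‖ : ℂ)) (τ := fun x => conj (G x) / (‖G x‖ : ℂ)) (by fun_prop)
    (by fun_prop) (fun _ => hphase _) (fun x => by simpa using hphase (conj (G x)))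
    (a := fun y => ‖u y‖ ^ p) (b := fun x => ‖G x‖ ^ q) (by fun_prop) (by fun_prop)
    (fun _ => by positivity) (fun _ => by positivity) (integrable_norm_rpow u hp0)
    (integrable_norm_rpow G hq0)
    (by simpa only [sqrt_rpow_eq (norm_nonneg _)] using integrable_norm_rpow u (half_pos hp0))
    (by simpa only [sqrt_rpow_eq (norm_nonneg _)] using integrable_norm_rpow G (half_pos hq0))
    (θ := θ) (by linarith) (by linarith)
  simp only [hexp, hroot (norm_nonneg _), div_self hp0.ne', Real.rpow_one] at key
  have hu : ∀ y, u y / (‖u y‖ : ℂ) * (‖u y‖ : ℂ) = u y := fun y =>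
    div_mul_cancel_of_imp fun h => by simpa using h
  have hGτ : ∀ x, G x * (conj (G x) / (‖G x‖ : ℂ) * ((‖G x‖ ^ (q / p) : ℝ) : ℂ)) =
      ((‖G x‖ ^ q : ℝ) : ℂ) := by
    intro x
    rcases eq_or_ne (G x) 0 with h | h
    · simp [h, Real.zero_rpow hq0.ne']
    · have hn : 0 < ‖G x‖ := norm_pos_iff.2 h
      have hn0 : (‖G x‖ : ℂ) ≠ 0 := ofReal_ne_zero.2 hn.ne'
      have hqp : q = 1 + q / p := by
        rw [div_eq_mul_inv, eq_sub_of_add_eq hpq1]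
        field_simp
        ring
      nth_rewrite 2 [hqp]
      rw [Real.rpow_add hn, Real.rpow_one, ← mul_assoc, ← mul_div_assoc, Complex.mul_conj',
        ofReal_mul, pow_two, mul_div_cancel_right₀ _ hn0]
  simp only [hu, ← hG, hGτ] at key
  rw [integral_complex_ofReal, Complex.norm_real, Real.norm_of_nonneg hY0] at key
  have hexp' : 1 - θ = p⁻¹ - q⁻¹ := by rw [hθ]; ring
  have hkey : Y ≤ A ^ (p⁻¹ - q⁻¹) * B ^ θ * (X ^ p⁻¹ * Y ^ p⁻¹) := by
    refine key.trans_eq ?_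
    rw [Real.mul_rpow hA0 (by positivity), Real.mul_rpow hB0 (by positivity), Real.sqrt_eq_rpow,
      ← Real.rpow_mul (by positivity), mul_mul_mul_comm,
      ← Real.rpow_add_of_nonneg (by positivity) (by linarith) (by linarith), hexp',
      ← Real.mul_rpow hX0 hY0]
    congr 2
    linarith
  rcases hY0.eq_or_lt with hY | hY
  · rw [← hY, Real.zero_rpow hq0'.ne']
    positivity
  · have hYp : 0 < Y ^ p⁻¹ := by positivity
    refine le_of_mul_le_mul_right ?_ hYp
    rw [← Real.rpow_add hY, add_comm, hpq1, Real.rpow_one]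
    linarith

end RieszThorinSchwartz

/-- Dispersive `L^p → L^q` decay estimate for the frequency-localized evolution `e^{-itΛ}`
of the gravity water wave equation (Lemma `dispersive` (i) of the paper). -/
theorem stmt6 (ψ : EuclideanSpace ℝ (Fin 2) → ℂ) (hψ : ContDiff ℝ (⊤ : ℕ∞) ψ)
    (hsupp : tsupport ψ ⊆ {ξ : EuclideanSpace ℝ (Fin 2) | 1 / 4 ≤ ‖ξ‖ ∧ ‖ξ‖ ≤ 2}) :
    ∃ C : ℝ, 0 < C ∧
      ∀ (k : ℤ) (t : ℝ), 0 ≤ t →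
      ∀ p q : ℝ≥0∞, 1 ≤ p → p ≤ 2 → 2 ≤ q → 1 / p + 1 / q = 1 →
      ∀ u : SchwartzMap (EuclideanSpace ℝ (Fin 2)) ℂ,
        eLpNorm (fun x => ∫ y : EuclideanSpace ℝ (Fin 2), waveKernel ψ k t y * u (x - y))
            q volume ≤
          ENNReal.ofReal (C * ((2 : ℝ) ^ (2 * k) * (1 + (2 : ℝ) ^ ((k : ℝ) / 2) * t)⁻¹) ^
              (p⁻¹.toReal - q⁻¹.toReal)) *
            eLpNorm (⇑u) p volume := by
  obtain ⟨C₀, hC₀, hker⟩ := exists_norm_unit_kernel_le finrank_euclideanSpace_fin hψ hsupp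
  obtain ⟨B, hB, hmul⟩ := exists_waveKernel_eq_fourierInv hψ hsupp
  refine ⟨max C₀ 1 * max B 1, by positivity, fun k t ht p q hp1 hp2 hq2 hpq u => ?_⟩
  obtain ⟨M, hM, hKM⟩ := hmul k t
  set D : ℝ := (2 : ℝ) ^ (2 * k) * (1 + (2 : ℝ) ^ ((k : ℝ) / 2) * t)⁻¹ with hD
  have hD0 : 0 < D := by positivity
  have hK : ∀ z, ‖FourierTransformInv.fourierInv M z‖ ≤ C₀ * D := by
    intro z
    rw [← hKM, waveKernel_eq, norm_smul, Real.norm_of_nonneg (by positivity)]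
    calc _ ≤ (2 : ℝ) ^ (2 * k) * (C₀ * (1 + (2 : ℝ) ^ ((k : ℝ) / 2) * t)⁻¹) := by
          gcongr
          exact hker _ _ (by positivity)
      _ = C₀ * D := by rw [hD]; ring
  simp_rw [hKM]
  set K : SchwartzMap (EuclideanSpace ℝ (Fin 2)) ℂ := FourierTransformInv.fourierInv M
  set conv := SchwartzMap.convolution (ContinuousLinearMap.mul ℂ ℂ) K
  have hconv : ∀ v x, conv v x = ∫ y, K y * v (x - y) := fun v x =>
    SchwartzMap.convolution_apply _ K v x
  have hconv' : ∀ v x, conv v x = ∫ y, K (x - y) * v y := fun v x =>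
    (SchwartzMap.convolution_apply _ K v x).trans convolution_mul_swap
  simp_rw [← hconv]
  have hexp : 0 ≤ p⁻¹.toReal - q⁻¹.toReal := by
    rw [sub_nonneg]
    refine ENNReal.toReal_mono ?_ (ENNReal.inv_le_inv.2 (hp2.trans hq2))
    simpa using (zero_lt_one.trans_le hp1).ne'
  rw [one_div, one_div] at hpq
  rcases hp1.eq_or_lt with rfl | hp1'
  · have hq : q = ⊤ := by
      rw [inv_one] at hpq
      have h0 : q⁻¹ = 0 :=
        (ENNReal.add_right_inj ENNReal.one_ne_top).1 (hpq.trans (add_zero 1).symm)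
      exact ENNReal.inv_eq_zero.1 h0
    subst hq
    rw [eLpNorm_exponent_top, eLpNorm_one_eq_lintegral_enorm]
    refine eLpNormEssSup_le_of_ae_enorm_bound (.of_forall fun x => ?_)
    rw [hconv']
    refine (enorm_integral_le_lintegral_enorm _).trans ?_
    rw [← lintegral_const_mul _ (by fun_prop)]
    refine lintegral_mono fun y => ?_
    rw [enorm_mul, ← ofReal_norm (K _)]
    gcongr
    refine (hK _).trans ?_
    simp only [inv_one, ENNReal.toReal_one, ENNReal.inv_top, ENNReal.toReal_zero, sub_zero,
      Real.rpow_one]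
    gcongr
    exact (le_max_left C₀ 1).trans (le_mul_of_one_le_right (by positivity) (le_max_right _ _))
  · have hp_top : p ≠ ⊤ := (hp2.trans_lt (by norm_num)).ne
    have hp_zero : p ≠ 0 := (zero_lt_one.trans hp1').ne'
    have hq_zero : q ≠ 0 := (lt_of_lt_of_le (by norm_num) hq2).ne'
    have hq_top : q ≠ ⊤ := by
      rintro rfl
      rw [ENNReal.inv_top, add_zero, ENNReal.inv_eq_one] at hpq
      exact hp1'.ne' hpq
    have hPQ : p.toReal.HolderConjugate q.toReal := by
      rw [Real.holderConjugate_iff]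
      constructor
      · simpa using (ENNReal.toReal_lt_toReal ENNReal.one_ne_top hp_top).2 hp1'
      · rw [← ENNReal.toReal_inv, ← ENNReal.toReal_inv, ← ENNReal.toReal_add
          (ENNReal.inv_ne_top.2 hp_zero) (ENNReal.inv_ne_top.2 hq_zero), hpq, ENNReal.toReal_one]
    have hP2 : p.toReal ≤ 2 := by simpa using ENNReal.toReal_mono (by norm_num) hp2
    have hL2 : ∀ f, MemLp f 2 volume → eLpNorm (fun x => ∫ y, K (x - y) * f y) 2 volume ≤
        ENNReal.ofReal B * eLpNorm f 2 volume := fun f hf =>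
      eLpNorm_integral_kernel_two_le ENNReal.ofReal_ne_top (fun v => by
        simp_rw [← hconv']
        exact eLpNorm_convolution_two_le hM v) hf
    have hmain := integral_norm_rpow_convolution_le (hconv' u) hK hB.le hL2 hPQ hP2
    rw [((conv u).memLp q volume).eLpNorm_eq_integral_rpow_norm hq_zero hq_top,
      (u.memLp p volume).eLpNorm_eq_integral_rpow_norm hp_zero hp_top,
      ← ENNReal.ofReal_mul (by positivity)]
    refine ENNReal.ofReal_le_ofReal (hmain.trans ?_)
    rw [← ENNReal.toReal_inv, ← ENNReal.toReal_inv]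
    set s := p⁻¹.toReal - q⁻¹.toReal
    have hs1 : s ≤ 1 := by
      have h1 : p⁻¹.toReal ≤ 1 := ENNReal.toReal_le_of_le_ofReal zero_le_one (by simpa using hp1)
      have h2 : 0 ≤ q⁻¹.toReal := ENNReal.toReal_nonneg
      linarith
    have hmax : ∀ {a r : ℝ}, 0 ≤ a → 0 ≤ r → r ≤ 1 → a ^ r ≤ max a 1 := by
      intro a r ha hr0 hr1
      calc a ^ r ≤ max a 1 ^ r := by gcongr; exact le_max_left _ _
        _ ≤ max a 1 ^ (1 : ℝ) := Real.rpow_le_rpow_of_exponent_le (le_max_right _ _) hr1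
        _ = max a 1 := Real.rpow_one _
    refine mul_le_mul_of_nonneg_right ?_ (by positivity)
    rw [Real.mul_rpow hC₀.le hD0.le, mul_right_comm]
    gcongr
    · exact hmax hC₀.le hexp hs1
    · exact hmax hB.le (by linarith) (by linarith)

end
end
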